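/- Let (a_n)_{n≥1} be a sequence of rational numbers such that f(t) = ∑_{n≥1} a_n t^{n-1} ∈ ℚ[[t]] is algebraic over ℚ(t). Then the following two conditions are equivalent: (i) for all but finitely many primes p, a_{np} − a_n ∈ p ℤ_(p) for all n ≥ 1; (ii) for all but finitely many primes p, a_{np} − a_n ∈ n p ℤ_(p) for all n ≥ 1. -/

import Mathlib

open PowerSeries

/-- A formal power series `g ∈ ℚ[[t]]` is algebraic over `ℚ(t)` if there exists a nonzero
polynomial `P ∈ ℚ[x][y]` with `P(t, g(t)) = 0`. -/
def IsAlgebraicPS (g : PowerSeries ℚ) : Prop :=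
  ∃ P : Polynomial (Polynomial ℚ), P ≠ 0 ∧
    Polynomial.eval₂ Polynomial.coeToPowerSeries.ringHom g P = 0

/-- `x ∈ ℤ_(p)`, the localization of `ℤ` at the prime `(p)`: the (reduced) denominator of the
rational number `x` is not divisible by `p`. -/
def MemZp (p : ℕ) (x : ℚ) : Prop := ¬ p ∣ x.den

/-- `x ∈ p ℤ_(p)`. -/
def MemPZp (p : ℕ) (x : ℚ) : Prop := ∃ y : ℚ, MemZp p y ∧ x = p * y

/-- `x ∈ n p ℤ_(p)`. -/
def MemNPZp (n p : ℕ) (x : ℚ) : Prop := ∃ y : ℚ, MemZp p y ∧ x = n * p * y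

section

/-- A submultiplicative, subadditive, extended-nonnegative size function on a `ℚ`-algebra. -/
structure SubNorm (R : Type*) [CommRing R] [Algebra ℚ R] where
  toFun : R → ENNReal
  add_le : ∀ x y, toFun (x + y) ≤ toFun x + toFun y
  mul_le : ∀ x y, toFun (x * y) ≤ toFun x * toFun y
  one_le : toFun 1 ≤ 1
  smul_le : ∀ (q : ℚ) x, toFun (q • x) ≤ ‖q‖ₑ * toFun x

/-- Coefficients of Laurent series commute with rational scalars. -/
lemma HahnSeries.coeff_algebraMap_rat_mul {R : Type*} [CommRing R] [Algebra ℚ R]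
    [Algebra ℚ (LaurentSeries R)] (q : ℚ)
    (x : LaurentSeries R) (m : ℤ) :
    (algebraMap ℚ (LaurentSeries R) q * x).coeff m = q • x.coeff m := by
  have h : algebraMap ℚ (LaurentSeries R) = (HahnSeries.C).comp (algebraMap ℚ R) :=
    Subsingleton.elim _ _
  rw [h, RingHom.comp_apply, HahnSeries.C_mul_eq_smul, HahnSeries.coeff_smul, smul_eq_mul,
    Algebra.smul_def]

namespace SubNorm

section basic
variable {R : Type*} [CommRing R] [Algebra ℚ R]

instance : CoeFun (SubNorm R) (fun _ => R → ENNReal) := ⟨SubNorm.toFun⟩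

variable (N : SubNorm R)

lemma zero : N 0 = 0 := by
  have := N.smul_le 0 0
  simpa using this

lemma neg_le (x : R) : N (-x) ≤ N x := by
  have := N.smul_le (-1) x
  simpa using this

lemma sum_le {ι : Type*} (s : Finset ι) (f : ι → R) : N (∑ i ∈ s, f i) ≤ ∑ i ∈ s, N (f i) := by
  classical
  induction s using Finset.induction_on with
  | empty => simp [N.zero]
  | insert a s ha ih =>
    rw [Finset.sum_insert ha, Finset.sum_insert ha]
    exact (N.add_le _ _).trans (by gcongr)

lemma prod_le {ι : Type*} (s : Finset ι) (f : ι → R) : N (∏ i ∈ s, f i) ≤ ∏ i ∈ s, N (f i) := by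
  classical
  induction s using Finset.induction_on with
  | empty => simp [N.one_le]
  | insert a s ha ih =>
    rw [Finset.prod_insert ha, Finset.prod_insert ha]
    exact (N.mul_le _ _).trans (by gcongr)

lemma pow_le (x : R) (n : ℕ) : N (x ^ n) ≤ N x ^ n := by
  simpa using N.prod_le (Finset.range n) (fun _ => x)

lemma sum_lt_top {ι : Type*} (s : Finset ι) (f : ι → R) (h : ∀ i ∈ s, N (f i) < ⊤) :
    N (∑ i ∈ s, f i) < ⊤ :=
  (N.sum_le s f).trans_lt (ENNReal.sum_lt_top.2 h)

lemma mul_lt_top {x y : R} (hx : N x < ⊤) (hy : N y < ⊤) : N (x * y) < ⊤ :=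
  (N.mul_le x y).trans_lt (ENNReal.mul_lt_top hx hy)

lemma add_lt_top {x y : R} (hx : N x < ⊤) (hy : N y < ⊤) : N (x + y) < ⊤ :=
  (N.add_le x y).trans_lt (ENNReal.add_lt_top.2 ⟨hx, hy⟩)

lemma pow_lt_top {x : R} (hx : N x < ⊤) (n : ℕ) : N (x ^ n) < ⊤ :=
  (N.pow_le x n).trans_lt (ENNReal.pow_lt_top hx)

lemma one_lt_top : N 1 < ⊤ := N.one_le.trans_lt (by simp)

end basic

/-- Weighted convolution estimate. -/
lemma tsum_conv_le {Γ : Type*} [AddCommMonoid Γ] (w : Γ → ENNReal)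
    (hw : ∀ a b, w (a + b) = w a * w b) (u v z : Γ → ENNReal) (S : Γ → Finset (Γ × Γ))
    (hS : ∀ γ, ∀ p ∈ S γ, p.1 + p.2 = γ) (hz : ∀ γ, z γ ≤ ∑ p ∈ S γ, u p.1 * v p.2) :
    ∑' γ, z γ * w γ ≤ (∑' γ, u γ * w γ) * (∑' γ, v γ * w γ) := by
  classical
  have h1 : ∀ γ, z γ * w γ ≤ ∑' p : Γ × Γ,
      if p.1 + p.2 = γ then (u p.1 * w p.1) * (v p.2 * w p.2) else 0 := by
    intro γ
    calc z γ * w γ ≤ (∑ p ∈ S γ, u p.1 * v p.2) * w γ := by gcongr; exact hz γ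
      _ = ∑ p ∈ S γ, if p.1 + p.2 = γ then (u p.1 * w p.1) * (v p.2 * w p.2) else 0 := by
          rw [Finset.sum_mul]
          refine Finset.sum_congr rfl fun p hp => ?_
          rw [if_pos (hS γ p hp), ← hS γ p hp, hw]
          ring
      _ ≤ _ := ENNReal.sum_le_tsum _
  calc ∑' γ, z γ * w γ ≤ ∑' γ, ∑' p : Γ × Γ,
      (if p.1 + p.2 = γ then (u p.1 * w p.1) * (v p.2 * w p.2) else 0) :=
        ENNReal.tsum_le_tsum h1
    _ = ∑' p : Γ × Γ, ∑' γ,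
      (if p.1 + p.2 = γ then (u p.1 * w p.1) * (v p.2 * w p.2) else 0) := ENNReal.tsum_comm
    _ = ∑' p : Γ × Γ, (u p.1 * w p.1) * (v p.2 * w p.2) := by
        refine tsum_congr fun p => ?_
        rw [tsum_eq_single (p.1 + p.2)]
        · simp
        · intro b hb; simp [hb.symm]
    _ = (∑' γ, u γ * w γ) * (∑' γ, v γ * w γ) := by
        rw [ENNReal.tsum_prod (f := fun a b => (u a * w a) * (v b * w b)), ← ENNReal.tsum_mul_right]
        refine tsum_congr fun a => ?_
        rw [ENNReal.tsum_mul_left]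

/-- The usual absolute value on `ℚ`. -/
noncomputable def rat : SubNorm ℚ where
  toFun q := ‖q‖ₑ
  add_le x y := enorm_add_le x y
  mul_le x y := by rw [enorm_mul]
  one_le := by simp
  smul_le q x := by rw [smul_eq_mul, enorm_mul]

@[simp] lemma rat_apply (q : ℚ) : rat q = ‖q‖ₑ := rfl

/-- The `ℓ¹` norm of the coefficients of a multivariate polynomial. -/
noncomputable def mvPoly (σ : Type*) : SubNorm (MvPolynomial σ ℚ) where
  toFun p := ∑' m, ‖MvPolynomial.coeff m p‖ₑ
  add_le x y := by
    rw [← ENNReal.tsum_add]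
    refine ENNReal.tsum_le_tsum fun m => ?_
    rw [MvPolynomial.coeff_add]
    exact enorm_add_le _ _
  mul_le x y := by
    classical
    have := tsum_conv_le (Γ := σ →₀ ℕ) (fun _ => 1) (by simp)
      (fun m => ‖MvPolynomial.coeff m x‖ₑ) (fun m => ‖MvPolynomial.coeff m y‖ₑ)
      (fun m => ‖MvPolynomial.coeff m (x * y)‖ₑ) (fun m => Finset.HasAntidiagonal.antidiagonal m)
      (fun γ p hp => Finset.HasAntidiagonal.mem_antidiagonal.1 hp) (fun γ => by
        rw [MvPolynomial.coeff_mul]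
        refine (enorm_sum_le _ _).trans (Finset.sum_le_sum fun p _ => ?_)
        rw [enorm_mul])
    simpa using this
  one_le := by
    classical
    rw [tsum_eq_single 0]
    · simp
    · intro m hm
      rw [MvPolynomial.coeff_one, if_neg (Ne.symm hm)]; simp
  smul_le q x := by
    rw [← ENNReal.tsum_mul_left]
    refine ENNReal.tsum_le_tsum fun m => ?_
    rw [MvPolynomial.coeff_smul, smul_eq_mul, enorm_mul]

lemma mvPoly_apply {σ : Type*} (p : MvPolynomial σ ℚ) :
    mvPoly σ p = ∑' m, ‖MvPolynomial.coeff m p‖ₑ := rfl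

lemma mvPoly_lt_top {σ : Type*} (p : MvPolynomial σ ℚ) : mvPoly σ p < ⊤ := by
  rw [mvPoly_apply, tsum_eq_sum (s := p.support)]
  · exact ENNReal.sum_lt_top.2 fun m _ => by simp
  · intro m hm
    rw [MvPolynomial.notMem_support_iff.1 hm]; simp

lemma enorm_coeff_le_mvPoly {σ : Type*} (p : MvPolynomial σ ℚ) (m : σ →₀ ℕ) :
    ‖MvPolynomial.coeff m p‖ₑ ≤ mvPoly σ p := ENNReal.le_tsum m

section ext
variable {R : Type*} [CommRing R] [Algebra ℚ R] (N : SubNorm R)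

/-- The weighted `ℓ¹` norm on power series. -/
noncomputable def ps (ρ : NNReal) : SubNorm R⟦X⟧ where
  toFun z := ∑' n, N (coeff n z) * (ρ : ENNReal) ^ n
  add_le x y := by
    rw [← ENNReal.tsum_add]
    refine ENNReal.tsum_le_tsum fun m => ?_
    rw [map_add, ← add_mul]
    gcongr
    exact N.add_le _ _
  mul_le x y := by
    refine tsum_conv_le (Γ := ℕ) (fun n => (ρ : ENNReal) ^ n) (fun a b => pow_add _ _ _)
      (fun m => N (coeff m x)) (fun m => N (coeff m y))
      (fun m => N (coeff m (x * y))) (fun m => Finset.HasAntidiagonal.antidiagonal m)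
      (fun γ p hp => Finset.HasAntidiagonal.mem_antidiagonal.1 hp) (fun γ => ?_)
    rw [PowerSeries.coeff_mul]
    exact (N.sum_le _ _).trans (Finset.sum_le_sum fun p _ => N.mul_le _ _)
  one_le := by
    rw [tsum_eq_single 0]
    · simpa using N.one_le
    · intro m hm
      rw [PowerSeries.coeff_one, if_neg hm, N.zero, zero_mul]
  smul_le q x := by
    rw [← ENNReal.tsum_mul_left]
    refine ENNReal.tsum_le_tsum fun m => ?_
    rw [← mul_assoc]
    gcongr
    rw [show coeff m (q • x) = q • coeff m x from rfl]
    exact N.smul_le _ _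

lemma ps_apply (ρ : NNReal) (z : R⟦X⟧) :
    N.ps ρ z = ∑' n, N (coeff n z) * (ρ : ENNReal) ^ n := rfl

lemma coeff_le_ps (ρ : NNReal) (z : R⟦X⟧) (n : ℕ) :
    N (coeff n z) * (ρ : ENNReal) ^ n ≤ N.ps ρ z :=
  ENNReal.le_tsum (f := fun n => N (coeff n z) * (ρ : ENNReal) ^ n) n

/-- The weighted `ℓ¹` norm on Laurent series. -/
noncomputable def ls (r : NNReal) (hr : r ≠ 0) : SubNorm (LaurentSeries R) where
  toFun z := ∑' e : ℤ, N (z.coeff e) * (r : ENNReal) ^ e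
  add_le x y := by
    rw [← ENNReal.tsum_add]
    refine ENNReal.tsum_le_tsum fun m => ?_
    rw [HahnSeries.coeff_add, ← add_mul]
    gcongr
    exact N.add_le _ _
  mul_le x y := by
    refine tsum_conv_le (Γ := ℤ) (fun n => (r : ENNReal) ^ n)
      (fun a b => ENNReal.zpow_add (by simpa using hr) (by simp) _ _)
      (fun m => N (x.coeff m)) (fun m => N (y.coeff m))
      (fun m => N ((x * y).coeff m)) (fun m => Finset.antidiagonal x.isPWO_support y.isPWO_support m)
      (fun γ p hp => (Finset.mem_antidiagonal.1 hp).2.2) (fun γ => ?_)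
    rw [HahnSeries.coeff_mul]
    exact (N.sum_le _ _).trans (Finset.sum_le_sum fun p _ => N.mul_le _ _)
  one_le := by
    rw [tsum_eq_single 0]
    · simpa using N.one_le
    · intro m hm
      rw [HahnSeries.coeff_one, if_neg hm, N.zero, zero_mul]
  smul_le q x := by
    rw [← ENNReal.tsum_mul_left]
    refine ENNReal.tsum_le_tsum fun m => ?_
    rw [← mul_assoc]
    gcongr
    rw [Algebra.smul_def, HahnSeries.coeff_algebraMap_rat_mul]
    exact N.smul_le _ _

lemma ls_apply (r : NNReal) (hr : r ≠ 0) (z : LaurentSeries R) :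
    N.ls r hr z = ∑' e : ℤ, N (z.coeff e) * (r : ENNReal) ^ e := rfl

lemma coeff_le_ls (r : NNReal) (hr : r ≠ 0) (z : LaurentSeries R) (e : ℤ) :
    N (z.coeff e) * (r : ENNReal) ^ e ≤ N.ls r hr z :=
  ENNReal.le_tsum (f := fun n : ℤ => N (z.coeff n) * (r : ENNReal) ^ n) e

end ext
end SubNorm

end

section

namespace PowerSeries

section
variable {S : Type*} [CommRing S] [Algebra ℚ S]

/-- Substitution of a power series without constant term into `∑ cᵢ Tⁱ`, with `cᵢ ∈ ℚ`. -/
noncomputable def ratComp (c : ℕ → ℚ) (z : S⟦X⟧) : S⟦X⟧ :=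
  mk fun n => ∑ i ∈ Finset.range (n + 1), c i • coeff n (z ^ i)

omit [Algebra ℚ S] in
lemma coeff_pow_eq_zero {z : S⟦X⟧} (hz : constantCoeff z = 0) {n i : ℕ} (h : n < i) :
    coeff n (z ^ i) = 0 :=
  coeff_of_lt_order n (by
    refine lt_of_lt_of_le ?_ (le_order_pow_of_constantCoeff_eq_zero i hz)
    exact_mod_cast h)

lemma coeff_ratComp_of_lt (c : ℕ → ℚ) {z : S⟦X⟧} (hz : constantCoeff z = 0) {n N : ℕ} (h : n < N) :
    coeff n (ratComp c z) = ∑ i ∈ Finset.range N, c i • coeff n (z ^ i) := by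
  rw [ratComp, coeff_mk]
  refine Finset.sum_subset (Finset.range_mono h) fun i _ hi => ?_
  rw [coeff_pow_eq_zero hz (by simpa using hi), smul_zero]

lemma X_pow_dvd_ratComp_sub (c : ℕ → ℚ) {z : S⟦X⟧} (hz : constantCoeff z = 0) (N : ℕ) :
    (X : S⟦X⟧) ^ N ∣ ratComp c z - ∑ i ∈ Finset.range N, c i • z ^ i := by
  rw [X_pow_dvd_iff]
  intro m hm
  rw [map_sub, coeff_ratComp_of_lt c hz hm, map_sum]
  simp [map_rat_smul (coeff m : S⟦X⟧ →ₗ[S] S)]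

omit [Algebra ℚ S] in
lemma eq_of_forall_X_pow_dvd {u v : S⟦X⟧} (h : ∀ N : ℕ, (X : S⟦X⟧) ^ N ∣ u - v) : u = v := by
  ext n
  have := X_pow_dvd_iff.1 (h (n + 1)) n (Nat.lt_succ_self n)
  rwa [map_sub, sub_eq_zero] at this

@[simp] lemma constantCoeff_ratComp (c : ℕ → ℚ) (z : S⟦X⟧) :
    constantCoeff (ratComp c z) = algebraMap ℚ S (c 0) := by
  rw [← coeff_zero_eq_constantCoeff_apply, ratComp, coeff_mk]
  simp [Algebra.smul_def]

lemma map_ratComp {T : Type*} [CommRing T] [Algebra ℚ T] (ψ : S⟦X⟧ →+* T⟦X⟧) (c : ℕ → ℚ) {z : S⟦X⟧}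
    (hψ : ∀ n z, (X : S⟦X⟧) ^ n ∣ z → (X : T⟦X⟧) ^ n ∣ ψ z)
    (hz : constantCoeff z = 0) : ψ (ratComp c z) = ratComp c (ψ z) := by
  have hz' : constantCoeff (ψ z) = 0 := by
    have := hψ 1 z (by simpa [X_dvd_iff] using hz)
    simpa [X_dvd_iff] using this
  refine eq_of_forall_X_pow_dvd fun N => ?_
  have h1 := hψ N _ (X_pow_dvd_ratComp_sub c hz N)
  have h2 := X_pow_dvd_ratComp_sub c hz' N
  have : ψ (ratComp c z) - ratComp c (ψ z) = ψ (ratComp c z - ∑ i ∈ Finset.range N, c i • z ^ i)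
      - (ratComp c (ψ z) - ∑ i ∈ Finset.range N, c i • (ψ z) ^ i) := by
    simp [map_sum, map_rat_smul ψ]
  rw [this]
  exact dvd_sub h1 h2

lemma derivative_ratComp (c : ℕ → ℚ) {z : S⟦X⟧} (hz : constantCoeff z = 0) :
    d⁄dX S (ratComp c z) = ratComp (fun i => (i + 1) * c (i + 1)) z * d⁄dX S z := by
  have key : ∀ N : ℕ, (X : S⟦X⟧) ^ N ∣ d⁄dX S (ratComp c z) -
      (∑ i ∈ Finset.range N, ((i + 1) * c (i + 1) : ℚ) • z ^ i) * d⁄dX S z := by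
    intro N
    have h1 : (X : S⟦X⟧) ^ N ∣ d⁄dX S (ratComp c z - ∑ i ∈ Finset.range (N + 1), c i • z ^ i) := by
      rw [X_pow_dvd_iff]
      intro m hm
      rw [coeff_derivative, X_pow_dvd_iff.1 (X_pow_dvd_ratComp_sub c hz (N + 1)) (m + 1) (by omega),
        zero_mul]
    have h2 : d⁄dX S (∑ i ∈ Finset.range (N + 1), c i • z ^ i) =
        (∑ i ∈ Finset.range N, ((i + 1) * c (i + 1) : ℚ) • z ^ i) * d⁄dX S z := by
      rw [map_sum, Finset.sum_range_succ', Finset.sum_mul]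
      have h0 : d⁄dX S (c 0 • z ^ 0) = 0 := by
        rw [map_rat_smul (d⁄dX S), pow_zero, Derivation.map_one_eq_zero, smul_zero]
      rw [h0, add_zero]
      refine Finset.sum_congr rfl fun i _ => ?_
      rw [map_rat_smul (d⁄dX S), Derivation.leibniz_pow, Nat.add_sub_cancel, smul_mul_assoc,
        mul_comm ((i : ℚ) + 1), mul_smul, smul_eq_mul]
      congr 1
      rw [← Nat.cast_succ, Nat.cast_smul_eq_nsmul]
    rwa [map_sub, h2] at h1
  refine eq_of_forall_X_pow_dvd fun N => ?_
  have h2 := (X_pow_dvd_ratComp_sub (fun i => ((i : ℚ) + 1) * c (i + 1)) hz N).mul_right (d⁄dX S z)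
  have := dvd_sub (key N) h2
  convert this using 1
  ring

omit [Algebra ℚ S] in
lemma eq_zero_of_derivative_eq_mul [IsAddTorsionFree S] {u b : S⟦X⟧} (h : d⁄dX S u = b * u)
    (h0 : constantCoeff u = 0) : u = 0 := by
  ext n
  rw [map_zero]
  induction n using Nat.strong_induction_on with
  | _ n ih =>
  cases n with
  | zero => simpa using h0
  | succ n =>
    have h1 := congrArg (coeff n) h
    rw [coeff_derivative, coeff_mul, Finset.sum_eq_zero] at h1
    · have h2 : (n + 1) • coeff (n + 1) u = 0 := by
        rw [nsmul_eq_mul]; push_cast; rw [mul_comm]; exact h1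
      exact (nsmul_eq_zero_iff_right (by omega)).1 h2
    · intro p hp
      rw [ih p.2 (by have := Finset.HasAntidiagonal.mem_antidiagonal.1 hp; omega), mul_zero]

omit [Algebra ℚ S] in
lemma eq_of_derivative_eq_mul [IsAddTorsionFree S] {u v b : S⟦X⟧} (hu : d⁄dX S u = b * u)
    (hv : d⁄dX S v = b * v) (h0 : constantCoeff u = constantCoeff v) : u = v := by
  rw [← sub_eq_zero]
  refine eq_zero_of_derivative_eq_mul (b := b) ?_ ?_
  · rw [map_sub, hu, hv]; ring
  · rw [map_sub, h0, sub_self]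

/-- Exponential of a power series without constant term. -/
noncomputable def Exp (z : S⟦X⟧) : S⟦X⟧ := ratComp (fun i => 1 / (i.factorial : ℚ)) z

/-- `Log u` is the logarithm of `1 + u`, for a power series `u` without constant term. -/
noncomputable def Log (u : S⟦X⟧) : S⟦X⟧ := ratComp (fun i => (-1) ^ (i + 1) / (i : ℚ)) u

@[simp] lemma constantCoeff_Exp (z : S⟦X⟧) : constantCoeff (Exp z) = 1 := by
  simp [Exp]

@[simp] lemma constantCoeff_Log (z : S⟦X⟧) : constantCoeff (Log z) = 0 := by
  simp [Log]

lemma derivative_Exp {z : S⟦X⟧} (hz : constantCoeff z = 0) :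
    d⁄dX S (Exp z) = d⁄dX S z * Exp z := by
  rw [Exp, derivative_ratComp _ hz, mul_comm]
  congr 2
  funext i
  rw [Nat.factorial_succ]
  push_cast
  field_simp

lemma ratComp_geom {u : S⟦X⟧} (hu : constantCoeff u = 0) :
    ratComp (fun i => (-1) ^ i) u * (1 + u) = 1 := by
  refine eq_of_forall_X_pow_dvd fun N => ?_
  have h1 := (X_pow_dvd_ratComp_sub (fun i => (-1) ^ i) hu N).mul_right (1 + u)
  have h2 : (X : S⟦X⟧) ^ N ∣ (∑ i ∈ Finset.range N, ((-1 : ℚ) ^ i) • u ^ i) * (1 + u) - 1 := by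
    have h3 : ∑ i ∈ Finset.range N, ((-1 : ℚ) ^ i) • u ^ i = ∑ i ∈ Finset.range N, (-u) ^ i := by
      refine Finset.sum_congr rfl fun i _ => ?_
      rw [neg_pow u, Algebra.smul_def]; simp
    have h4 := geom_sum_mul (-u) N
    have h5 : (∑ i ∈ Finset.range N, (-u) ^ i) * (1 + u) - 1 = - (-u) ^ N := by
      linear_combination -h4
    rw [h3, h5, dvd_neg]
    exact pow_dvd_pow_of_dvd (by simpa [X_dvd_iff] using hu) N
  have := dvd_add h1 h2
  convert this using 1
  ring

lemma derivative_Log {u : S⟦X⟧} (hu : constantCoeff u = 0) :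
    d⁄dX S (Log u) * (1 + u) = d⁄dX S u := by
  have h : (fun i : ℕ => ((i : ℚ) + 1) * ((-1) ^ ((i + 1) + 1) / ((i + 1 : ℕ) : ℚ))) =
      fun i => (-1) ^ i := by
    funext i
    push_cast
    field_simp
    ring
  rw [Log, derivative_ratComp _ hu, h, mul_assoc, mul_comm (d⁄dX S u), ← mul_assoc, ratComp_geom hu, one_mul]

lemma Exp_add {z w : S⟦X⟧} (hz : constantCoeff z = 0) (hw : constantCoeff w = 0) :
    Exp (z + w) = Exp z * Exp w := by
  have : IsAddTorsionFree S := IsAddTorsionFree.of_module_rat S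
  refine eq_of_derivative_eq_mul (b := d⁄dX S (z + w)) ?_ ?_ ?_
  · exact derivative_Exp (by simp [hz, hw])
  · rw [Derivation.leibniz, derivative_Exp hz, derivative_Exp hw, map_add]
    simp only [smul_eq_mul]; ring
  · simp

lemma Exp_Log {u : S⟦X⟧} (hu : constantCoeff u = 0) : Exp (Log u) = 1 + u := by
  have : IsAddTorsionFree S := IsAddTorsionFree.of_module_rat S
  refine eq_of_derivative_eq_mul (b := d⁄dX S (Log u)) ?_ ?_ ?_
  · exact derivative_Exp (by simp)
  · rw [map_add, Derivation.map_one_eq_zero, zero_add, derivative_Log hu]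
  · simp [hu]

lemma Log_Exp_sub_one {z : S⟦X⟧} (hz : constantCoeff z = 0) : Log (Exp z - 1) = z := by
  have : IsAddTorsionFree S := IsAddTorsionFree.of_module_rat S
  have hu : constantCoeff (Exp z - 1) = 0 := by simp
  refine derivative.ext ?_ (by simp [hz])
  have h1 := derivative_Log hu
  rw [map_sub, Derivation.map_one_eq_zero, sub_zero, derivative_Exp hz] at h1
  have h2 : IsUnit (Exp z) := by
    rw [isUnit_iff_constantCoeff]; simp
  exact h2.mul_right_cancel (by rw [← h1]; ring)

@[simp] lemma Exp_zero : Exp (0 : S⟦X⟧) = 1 := by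
  have := Exp_Log (S := S) (u := 0) (by simp)
  have h : Log (0 : S⟦X⟧) = 0 := by
    ext n
    rw [Log, ratComp, coeff_mk, map_zero]
    refine Finset.sum_eq_zero fun i _ => ?_
    rcases i with _ | i <;> simp
  rw [h] at this
  simpa using this

lemma Exp_nsmul {z : S⟦X⟧} (hz : constantCoeff z = 0) (n : ℕ) : Exp (n • z) = Exp z ^ n := by
  induction n with
  | zero => simp
  | succ n ih => rw [succ_nsmul, Exp_add (by simp [hz]) hz, ih, pow_succ]

lemma Exp_neg_mul {z : S⟦X⟧} (hz : constantCoeff z = 0) : Exp (-z) * Exp z = 1 := by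
  rw [← Exp_add (by simp [hz]) hz]; simp

end
end PowerSeries

end

/-- Evaluation of a polynomial over `ℚ[t]` at a power series. -/
noncomputable abbrev polyEval (g : ℚ⟦X⟧) : Polynomial (Polynomial ℚ) →+* ℚ⟦X⟧ :=
  Polynomial.eval₂RingHom Polynomial.coeToPowerSeries.ringHom g

lemma polyEval_C (g : ℚ⟦X⟧) (q : Polynomial ℚ) : polyEval g (Polynomial.C q) = (q : ℚ⟦X⟧) := by
  simp [polyEval]

lemma polyEval_X (g : ℚ⟦X⟧) : polyEval g Polynomial.X = g := by
  simp [polyEval]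

lemma exists_derivative_eval_ne_zero {f : ℚ⟦X⟧} (hf : IsAlgebraicPS f) :
    ∃ P : Polynomial (Polynomial ℚ), polyEval f P = 0 ∧ polyEval f (Polynomial.derivative P) ≠ 0 := by
  classical
  have hex : ∃ n : ℕ, ∃ P : Polynomial (Polynomial ℚ), P ≠ 0 ∧ polyEval f P = 0 ∧ P.natDegree = n := by
    obtain ⟨P, h0, h1⟩ := hf
    exact ⟨_, P, h0, h1, rfl⟩
  obtain ⟨P, h0, h1, h2⟩ := Nat.find_spec hex
  refine ⟨P, h1, fun h => ?_⟩
  have hdeg : P.natDegree ≠ 0 := by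
    intro hd
    rw [Polynomial.eq_C_of_natDegree_eq_zero hd] at h1 h0
    simp only [polyEval, Polynomial.coe_eval₂RingHom, Polynomial.eval₂_C] at h1
    have : P.coeff 0 = 0 := by
      have := Polynomial.coe_eq_zero_iff.1 (show ((P.coeff 0 : Polynomial ℚ) : ℚ⟦X⟧) = 0 from h1)
      exact this
    exact h0 (by rw [this, map_zero])
  have hne : Polynomial.derivative P ≠ 0 := by
    intro hd
    exact hdeg (Polynomial.derivative_eq_zero.1 hd)
  have := Nat.find_min' hex ⟨Polynomial.derivative P, hne, h, rfl⟩
  have h3 := Polynomial.natDegree_derivative_lt hdeg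
  omega

/-- An algebraic power series is, up to a polynomial and a shift, a solution of a contracting
polynomial fixed-point equation. -/
lemma exists_fixedPoint {f : ℚ⟦X⟧} (hf : IsAlgebraicPS f) :
    ∃ (f₀ : Polynomial ℚ) (μ : ℕ) (z : ℚ⟦X⟧) (q u : Polynomial ℚ) (G : Polynomial (Polynomial ℚ)),
      f = (f₀ : ℚ⟦X⟧) + X ^ μ * z ∧ constantCoeff z = 0 ∧
      z = X * (q : ℚ⟦X⟧) + X * (u : ℚ⟦X⟧) * z + z ^ 2 * polyEval z G := by
  obtain ⟨P, hP, hP'⟩ := exists_derivative_eval_ne_zero hf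
  set D := polyEval f (Polynomial.derivative P) with hD
  obtain ⟨μ, D₁, hD₁, hμ⟩ : ∃ (μ : ℕ) (D₁ : ℚ⟦X⟧), constantCoeff D₁ ≠ 0 ∧ D = X ^ μ * D₁ := by
    refine ⟨D.order.toNat, PowerSeries.divXPowOrder D, ?_, (X_pow_order_mul_divXPowOrder).symm⟩
    rw [constantCoeff_divXPowOrder]
    exact coeff_order hP'
  obtain ⟨g, hg⟩ : (X : ℚ⟦X⟧) ^ (2 * μ + 1) ∣ f - (trunc (2 * μ + 1) f : Polynomial ℚ) := by
    rw [X_pow_dvd_iff]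
    intro m hm
    rw [map_sub, Polynomial.coeff_coe, coeff_trunc, if_pos hm, sub_self]
  set f₀ := trunc (2 * μ + 1) f with hf₀
  have hdvd : ∀ Q : Polynomial (Polynomial ℚ), (X : ℚ⟦X⟧) ^ (2 * μ + 1) ∣
      polyEval f Q - ((Q.eval f₀ : Polynomial ℚ) : ℚ⟦X⟧) := by
    intro Q
    have h1 : ((Q.eval f₀ : Polynomial ℚ) : ℚ⟦X⟧) = polyEval (f₀ : ℚ⟦X⟧) Q := by
      change Polynomial.coeToPowerSeries.ringHom (Q.eval f₀) = _
      rw [Polynomial.eval, Polynomial.hom_eval₂]; rfl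
    rw [h1]
    change _ ∣ Polynomial.eval₂ _ f Q - Polynomial.eval₂ _ (f₀ : ℚ⟦X⟧) Q
    rw [← Polynomial.eval_map, ← Polynomial.eval_map]
    exact (Dvd.intro _ hg.symm).trans (Polynomial.sub_dvd_eval_sub _ _ _)
  -- values at the truncation
  obtain ⟨q₁, hq₁⟩ : (Polynomial.X : Polynomial ℚ) ^ (2 * μ + 1) ∣ P.eval f₀ := by
    have h := hdvd P
    rw [hP, zero_sub, dvd_neg, X_pow_dvd_iff] at h
    rw [Polynomial.X_pow_dvd_iff]
    intro d hd
    simpa using h d hd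
  obtain ⟨u₁, hu₁⟩ : (Polynomial.X : Polynomial ℚ) ^ μ ∣ (Polynomial.derivative P).eval f₀ := by
    have h := (pow_dvd_pow X (by omega : μ ≤ 2 * μ + 1)).trans (hdvd (Polynomial.derivative P))
    rw [← hD, hμ, dvd_sub_right (Dvd.intro _ rfl), X_pow_dvd_iff] at h
    rw [Polynomial.X_pow_dvd_iff]
    intro d hd
    simpa using h d hd
  have hu₁0 : u₁.coeff 0 = constantCoeff D₁ := by
    have h := X_pow_dvd_iff.1 (hdvd (Polynomial.derivative P)) μ (by omega)
    rw [← hD, hμ, hu₁, map_sub, Polynomial.coeff_coe, Polynomial.coeff_X_pow_mul', if_pos le_rfl,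
      coeff_X_pow_mul', if_pos le_rfl, Nat.sub_self, sub_eq_zero] at h
    simpa using h.symm
  set c := constantCoeff D₁ with hc
  obtain ⟨u₂, hu₂⟩ : (Polynomial.X : Polynomial ℚ) ∣ 1 - Polynomial.C c⁻¹ * u₁ := by
    rw [Polynomial.X_dvd_iff]
    simp [hu₁0, hD₁]
  obtain ⟨k, hk⟩ := Polynomial.binomExpansion (P.map (Polynomial.C : Polynomial ℚ →+* _))
    (Polynomial.C f₀) (Polynomial.C (Polynomial.X ^ μ) * Polynomial.X)
  have hz : f = (f₀ : ℚ⟦X⟧) + X ^ μ * (X ^ (μ + 1) * g) := by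
    linear_combination hg
  set z : ℚ⟦X⟧ := X ^ (μ + 1) * g with hzdef
  refine ⟨f₀, μ, z, -Polynomial.C c⁻¹ * q₁, u₂, -Polynomial.C (Polynomial.C c⁻¹) * k, hz, by simp [hzdef], ?_⟩
  have h1 := congrArg (polyEval z) hk
  have e1 : polyEval z ((P.map (Polynomial.C : Polynomial ℚ →+* _)).eval
      (Polynomial.C f₀ + Polynomial.C (Polynomial.X ^ μ) * Polynomial.X)) = 0 := by
    rw [Polynomial.eval_map, Polynomial.hom_eval₂, ← hP]
    have e3 : (polyEval z).comp Polynomial.C = Polynomial.coeToPowerSeries.ringHom := by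
      ext <;> simp [polyEval]
    have e4 : polyEval z (Polynomial.C f₀ + Polynomial.C (Polynomial.X ^ μ) * Polynomial.X) = f := by
      rw [hz, map_add, map_mul, polyEval_C, polyEval_C, polyEval_X, Polynomial.coe_pow, Polynomial.coe_X]
    rw [e3, e4]; rfl
  have e2 : ∀ Q : Polynomial (Polynomial ℚ), polyEval z ((Q.map (Polynomial.C : Polynomial ℚ →+* _)).eval
      (Polynomial.C f₀)) = ((Q.eval f₀ : Polynomial ℚ) : ℚ⟦X⟧) := by
    intro Q
    rw [Polynomial.eval_map, Polynomial.eval₂_at_apply]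
    simp [polyEval]
  rw [e1, map_add, map_add, map_mul, Polynomial.derivative_map, e2, e2, hq₁, hu₁] at h1
  simp only [map_mul, map_pow, polyEval_C, polyEval_X] at h1
  have e7 : polyEval z (-Polynomial.C (Polynomial.C c⁻¹) * k) = - C c⁻¹ * polyEval z k := by
    rw [map_mul, map_neg, polyEval_C, Polynomial.coe_C]
  have e8 : ((1 - Polynomial.C c⁻¹ * u₁ : Polynomial ℚ) : ℚ⟦X⟧) = X * (u₂ : ℚ⟦X⟧) := by
    rw [hu₂]; simp
  have e9 : (u₁ : ℚ⟦X⟧) = C c * (1 - X * (u₂ : ℚ⟦X⟧)) := by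
    rw [← e8]
    simp only [Polynomial.coe_sub, Polynomial.coe_one, Polynomial.coe_mul, Polynomial.coe_C]
    rw [sub_sub_cancel, ← mul_assoc, ← map_mul, mul_inv_cancel₀ hD₁, map_one, one_mul]
  have hcc : (C c⁻¹ : ℚ⟦X⟧) * C c = 1 := by rw [← map_mul, inv_mul_cancel₀ hD₁, map_one]
  have hX : (X : ℚ⟦X⟧) ^ (2 * μ) ≠ 0 := pow_ne_zero _ X_ne_zero
  refine mul_left_cancel₀ hX ?_
  rw [e7]
  simp only [Polynomial.coe_mul, Polynomial.coe_pow, Polynomial.coe_X, Polynomial.coe_neg,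
    Polynomial.coe_C] at h1 ⊢
  rw [e9] at h1
  linear_combination -(C c⁻¹) * h1 - X ^ (2 * μ) * (1 - X * (u₂ : ℚ⟦X⟧)) * z * hcc

lemma X_pow_succ_dvd_fixedPoint_sub {z y : ℚ⟦X⟧} (q u : ℚ⟦X⟧)
    (G : Polynomial (Polynomial ℚ)) (hz : constantCoeff z = 0) (hy : constantCoeff y = 0) {N : ℕ}
    (h : X ^ N ∣ z - y) :
    X ^ (N + 1) ∣ (X * q + X * u * z + z ^ 2 * polyEval z G) -
      (X * q + X * u * y + y ^ 2 * polyEval y G) := by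
  obtain ⟨z', rfl⟩ : (X : ℚ⟦X⟧) ∣ z := by simpa [X_dvd_iff] using hz
  obtain ⟨y', rfl⟩ : (X : ℚ⟦X⟧) ∣ y := by simpa [X_dvd_iff] using hy
  obtain ⟨d, hd⟩ := h
  obtain ⟨e, he⟩ : (X * z' - X * y') ∣ polyEval (X * z') G - polyEval (X * y') G := by
    simp only [polyEval, Polynomial.coe_eval₂RingHom]
    rw [← Polynomial.eval_map, ← Polynomial.eval_map]
    exact Polynomial.sub_dvd_eval_sub _ _ _
  refine ⟨u * d + (z' + y') * d * polyEval (X * z') G + X * y' ^ 2 * d * e, ?_⟩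
  rw [hd] at he
  linear_combination (X * u + X * (z' + y') * polyEval (X * z') G) * hd + (X * y') ^ 2 * he

/-- Induction principle for the truncations of the solution of a fixed-point equation. -/
lemma trunc_induction {z q u : ℚ⟦X⟧} {G : Polynomial (Polynomial ℚ)} (hz : constantCoeff z = 0)
    (h : z = X * q + X * u * z + z ^ 2 * polyEval z G) (J : ℚ⟦X⟧ → Prop) (h0 : J 0)
    (htr : ∀ y N, J y → J (trunc N y : Polynomial ℚ))
    (hJ : ∀ y, J y → J (X * q + X * u * y + y ^ 2 * polyEval y G)) (N : ℕ) :
    J (trunc N z : Polynomial ℚ) := by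
  induction N with
  | zero => simpa using h0
  | succ N ih =>
    have h1 : (X : ℚ⟦X⟧) ^ N ∣ z - (trunc N z : Polynomial ℚ) := by
      rw [X_pow_dvd_iff]
      intro m hm
      rw [map_sub, Polynomial.coeff_coe, coeff_trunc, if_pos hm, sub_self]
    have hy : constantCoeff ((trunc N z : Polynomial ℚ) : ℚ⟦X⟧) = 0 := by
      rw [← coeff_zero_eq_constantCoeff_apply, Polynomial.coeff_coe, coeff_trunc]
      split_ifs <;> simp [hz]
    have h2 := X_pow_succ_dvd_fixedPoint_sub q u G hz hy h1
    rw [← h, X_pow_dvd_iff] at h2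
    have h3 : trunc (N + 1) z = trunc (N + 1) (X * q + X * u * ((trunc N z : Polynomial ℚ) : ℚ⟦X⟧) +
        ((trunc N z : Polynomial ℚ) : ℚ⟦X⟧) ^ 2 * polyEval ((trunc N z : Polynomial ℚ) : ℚ⟦X⟧) G) := by
      ext m
      rw [coeff_trunc, coeff_trunc]
      split_ifs with hm
      · have := h2 m hm
        rwa [map_sub, sub_eq_zero] at this
      · rfl
    rw [h3]
    exact htr _ _ (hJ _ ih)

lemma exists_common_denominator (s : Finset ℚ) :
    ∃ M : ℕ, 1 ≤ M ∧ ∀ x ∈ s, ∃ k : ℤ, (M : ℚ) * x = k := by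
  refine ⟨∏ x ∈ s, x.den, Nat.one_le_iff_ne_zero.2 (Finset.prod_ne_zero_iff.2 fun x _ => x.den_nz),
    fun x hx => ?_⟩
  obtain ⟨c, hc⟩ := Finset.dvd_prod_of_mem (fun x : ℚ => x.den) hx
  refine ⟨c * x.num, ?_⟩
  rw [hc]
  push_cast
  have := Rat.mul_den_eq_num x
  linear_combination (c : ℚ) * this

/-- Power series whose `n`-th coefficient becomes an integer after multiplication by `Dⁿ`. -/
noncomputable def integralAfterScaling (D : ℚ) : Subring ℚ⟦X⟧ :=
  (PowerSeries.map (Int.castRingHom ℚ)).range.comap (rescale D)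

lemma mem_integralAfterScaling {D : ℚ} {z : ℚ⟦X⟧} :
    z ∈ integralAfterScaling D ↔ ∀ n, ∃ k : ℤ, D ^ n * coeff n z = k := by
  constructor
  · rintro ⟨w, hw⟩ n
    refine ⟨coeff n w, ?_⟩
    rw [← coeff_rescale]
    change coeff n (rescale D z) = _
    rw [show rescale D z = _ from hw.symm]
    simp
  · intro h
    choose k hk using h
    refine ⟨mk k, ?_⟩
    ext n
    simp [coeff_rescale, hk]

lemma fixedPoint_integral {z : ℚ⟦X⟧} {q u : Polynomial ℚ} {G : Polynomial (Polynomial ℚ)}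
    (hz : constantCoeff z = 0)
    (h : z = X * (q : ℚ⟦X⟧) + X * (u : ℚ⟦X⟧) * z + z ^ 2 * polyEval z G) :
    ∃ M : ℕ, 1 ≤ M ∧ ∀ n, ∃ k : ℤ, (M : ℚ) ^ n * coeff n z = k := by
  classical
  obtain ⟨M, hM, hMi⟩ := exists_common_denominator
    (((q.support.image q.coeff) ∪ (u.support.image u.coeff)) ∪
      (G.support.biUnion fun i => (G.coeff i).support.image (G.coeff i).coeff))
  have hM0 : (M : ℚ) ≠ 0 := by positivity
  set D : ℚ := (M : ℚ) ^ 2 with hD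
  set 𝓡 := integralAfterScaling D
  have hpoly : ∀ p : Polynomial ℚ, (∀ x ∈ p.support.image p.coeff, ∃ k : ℤ, (M : ℚ) * x = k) →
      C (M : ℚ) * (p : ℚ⟦X⟧) ∈ 𝓡 := by
    intro p hp
    rw [mem_integralAfterScaling]
    intro n
    by_cases hn : n ∈ p.support
    · obtain ⟨k, hk⟩ := hp _ (Finset.mem_image_of_mem _ hn)
      refine ⟨(M ^ 2) ^ n * k, ?_⟩
      rw [coeff_C_mul, Polynomial.coeff_coe, hk]
      push_cast; rfl
    · refine ⟨0, ?_⟩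
      rw [coeff_C_mul, Polynomial.coeff_coe, Polynomial.notMem_support_iff.1 hn]; simp
  have hq := hpoly q (fun x hx => hMi x (by simp only [Finset.mem_union]; tauto))
  have hu := hpoly u (fun x hx => hMi x (by simp only [Finset.mem_union]; tauto))
  have hG : ∀ i, C (M : ℚ) * ((G.coeff i : Polynomial ℚ) : ℚ⟦X⟧) ∈ 𝓡 := by
    intro i
    by_cases hi : i ∈ G.support
    · exact hpoly _ (fun x hx => hMi x (by
        rw [Finset.mem_union]; right; exact Finset.mem_biUnion.2 ⟨i, hi, hx⟩))
    · rw [Polynomial.notMem_support_iff.1 hi]; simp [𝓡.zero_mem]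
  have hC : (C (M : ℚ) : ℚ⟦X⟧) ∈ 𝓡 := by
    rw [mem_integralAfterScaling]
    intro n
    rcases n with _ | n
    · exact ⟨M, by simp⟩
    · exact ⟨0, by rw [coeff_C, if_neg (Nat.succ_ne_zero n)]; simp⟩
  have hX : (C ((M : ℚ) ^ 2)⁻¹ * X : ℚ⟦X⟧) ∈ 𝓡 := by
    rw [mem_integralAfterScaling]
    intro n
    by_cases hn : n = 1
    · exact ⟨1, by rw [hn, coeff_C_mul, coeff_one_X, hD]; field_simp; simp⟩
    · exact ⟨0, by rw [coeff_C_mul, coeff_X, if_neg hn]; simp⟩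
  set X' : ℚ⟦X⟧ := C ((M : ℚ) ^ 2)⁻¹ * X with hX'
  have hXX' : (X : ℚ⟦X⟧) = C (M : ℚ) ^ 2 * X' := by
    rw [hX', ← mul_assoc, ← map_pow, ← map_mul, mul_inv_cancel₀ (by positivity), map_one, one_mul]
  have key := trunc_induction hz h (fun y => ∃ w ∈ 𝓡, y = C (M : ℚ) * w)
    ⟨0, 𝓡.zero_mem, by simp⟩ (by
      rintro y N ⟨w, hw, rfl⟩
      refine ⟨(trunc N w : Polynomial ℚ), ?_, ?_⟩
      · rw [mem_integralAfterScaling] at hw ⊢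
        intro n
        rw [Polynomial.coeff_coe, coeff_trunc]
        split_ifs with h
        · exact hw n
        · exact ⟨0, by simp⟩
      · ext n
        rw [coeff_C_mul, Polynomial.coeff_coe, Polynomial.coeff_coe, coeff_trunc, coeff_trunc,
          coeff_C_mul]
        split_ifs <;> simp) (by
      rintro y ⟨w, hw, rfl⟩
      have hE : C (M : ℚ) * polyEval (C (M : ℚ) * w) G ∈ 𝓡 := by
        simp only [polyEval, Polynomial.coe_eval₂RingHom]
        rw [Polynomial.eval₂_eq_sum_range, Finset.mul_sum]
        refine 𝓡.sum_mem fun i _ => ?_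
        rw [← mul_assoc]
        exact 𝓡.mul_mem (hG i) (𝓡.pow_mem (𝓡.mul_mem hC hw) i)
      refine ⟨X' * (C (M : ℚ) * (q : ℚ⟦X⟧)) + X' * (C (M : ℚ) * (u : ℚ⟦X⟧)) * (C (M : ℚ) * w) +
        w ^ 2 * (C (M : ℚ) * polyEval (C (M : ℚ) * w) G), ?_, ?_⟩
      · exact 𝓡.add_mem (𝓡.add_mem (𝓡.mul_mem hX hq) (𝓡.mul_mem (𝓡.mul_mem hX hu)
          (𝓡.mul_mem hC hw))) (𝓡.mul_mem (𝓡.pow_mem hw 2) hE)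
      · linear_combination ((q : ℚ⟦X⟧) + (u : ℚ⟦X⟧) * (C (M : ℚ) * w)) * hXX')
  refine ⟨M ^ 2, Nat.one_le_pow _ _ hM, fun n => ?_⟩
  obtain ⟨w, hw, hwz⟩ := key (n + 1)
  obtain ⟨k, hk⟩ := mem_integralAfterScaling.1 hw n
  refine ⟨M * k, ?_⟩
  have h2 := congrArg (coeff n) hwz
  rw [Polynomial.coeff_coe, coeff_trunc, if_pos (by omega), coeff_C_mul] at h2
  rw [h2]
  push_cast
  rw [← hk, hD]
  ring

/-- Eisenstein's theorem. -/
theorem IsAlgebraicPS.exists_integral {f : ℚ⟦X⟧} (hf : IsAlgebraicPS f) :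
    ∃ A : ℕ, 1 ≤ A ∧ ∀ n, ∃ k : ℤ, (A : ℚ) ^ (n + 1) * coeff n f = k := by
  classical
  obtain ⟨f₀, μ, z, q, u, G, hfz, hz, h⟩ := exists_fixedPoint hf
  obtain ⟨M, hM, hMz⟩ := fixedPoint_integral hz h
  obtain ⟨d, hd, hdi⟩ := exists_common_denominator (f₀.support.image f₀.coeff)
  refine ⟨M * d, Nat.mul_pos hM hd, fun n => ?_⟩
  obtain ⟨k₁, hk₁⟩ : ∃ k : ℤ, (d : ℚ) * f₀.coeff n = k := by
    by_cases hn : n ∈ f₀.support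
    · exact hdi _ (Finset.mem_image_of_mem _ hn)
    · exact ⟨0, by rw [Polynomial.notMem_support_iff.1 hn]; simp⟩
  obtain ⟨k₂, hk₂⟩ : ∃ k : ℤ, (M : ℚ) ^ n * coeff n (X ^ μ * z) = k := by
    rw [coeff_X_pow_mul']
    split_ifs with hn
    · obtain ⟨k, hk⟩ := hMz (n - μ)
      refine ⟨M ^ μ * k, ?_⟩
      push_cast
      rw [← hk, ← mul_assoc, ← pow_add]
      congr 2; omega
    · exact ⟨0, by simp⟩
  refine ⟨M ^ (n + 1) * d ^ n * k₁ + M * d ^ (n + 1) * k₂, ?_⟩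
  rw [hfz, map_add, Polynomial.coeff_coe]
  push_cast
  rw [← hk₁, ← hk₂]
  ring

/-- An algebraic power series has positive radius of convergence. -/
theorem IsAlgebraicPS.exists_bound {f : ℚ⟦X⟧} (hf : IsAlgebraicPS f) :
    ∃ ρ : NNReal, 0 < ρ ∧ SubNorm.rat.ps ρ f < ⊤ := by
  classical
  obtain ⟨f₀, μ, z, q, u, G, hfz, hz, h⟩ := exists_fixedPoint hf
  have hfin : ∀ (p : Polynomial ℚ) (ρ : NNReal), SubNorm.rat.ps ρ (p : ℚ⟦X⟧) < ⊤ := by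
    intro p ρ
    rw [SubNorm.ps_apply, tsum_eq_sum (s := p.support)]
    · exact ENNReal.sum_lt_top.2 fun i _ => ENNReal.mul_lt_top (by simp) (by
        exact ENNReal.pow_lt_top (by simp))
    · intro n hn
      rw [Polynomial.coeff_coe, Polynomial.notMem_support_iff.1 hn]; simp
  have hmono : ∀ (y : ℚ⟦X⟧) (ρ : NNReal), ρ ≤ 1 → SubNorm.rat.ps ρ y ≤ SubNorm.rat.ps 1 y := by
    intro y ρ hρ
    rw [SubNorm.ps_apply, SubNorm.ps_apply]
    refine ENNReal.tsum_le_tsum fun n => ?_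
    gcongr
  have hXle : ∀ ρ : NNReal, SubNorm.rat.ps ρ (X : ℚ⟦X⟧) ≤ ρ := by
    intro ρ
    rw [SubNorm.ps_apply, tsum_eq_single 1]
    · simp [coeff_one_X]
    · intro n hn
      rw [coeff_X, if_neg hn]; simp
  set K' : ENNReal := SubNorm.rat.ps 1 (q : ℚ⟦X⟧) + SubNorm.rat.ps 1 (u : ℚ⟦X⟧) +
    ∑ i ∈ Finset.range (G.natDegree + 1), SubNorm.rat.ps 1 (G.coeff i : ℚ⟦X⟧) with hK'
  have hK'top : K' < ⊤ := ENNReal.add_lt_top.2 ⟨ENNReal.add_lt_top.2 ⟨hfin _ _, hfin _ _⟩,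
    ENNReal.sum_lt_top.2 fun i _ => hfin _ _⟩
  obtain ⟨K, hK⟩ : ∃ K : NNReal, (K : ENNReal) = K' :=
    ⟨K'.toNNReal, ENNReal.coe_toNNReal hK'top.ne⟩
  set ε : NNReal := 1 / (2 * (K + 1)) with hε
  set ρ : NNReal := ε / (4 * (K + 1)) with hρ
  have hε1 : ε ≤ 1 := by
    rw [hε, div_le_one (by positivity)]
    nlinarith [K.2, show (0 : NNReal) ≤ K from K.2]
  have hρ1 : ρ ≤ 1 := by
    rw [hρ, div_le_one (by positivity)]
    refine hε1.trans ?_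
    have : (0 : NNReal) ≤ K := K.2
    calc (1 : NNReal) ≤ 4 * 1 := by norm_num
      _ ≤ 4 * (K + 1) := by gcongr; simp
  have hρ0 : 0 < ρ := by positivity
  have hineq : ρ * K + ρ * K * ε + ε ^ 2 * K ≤ ε := by
    have e1 : ρ * (K + 1) = ε / 4 := by
      rw [hρ]; field_simp
    have e2 : ε * (K + 1) = 1 / 2 := by
      rw [hε]; field_simp
    have e3 : ρ * K ≤ ε / 4 := by rw [← e1]; gcongr; simp
    have e4 : ε * K ≤ 1 / 2 := by rw [← e2]; gcongr; simp
    calc ρ * K + ρ * K * ε + ε ^ 2 * K ≤ ε / 4 + ε / 4 * 1 + ε * (1 / 2) := by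
          rw [pow_two, mul_assoc ε ε K]; gcongr
      _ = ε := by
          have : (ε : ℝ) / 4 + ε / 4 * 1 + ε * (1 / 2) = ε := by ring
          apply NNReal.coe_injective
          push_cast
          exact this
  have key := trunc_induction hz h (fun y => SubNorm.rat.ps ρ y ≤ ε)
    (by rw [SubNorm.zero]; simp) (by
      intro y N hy
      refine le_trans ?_ hy
      rw [SubNorm.ps_apply, SubNorm.ps_apply]
      refine ENNReal.tsum_le_tsum fun n => ?_
      gcongr
      rw [Polynomial.coeff_coe, coeff_trunc]
      split_ifs <;> simp) (by
      intro y hy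
      have hE : SubNorm.rat.ps ρ (polyEval y G) ≤ K := by
        have e1 : ∑ i ∈ Finset.range (G.natDegree + 1), SubNorm.rat.ps 1 (G.coeff i : ℚ⟦X⟧) ≤ K := by
          rw [hK, hK']; exact le_add_self
        refine le_trans ?_ e1
        simp only [polyEval, Polynomial.coe_eval₂RingHom]
        rw [Polynomial.eval₂_eq_sum_range]
        refine (SubNorm.sum_le _ _ _).trans (Finset.sum_le_sum fun i _ => ?_)
        refine (SubNorm.mul_le _ _ _).trans ?_
        calc SubNorm.rat.ps ρ (G.coeff i : ℚ⟦X⟧) * SubNorm.rat.ps ρ (y ^ i)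
            ≤ SubNorm.rat.ps 1 (G.coeff i : ℚ⟦X⟧) * 1 := by
              gcongr
              · exact hmono _ _ hρ1
              · refine (SubNorm.pow_le _ _ _).trans (pow_le_one₀ (by simp) (hy.trans ?_))
                exact_mod_cast hε1
          _ = _ := mul_one _
      have hq : SubNorm.rat.ps ρ (q : ℚ⟦X⟧) ≤ K := (hmono _ _ hρ1).trans (by
        rw [hK, hK', add_assoc]; exact le_self_add)
      have hu : SubNorm.rat.ps ρ (u : ℚ⟦X⟧) ≤ K := (hmono _ _ hρ1).trans (by
        rw [hK, hK', add_right_comm]; exact le_add_self)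
      calc SubNorm.rat.ps ρ (X * (q : ℚ⟦X⟧) + X * (u : ℚ⟦X⟧) * y + y ^ 2 * polyEval y G)
          ≤ ρ * K + ρ * K * ε + ε ^ 2 * K := by
            refine (SubNorm.add_le _ _ _).trans (add_le_add ((SubNorm.add_le _ _ _).trans
              (add_le_add ?_ ?_)) ?_)
            · exact (SubNorm.mul_le _ _ _).trans (mul_le_mul' (hXle ρ) hq)
            · exact (SubNorm.mul_le _ _ _).trans (mul_le_mul' ((SubNorm.mul_le _ _ _).trans
                (mul_le_mul' (hXle ρ) hu)) hy)
            · refine (SubNorm.mul_le _ _ _).trans (mul_le_mul' ((SubNorm.pow_le _ _ _).trans ?_) hE)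
              gcongr
        _ ≤ ε := by exact_mod_cast hineq)
  have hzb : SubNorm.rat.ps ρ z ≤ ε := by
    rw [SubNorm.ps_apply, ENNReal.tsum_eq_iSup_nat]
    refine iSup_le fun N => ?_
    refine le_trans ?_ (key N)
    rw [SubNorm.ps_apply]
    refine le_trans (le_of_eq ?_) (ENNReal.sum_le_tsum (Finset.range N))
    refine Finset.sum_congr rfl fun n hn => ?_
    rw [Polynomial.coeff_coe, coeff_trunc, if_pos (Finset.mem_range.1 hn)]
  refine ⟨ρ, hρ0, ?_⟩
  rw [hfz]
  refine SubNorm.add_lt_top _ (hfin _ _) (SubNorm.mul_lt_top _ (SubNorm.pow_lt_top _ ?_ _) ?_)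
  · exact (hXle ρ).trans_lt (by simp)
  · exact hzb.trans_lt (by simp)

lemma memZp_iff_norm_le_one {p : ℕ} [hp : Fact p.Prime] {x : ℚ} :
    MemZp p x ↔ ‖(x : ℚ_[p])‖ ≤ 1 := by
  refine ⟨fun h => Padic.norm_rat_le_one h, fun h hd => ?_⟩
  have h1 : (x : ℚ_[p]) * ((x.den : ℤ) : ℚ_[p]) = ((x.num : ℤ) : ℚ_[p]) := by
    exact_mod_cast congrArg (Rat.cast : ℚ → ℚ_[p]) (Rat.mul_den_eq_num x)
  have h2 : ‖((x.den : ℤ) : ℚ_[p])‖ < 1 := by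
    rw [Padic.norm_intCast_lt_one_iff]; exact_mod_cast hd
  have h3 : ‖((x.num : ℤ) : ℚ_[p])‖ < 1 := by
    rw [← h1, norm_mul]
    calc _ ≤ 1 * ‖((x.den : ℤ) : ℚ_[p])‖ := by gcongr
      _ < 1 := by simpa using h2
  rw [Padic.norm_intCast_lt_one_iff] at h3
  have h4 : p ∣ x.num.natAbs := Int.natCast_dvd.1 h3
  have := Nat.dvd_gcd h4 hd
  rw [x.reduced.gcd_eq_one] at this
  exact hp.out.one_lt.ne' (Nat.dvd_one.1 this)

/-- `w ^ p` is congruent to the expansion of `w` modulo `p`. -/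
lemma exists_pow_eq_expand_add {p : ℕ} [hp : Fact p.Prime] (w : ℤ_[p]⟦X⟧) :
    ∃ v : ℤ_[p]⟦X⟧, w ^ p = expand p hp.out.ne_zero w + C (p : ℤ_[p]) * v := by
  have h1 : ∀ g : (ZMod p)⟦X⟧, g ^ p = expand p hp.out.ne_zero g := by
    intro g
    have := MvPowerSeries.map_frobenius_expand p hp.out.ne_zero (f := g)
    rw [ZMod.frobenius_zmod] at this
    rw [← this]
    change MvPowerSeries.map _ _ = MvPowerSeries.expand _ _ _
    ext n
    simp
  have h2 : PowerSeries.map (PadicInt.toZMod (p := p)) (w ^ p - expand p hp.out.ne_zero w) = 0 := by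
    rw [map_sub, map_pow, h1, map_expand, sub_self]
  have h3 : ∀ n, ∃ c, coeff n (w ^ p - expand p hp.out.ne_zero w) = p * c := by
    intro n
    have := congrArg (coeff n) h2
    rw [coeff_map, map_zero, ← RingHom.mem_ker, PadicInt.ker_toZMod,
      PadicInt.maximalIdeal_eq_span_p, Ideal.mem_span_singleton] at this
    exact this
  choose c hc using h3
  refine ⟨mk c, ?_⟩
  rw [← sub_eq_iff_eq_add']
  ext n
  rw [hc, coeff_C_mul, coeff_mk]

lemma norm_pow_div_natCast_le {p : ℕ} [hp : Fact p.Prime] {i : ℕ} (hi : i ≠ 0) :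
    ‖(p : ℚ_[p]) ^ i / (i : ℚ_[p])‖ ≤ ‖(p : ℚ_[p])‖ := by
  obtain ⟨e, m, hm, rfl⟩ := Nat.exists_eq_pow_mul_and_not_dvd hi p hp.out.ne_one
  have h1 : ‖((m : ℤ) : ℚ_[p])‖ = 1 := by
    refine le_antisymm (Padic.norm_int_le_one _) (not_lt.1 fun h => hm ?_)
    rw [Padic.norm_intCast_lt_one_iff] at h
    exact_mod_cast h
  have h1' : ‖(m : ℚ_[p])‖ = 1 := by simpa using h1
  have hp0 : 0 < ‖(p : ℚ_[p])‖ := norm_pos_iff.2 (by exact_mod_cast hp.out.ne_zero)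
  have hp1 : ‖(p : ℚ_[p])‖ < 1 := Padic.norm_p_lt_one
  have he : e + 1 ≤ p ^ e * m := by
    have : 0 < m := Nat.pos_of_ne_zero (by rintro rfl; simp at hi)
    calc e + 1 ≤ p ^ e := Nat.lt_pow_self hp.out.one_lt
      _ ≤ p ^ e * m := Nat.le_mul_of_pos_right _ this
  push_cast
  rw [norm_div, norm_mul, h1', mul_one, norm_pow, norm_pow, div_le_iff₀ (by positivity), ← pow_succ']
  exact pow_le_pow_of_le_one hp0.le hp1.le he

/-- Integrality of `exp (- ∑ aₙ Xⁿ / n)` at `p` gives the Gauss congruences at `p`. -/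
lemma gauss_of_integral {p : ℕ} (hp : p.Prime) (a : ℕ → ℚ)
    (h : ∀ n, MemZp p (coeff n (Exp (mk fun n : ℕ => - (a n / n) : ℚ⟦X⟧)))) {n : ℕ} (hn : 1 ≤ n) :
    MemNPZp n p (a (n * p) - a n) := by
  have : Fact p.Prime := ⟨hp⟩
  set ℓ : ℚ⟦X⟧ := mk fun n : ℕ => - (a n / n) with hℓ
  have hℓ0 : constantCoeff ℓ = 0 := by
    rw [← coeff_zero_eq_constantCoeff_apply, hℓ, coeff_mk]; simp
  set φ : ℚ →+* ℚ_[p] := algebraMap ℚ ℚ_[p] with hφ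
  set L := PowerSeries.map φ ℓ with hL
  have hL0 : constantCoeff L = 0 := by
    rw [hL, ← coeff_zero_eq_constantCoeff_apply, coeff_map, coeff_zero_eq_constantCoeff_apply, hℓ0,
      map_zero]
  have hExp : PowerSeries.map φ (Exp ℓ) = Exp L := by
    refine map_ratComp (PowerSeries.map φ) _ (fun n z hz => ?_) hℓ0
    obtain ⟨w, rfl⟩ := hz
    exact ⟨PowerSeries.map φ w, by rw [map_mul, map_pow, map_X]⟩
  set ι : ℤ_[p] →+* ℚ_[p] := PadicInt.Coe.ringHom with hι
  have hex : ∀ n, ∃ c : ℤ_[p], ι c = φ (coeff n (Exp ℓ)) := fun n =>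
    ⟨⟨((coeff n (Exp ℓ) : ℚ) : ℚ_[p]), memZp_iff_norm_le_one.1 (h n)⟩, rfl⟩
  choose c hc using hex
  set w : ℤ_[p]⟦X⟧ := mk c with hw
  have hwE : PowerSeries.map ι w = Exp L := by
    rw [← hExp]
    ext n
    rw [coeff_map, coeff_map, hw, coeff_mk, hc]
  have hw0 : constantCoeff w = 1 := by
    have h1 : ι (constantCoeff w) = 1 := by
      have := congrArg (coeff 0) hwE
      rwa [coeff_map, coeff_zero_eq_constantCoeff_apply, coeff_zero_eq_constantCoeff_apply,
        constantCoeff_Exp] at this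
    exact Subtype.ext h1
  have hp0 : p ≠ 0 := hp.ne_zero
  obtain ⟨v, hv⟩ := exists_pow_eq_expand_add w
  obtain ⟨u, hu⟩ : ∃ u, expand p hp0 w * u = 1 := by
    have : IsUnit (expand p hp0 w) := by
      rw [isUnit_iff_constantCoeff, constantCoeff_expand, hw0]; exact isUnit_one
    exact this.exists_right_inv
  set H := PowerSeries.map ι (v * u) with hH
  have hEL : expand p hp0 (Exp L) = Exp (expand p hp0 L) := by
    refine map_ratComp (expand p hp0).toRingHom _ (fun n z hz => ?_) hL0
    obtain ⟨w, rfl⟩ := hz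
    refine ⟨X ^ (n * p - n) * expand p hp0 w, ?_⟩
    change expand p hp0 _ = _
    rw [map_mul, map_pow, expand_X, ← pow_mul, ← mul_assoc, ← pow_add]
    congr 2
    have : n ≤ n * p := Nat.le_mul_of_pos_right _ hp.pos
    rw [mul_comm p n]; omega
  have hEL0 : constantCoeff (expand p hp0 L) = 0 := by rw [constantCoeff_expand, hL0]
  have key : Exp (p • L - expand p hp0 L) = 1 + C (p : ℚ_[p]) * H := by
    have h1 : Exp L ^ p = Exp (expand p hp0 L) + C (p : ℚ_[p]) * PowerSeries.map ι v := by
      rw [← hEL, ← hwE, ← map_pow, hv, map_add, map_expand, map_mul, map_C, map_natCast]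
    have h2 : Exp (expand p hp0 L) * PowerSeries.map ι u = 1 := by
      rw [← hEL, ← hwE, ← map_expand, ← map_mul, hu, map_one]
    have h3 : Exp (p • L - expand p hp0 L) * Exp (expand p hp0 L) = Exp L ^ p := by
      rw [← Exp_add (by simp [hL0, hEL0]) hEL0, sub_add_cancel, Exp_nsmul hL0]
    have h4 : Exp (p • L - expand p hp0 L) = Exp L ^ p * PowerSeries.map ι u := by
      rw [← h3, mul_assoc, h2, mul_one]
    rw [h4, h1, add_mul, h2, hH, map_mul, mul_assoc]
  have hD0 : constantCoeff (p • L - expand p hp0 L) = 0 := by simp [hL0, hEL0]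
  have hlog : p • L - expand p hp0 L = Log (C (p : ℚ_[p]) * H) := by
    rw [← Log_Exp_sub_one hD0, key, add_sub_cancel_left]
  have hcoef := congrArg (coeff (p * n)) hlog
  have hleft : coeff (p * n) (p • L - expand p hp0 L) = ((a n - a (n * p)) / n : ℚ) := by
    rw [map_sub, coeff_expand_mul, map_nsmul, hL, coeff_map, coeff_map, hℓ, coeff_mk, coeff_mk,
      nsmul_eq_mul, hφ]
    simp only [eq_ratCast]
    push_cast
    have : (n : ℚ_[p]) ≠ 0 := by exact_mod_cast (by omega : n ≠ 0)
    have : (p : ℚ_[p]) ≠ 0 := by exact_mod_cast hp0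
    rw [mul_comm p n]
    field_simp
    ring
  have hbound : ‖coeff (p * n) (Log (C (p : ℚ_[p]) * H))‖ ≤ ‖(p : ℚ_[p])‖ := by
    rw [Log, ratComp, coeff_mk]
    refine IsUltrametricDist.norm_sum_le_of_forall_le_of_nonneg (norm_nonneg _) fun i _ => ?_
    rcases Nat.eq_zero_or_pos i with rfl | hi
    · simp
    · rw [mul_pow, ← map_pow, coeff_C_mul, hH, ← map_pow, coeff_map, Algebra.smul_def, ← mul_assoc,
        norm_mul]
      have e1 : ‖ι (coeff (p * n) ((v * u) ^ i))‖ ≤ 1 := PadicInt.norm_le_one _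
      have e2 : ‖(algebraMap ℚ ℚ_[p]) ((-1) ^ (i + 1) / (i : ℚ)) * (p : ℚ_[p]) ^ i‖ ≤ ‖(p : ℚ_[p])‖ := by
        refine le_trans (le_of_eq ?_) (norm_pow_div_natCast_le (p := p) hi.ne')
        rw [map_div₀, map_pow, map_neg, map_one, map_natCast, norm_mul, norm_div, norm_pow, norm_neg,
          norm_one, one_pow, norm_div]
        ring
      calc _ ≤ ‖(p : ℚ_[p])‖ * 1 := by gcongr
        _ = _ := mul_one _
  rw [← hcoef, hleft] at hbound
  have hn0 : (n : ℚ) ≠ 0 := by exact_mod_cast (by omega : n ≠ 0)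
  have hpq : (p : ℚ) ≠ 0 := by exact_mod_cast hp0
  refine ⟨(a (n * p) - a n) / (n * p), ?_, by field_simp⟩
  rw [memZp_iff_norm_le_one]
  have e : (a (n * p) - a n) / (n * p) = -(((a n - a (n * p)) / n) / p) := by field_simp; ring
  rw [e]
  push_cast at hbound ⊢
  rw [norm_neg, norm_div]
  exact div_le_one_of_le₀ hbound (norm_nonneg _)

section

namespace LaurentSeries

/-- Laurent series over `ℚ` without terms of exponent larger than `n`. -/
def degLE (n : ℤ) : AddSubgroup (LaurentSeries ℚ) where
  carrier := {z | ∀ e, n < e → z.coeff e = 0}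
  add_mem' {x y} hx hy e he := by rw [HahnSeries.coeff_add, hx e he, hy e he, add_zero]
  zero_mem' e _ := by simp
  neg_mem' {x} hx e he := by rw [HahnSeries.coeff_neg, hx e he, neg_zero]

/-- Laurent series over `ℚ` without terms of exponent smaller than `n`. -/
def ordGE (n : ℤ) : AddSubgroup (LaurentSeries ℚ) where
  carrier := {z | ∀ e, e < n → z.coeff e = 0}
  add_mem' {x y} hx hy e he := by rw [HahnSeries.coeff_add, hx e he, hy e he, add_zero]
  zero_mem' e _ := by simp
  neg_mem' {x} hx e he := by rw [HahnSeries.coeff_neg, hx e he, neg_zero]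

lemma mem_ordGE {n : ℤ} {z : LaurentSeries ℚ} : z ∈ ordGE n ↔ ∀ e, e < n → z.coeff e = 0 := Iff.rfl

lemma degLE_mono {m n : ℤ} (h : m ≤ n) : degLE m ≤ degLE n := fun _ hz e he => hz e (by omega)
lemma ordGE_mono {m n : ℤ} (h : m ≤ n) : ordGE n ≤ ordGE m := fun _ hz e he => hz e (by omega)

lemma mul_mem_degLE {m n : ℤ} {x y : LaurentSeries ℚ} (hx : x ∈ degLE m) (hy : y ∈ degLE n) :
    x * y ∈ degLE (m + n) := by
  intro e he
  rw [HahnSeries.coeff_mul]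
  refine Finset.sum_eq_zero fun p hp => ?_
  rw [Finset.mem_antidiagonal] at hp
  by_cases h : m < p.1
  · rw [hx _ h, zero_mul]
  · rw [hy _ (by omega), mul_zero]

lemma mul_mem_ordGE {m n : ℤ} {x y : LaurentSeries ℚ} (hx : x ∈ ordGE m) (hy : y ∈ ordGE n) :
    x * y ∈ ordGE (m + n) := by
  intro e he
  rw [HahnSeries.coeff_mul]
  refine Finset.sum_eq_zero fun p hp => ?_
  rw [Finset.mem_antidiagonal] at hp
  by_cases h : p.1 < m
  · rw [hx _ h, zero_mul]
  · rw [hy _ (by omega), mul_zero]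

lemma one_mem_degLE : (1 : LaurentSeries ℚ) ∈ degLE 0 := by
  intro e he
  rw [HahnSeries.coeff_one, if_neg (by omega)]

lemma one_mem_ordGE : (1 : LaurentSeries ℚ) ∈ ordGE 0 := by
  intro e he
  rw [HahnSeries.coeff_one, if_neg (by omega)]

lemma mul_mem_ordGE_zero {x y : LaurentSeries ℚ} (hx : x ∈ ordGE 0) (hy : y ∈ ordGE 0) :
    x * y ∈ ordGE 0 := mul_mem_ordGE hx hy

lemma natCast_mem_degLE (n : ℕ) : (n : LaurentSeries ℚ) ∈ degLE 0 := by
  rw [← nsmul_one]; exact nsmul_mem one_mem_degLE n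

lemma natCast_mem_ordGE (n : ℕ) : (n : LaurentSeries ℚ) ∈ ordGE 0 := by
  rw [← nsmul_one]; exact nsmul_mem one_mem_ordGE n

lemma ofPowerSeries_mem_ordGE (z : ℚ⟦X⟧) : (HahnSeries.ofPowerSeries ℤ ℚ z) ∈ ordGE 0 := by
  intro e he
  rw [PowerSeries.coeff_coe, if_pos he]

end LaurentSeries

namespace Polynomial
variable {R : Type*} [CommRing R]

lemma coeff_mul_mem (S T V : ℕ → AddSubgroup R) {A B : R[X]} (hA : ∀ j, A.coeff j ∈ S j)
    (hB : ∀ j, B.coeff j ∈ T j) (h : ∀ i j, ∀ x ∈ S i, ∀ y ∈ T j, x * y ∈ V (i + j)) (n : ℕ) :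
    (A * B).coeff n ∈ V n := by
  rw [coeff_mul]
  refine sum_mem fun p hp => ?_
  rw [Finset.HasAntidiagonal.mem_antidiagonal] at hp
  rw [← hp]
  exact h _ _ _ (hA _) _ (hB _)

lemma exists_modByMonic_coeff_mem (S : ℕ → AddSubgroup R) {P : R[X]} (hP : P.Monic)
    (h : ∀ m j, ∀ u ∈ S (m + P.natDegree), j ≤ P.natDegree → u * P.coeff j ∈ S (m + j)) :
    ∀ (n : ℕ) (U : R[X]), U.degree < (P.natDegree + n : ℕ) → (∀ j, U.coeff j ∈ S j) →
      ∀ j, (U %ₘ P).coeff j ∈ S j := by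
  intro n
  induction n with
  | zero =>
    intro U hU hS j
    rcases subsingleton_or_nontrivial R with h | h
    · rw [Subsingleton.elim (coeff _ j) 0]; exact zero_mem _
    · rw [(modByMonic_eq_self_iff hP).2]
      · exact hS j
      · rwa [degree_eq_natDegree hP.ne_zero]
  | succ n ih =>
    intro U hU hS
    set c := U.coeff (n + P.natDegree) with hc
    have key : (U - C c * X ^ n * P) %ₘ P = U %ₘ P := by
      rw [sub_modByMonic, (modByMonic_eq_zero_iff_dvd hP).2 (dvd_mul_left P _), sub_zero]
    rw [← key]
    have hcoef : ∀ j, (C c * X ^ n * P).coeff j = if n ≤ j then c * P.coeff (j - n) else 0 := by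
      intro j
      rw [mul_assoc, coeff_C_mul, coeff_X_pow_mul']
      split_ifs <;> simp
    refine ih _ ?_ ?_
    · rw [degree_lt_iff_coeff_zero] at hU ⊢
      intro m hm
      rw [coeff_sub, hcoef]
      rcases hm.eq_or_lt with h1 | h1
      · rw [if_pos (by omega)]
        have : m - n = P.natDegree := by omega
        rw [this, hP.coeff_natDegree, mul_one, hc, add_comm n, h1, sub_self]
      · rw [hU m (by omega)]
        split_ifs with h2
        · rw [coeff_eq_zero_of_natDegree_lt (p := P) (by omega)]; simp
        · simp
    · intro j
      rw [coeff_sub, hcoef]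
      refine sub_mem (hS j) ?_
      split_ifs with h2
      · by_cases h3 : j - n ≤ P.natDegree
        · have := h n (j - n) c (hS _) h3
          rwa [Nat.add_sub_cancel' h2] at this
        · rw [coeff_eq_zero_of_natDegree_lt (p := P) (by omega), mul_zero]
          exact zero_mem _
      · exact zero_mem _

lemma modByMonic_coeff_mem (S : ℕ → AddSubgroup R) {P : R[X]} (hP : P.Monic)
    (h : ∀ m j, ∀ u ∈ S (m + P.natDegree), j ≤ P.natDegree → u * P.coeff j ∈ S (m + j))
    {U : R[X]} (hU : ∀ j, U.coeff j ∈ S j) (j : ℕ) : (U %ₘ P).coeff j ∈ S j := by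
  refine exists_modByMonic_coeff_mem S hP h (U.natDegree + 1) U ?_ hU j
  refine degree_le_natDegree.trans_lt ?_
  exact_mod_cast (by omega : U.natDegree < P.natDegree + (U.natDegree + 1))

/-- If `P = (X - F) Q` then `Q G ≡ G(F) Q` modulo `P`. -/
lemma mul_modByMonic_of_eq_mul {P Q : R[X]} {F : R} (hPm : P.Monic) (hP : P = (X - C F) * Q)
    (hQ : Q.degree < P.degree) (G : R[X]) : (G * Q) %ₘ P = C (G.eval F) * Q := by
  rcases subsingleton_or_nontrivial R with h | h
  · exact Subsingleton.elim _ _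
  have h1 : P ∣ G * Q - C (G.eval F) * Q := by
    rw [← sub_mul, hP]
    exact mul_dvd_mul_right (X_sub_C_dvd_sub_C_eval) _
  have h2 := (modByMonic_eq_zero_iff_dvd hPm).2 h1
  rw [sub_modByMonic, sub_eq_zero] at h2
  rw [h2, modByMonic_eq_self_iff hPm]
  refine lt_of_le_of_lt ?_ hQ
  rw [← smul_eq_C_mul]
  exact degree_smul_le _ _

end Polynomial

end

section

/-- A monic polynomial `P = (X - F) Q` over `ℚ[t]`, where `F = ℓ f` is a simple root in `ℚ[[t]]`. -/
structure BranchData (f : LaurentSeries ℚ) where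
  P : Polynomial (LaurentSeries ℚ)
  Q : Polynomial (LaurentSeries ℚ)
  F : LaurentSeries ℚ
  ℓ : LaurentSeries ℚ
  δ : ℕ
  degℓ : ℕ
  monic : P.Monic
  natDegree_pos : 1 ≤ P.natDegree
  eq_mul : P = (Polynomial.X - Polynomial.C F) * Q
  eval_ne_zero : Q.eval F ≠ 0
  F_mem : F ∈ LaurentSeries.ordGE 0
  P_mem : ∀ j, P.coeff j ∈ LaurentSeries.ordGE 0
  Q_mem : ∀ j, Q.coeff j ∈ LaurentSeries.ordGE 0
  P_deg : ∀ j ≤ P.natDegree, P.coeff j ∈ LaurentSeries.degLE (δ * (P.natDegree - j))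
  ℓ_ne_zero : ℓ ≠ 0
  ℓ_mem : ℓ ∈ LaurentSeries.ordGE 0
  ℓ_deg : ℓ ∈ LaurentSeries.degLE degℓ
  F_eq : F = ℓ * f

namespace BranchData
open LaurentSeries Polynomial

variable {f : LaurentSeries ℚ} (B : BranchData f)

/-- Polynomials whose `j`-th coefficient has degree at most `N - δ j`. -/
def Weight (N : ℤ) (U : (LaurentSeries ℚ)[X]) : Prop := ∀ j : ℕ, U.coeff j ∈ degLE (N - B.δ * j)

/-- Polynomials which are polar only along the branch `F`. -/
def Polar (U : (LaurentSeries ℚ)[X]) : Prop := ∃ c, ∀ j, U.coeff j - c * B.Q.coeff j ∈ ordGE 0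

lemma Weight.mul {B : BranchData f} {M N : ℤ} {U V : (LaurentSeries ℚ)[X]} (hU : B.Weight M U)
    (hV : B.Weight N V) : B.Weight (M + N) (U * V) := by
  refine coeff_mul_mem (fun j => degLE (M - B.δ * j)) (fun j => degLE (N - B.δ * j))
    (fun j => degLE (M + N - B.δ * j)) hU hV ?_
  intro i j x hx y hy
  refine degLE_mono (le_of_eq ?_) (mul_mem_degLE hx hy)
  push_cast; ring

lemma Weight.modByMonic {B : BranchData f} {N : ℤ} {U : (LaurentSeries ℚ)[X]} (hU : B.Weight N U) :
    B.Weight N (U %ₘ B.P) := by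
  refine modByMonic_coeff_mem (fun j => degLE (N - B.δ * j)) B.monic ?_ hU
  intro m j u hu hj
  refine degLE_mono (le_of_eq ?_) (mul_mem_degLE hu (B.P_deg j hj))
  push_cast; ring

lemma weight_C {N : ℤ} {z : LaurentSeries ℚ} (hz : z ∈ degLE N) : B.Weight N (Polynomial.C z) := by
  intro j
  rw [Polynomial.coeff_C]
  split_ifs with h
  · subst h; simpa using hz
  · exact zero_mem _

lemma weight_X : B.Weight B.δ Polynomial.X := by
  intro j
  rw [Polynomial.coeff_X]
  split_ifs with h
  · subst h; simpa using one_mem_degLE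
  · exact zero_mem _

lemma weight_derivative : B.Weight (B.δ * (B.P.natDegree - 1)) (derivative B.P) := by
  intro j
  rw [Polynomial.coeff_derivative]
  by_cases hj : j + 1 ≤ B.P.natDegree
  · have := mul_mem_degLE (B.P_deg _ hj) (natCast_mem_degLE (j + 1))
    push_cast at this ⊢
    refine degLE_mono (le_of_eq ?_) this
    ring
  · rw [coeff_eq_zero_of_natDegree_lt (by omega), zero_mul]
    exact zero_mem _

lemma mem_ordGE_modByMonic {U : (LaurentSeries ℚ)[X]} (hU : ∀ j, U.coeff j ∈ ordGE 0) (j : ℕ) :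
    (U %ₘ B.P).coeff j ∈ ordGE 0 :=
  modByMonic_coeff_mem (fun _ => ordGE 0) B.monic
    (fun _ j _ hu _ => mul_mem_ordGE_zero hu (B.P_mem j)) hU j

lemma mem_ordGE_mul {U V : (LaurentSeries ℚ)[X]} (hU : ∀ j, U.coeff j ∈ ordGE 0)
    (hV : ∀ j, V.coeff j ∈ ordGE 0) (j : ℕ) : (U * V).coeff j ∈ ordGE 0 :=
  coeff_mul_mem (fun _ => ordGE 0) (fun _ => ordGE 0) (fun _ => ordGE 0) hU hV
    (fun _ _ _ hx _ hy => mul_mem_ordGE_zero hx hy) j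

lemma eval_mem_ordGE {U : (LaurentSeries ℚ)[X]} (hU : ∀ j, U.coeff j ∈ ordGE 0) :
    U.eval B.F ∈ ordGE 0 := by
  rw [eval_eq_sum_range]
  refine sum_mem fun i hi => mul_mem_ordGE_zero (hU i) ?_
  clear hi
  induction i with
  | zero => rw [pow_zero]; exact one_mem_ordGE
  | succ i ih => rw [pow_succ]; exact mul_mem_ordGE_zero ih B.F_mem

lemma Q_monic : B.Q.Monic := by
  have := B.monic
  rw [B.eq_mul] at this
  exact (monic_X_sub_C B.F).of_mul_monic_left this

lemma natDegree_Q : B.Q.natDegree + 1 = B.P.natDegree := by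
  conv_rhs => rw [B.eq_mul, (monic_X_sub_C B.F).natDegree_mul B.Q_monic, natDegree_X_sub_C]
  omega

lemma degree_Q_lt : B.Q.degree < B.P.degree := by
  rw [degree_eq_natDegree B.Q_monic.ne_zero, degree_eq_natDegree B.monic.ne_zero]
  exact_mod_cast (by have := B.natDegree_Q; omega)

lemma eval_P : B.P.eval B.F = 0 := by
  rw [B.eq_mul]; simp

lemma eval_derivative : (derivative B.P).eval B.F = B.Q.eval B.F := by
  conv_lhs => rw [B.eq_mul]
  simp

lemma eval_modByMonic (U : (LaurentSeries ℚ)[X]) : (U %ₘ B.P).eval B.F = U.eval B.F := by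
  conv_rhs => rw [← modByMonic_add_div U B.P]
  rw [eval_add, eval_mul, B.eval_P, zero_mul, add_zero]

/-- Products with a regular polynomial of a polar one stay polar. -/
lemma modByMonic_mul_eq {U H : (LaurentSeries ℚ)[X]} {c : LaurentSeries ℚ}
    (hU : ∀ j, U.coeff j - c * B.Q.coeff j ∈ ordGE 0) (hH : ∀ j, H.coeff j ∈ ordGE 0) (j : ℕ) :
    ((H * U) %ₘ B.P).coeff j - c * H.eval B.F * B.Q.coeff j ∈ ordGE 0 := by
  have h1 : H * U = Polynomial.C c * (H * B.Q) + H * (U - Polynomial.C c * B.Q) := by ring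
  have h2 : (H * U) %ₘ B.P = Polynomial.C (c * H.eval B.F) * B.Q + (H * (U - Polynomial.C c * B.Q)) %ₘ B.P := by
    rw [h1, add_modByMonic, ← Polynomial.smul_eq_C_mul, smul_modByMonic,
      mul_modByMonic_of_eq_mul B.monic B.eq_mul B.degree_Q_lt, Polynomial.smul_eq_C_mul, ← mul_assoc, ← C_mul]
  rw [h2, coeff_add, Polynomial.coeff_C_mul, add_sub_cancel_left]
  refine B.mem_ordGE_modByMonic (mem_ordGE_mul hH fun j => ?_) j
  rw [coeff_sub, Polynomial.coeff_C_mul]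
  exact hU j

/-- The residue formula: residues along the branch `F` are computed by a trace form. -/
lemma coeff_neg_eq {U H : (LaurentSeries ℚ)[X]} {c : LaurentSeries ℚ}
    (hU : ∀ j, U.coeff j - c * B.Q.coeff j ∈ ordGE 0) (hH : ∀ j, H.coeff j ∈ ordGE 0) {e : ℤ}
    (he : e < 0) : (H.eval B.F * U.eval B.F).coeff e =
      (((H * derivative B.P * U) %ₘ B.P).coeff (B.P.natDegree - 1)).coeff e := by
  have hd : ∀ j, (derivative B.P).coeff j ∈ ordGE 0 := fun j => by
    rw [Polynomial.coeff_derivative]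
    have := mul_mem_ordGE_zero (B.P_mem (j + 1)) (natCast_mem_ordGE (j + 1))
    push_cast at this
    exact this
  have h1 := B.modByMonic_mul_eq hU (mem_ordGE_mul hH hd) (B.P.natDegree - 1)
  have hQ1 : B.Q.coeff (B.P.natDegree - 1) = 1 := by
    rw [← B.natDegree_Q, Nat.add_sub_cancel]; exact B.Q_monic
  rw [hQ1, mul_one, eval_mul, eval_derivative] at h1
  have h2 : H.eval B.F * U.eval B.F - c * (H.eval B.F * B.Q.eval B.F) ∈ ordGE 0 := by
    have e1 : H.eval B.F * U.eval B.F - c * (H.eval B.F * B.Q.eval B.F) =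
        H.eval B.F * (U - Polynomial.C c * B.Q).eval B.F := by
      simp; ring
    rw [e1]
    refine mul_mem_ordGE_zero (B.eval_mem_ordGE hH) (B.eval_mem_ordGE fun j => ?_)
    rw [coeff_sub, Polynomial.coeff_C_mul]; exact hU j
  have h3 := sub_mem h2 h1 e he
  rw [sub_sub_sub_cancel_right, HahnSeries.coeff_sub, sub_eq_zero] at h3
  exact h3

/-- The functions with poles only along the branch `F`, and small enough elsewhere. -/
def fn (i : ℕ) : Set (LaurentSeries ℚ) :=
  {z | ∃ U : (LaurentSeries ℚ)[X], U.degree < B.P.degree ∧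
    B.Weight (-(B.degℓ + i * (B.δ + 2) : ℕ)) U ∧ B.Polar U ∧ z = B.ℓ * U.eval B.F}

lemma mul_mem_fn {i j : ℕ} {x y : LaurentSeries ℚ} (hx : x ∈ B.fn i) (hy : y ∈ B.fn j) :
    x * y ∈ B.fn (i + j) := by
  obtain ⟨U, hU1, hU2, ⟨c, hU3⟩, rfl⟩ := hx
  obtain ⟨V, hV1, hV2, ⟨c', hV3⟩, rfl⟩ := hy
  refine ⟨(Polynomial.C B.ℓ * (U * V)) %ₘ B.P, degree_modByMonic_lt _ B.monic, ?_, ?_, ?_⟩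
  · have h := ((B.weight_C B.ℓ_deg).mul (hU2.mul hV2)).modByMonic
    have e : (B.degℓ : ℤ) + (-(B.degℓ + i * (B.δ + 2) : ℕ) + -(B.degℓ + j * (B.δ + 2) : ℕ)) =
        -(B.degℓ + (i + j) * (B.δ + 2) : ℕ) := by push_cast; ring
    rwa [e] at h
  · set r := U - Polynomial.C c * B.Q with hr
    set r' := V - Polynomial.C c' * B.Q with hr'
    have hr0 : ∀ j, r.coeff j ∈ ordGE 0 := fun j => by
      rw [hr, coeff_sub, Polynomial.coeff_C_mul]; exact hU3 j
    have hr0' : ∀ j, r'.coeff j ∈ ordGE 0 := fun j => by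
      rw [hr', coeff_sub, Polynomial.coeff_C_mul]; exact hV3 j
    refine ⟨(Polynomial.C B.ℓ * (Polynomial.C c * V + Polynomial.C c' * r)).eval B.F, fun n => ?_⟩
    have h1 : Polynomial.C B.ℓ * (U * V) = (Polynomial.C B.ℓ * (Polynomial.C c * V + Polynomial.C c' * r)) * B.Q + Polynomial.C B.ℓ * (r * r') := by
      rw [hr', hr]; ring
    rw [h1, add_modByMonic, mul_modByMonic_of_eq_mul B.monic B.eq_mul B.degree_Q_lt, coeff_add,
      Polynomial.coeff_C_mul, add_sub_cancel_left]
    refine B.mem_ordGE_modByMonic (fun j => ?_) n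
    rw [Polynomial.coeff_C_mul]
    exact mul_mem_ordGE_zero B.ℓ_mem (mem_ordGE_mul hr0 hr0' j)
  · rw [eval_modByMonic]; simp; ring

lemma coeff_modByMonic_eq_zero {U H : (LaurentSeries ℚ)[X]} {M N e : ℤ} (hU : B.Weight N U)
    (hH : B.Weight M H) (he : M + N < e) :
    (((H * derivative B.P * U) %ₘ B.P).coeff (B.P.natDegree - 1)).coeff e = 0 := by
  refine ((hH.mul B.weight_derivative).mul hU).modByMonic (B.P.natDegree - 1) e ?_
  have := B.natDegree_pos
  push_cast [this]
  linarith

lemma coeff_mul_fn {i : ℕ} (hi : 1 ≤ i) {x : LaurentSeries ℚ} (hx : x ∈ B.fn i) :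
    (f * x).coeff (-1) = 0 := by
  obtain ⟨U, hU1, hU2, ⟨c, hU3⟩, rfl⟩ := hx
  have h1 : f * (B.ℓ * U.eval B.F) = (Polynomial.X : (LaurentSeries ℚ)[X]).eval B.F * U.eval B.F := by
    rw [eval_X]; nth_rewrite 2 [B.F_eq]; ring
  rw [h1, B.coeff_neg_eq hU3 (fun j => ?_) (by norm_num)]
  · refine B.coeff_modByMonic_eq_zero hU2 B.weight_X ?_
    push_cast
    have : (1 : ℤ) ≤ i := by exact_mod_cast hi
    nlinarith [B.δ.cast_nonneg (α := ℤ), B.degℓ.cast_nonneg (α := ℤ)]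
  · rw [Polynomial.coeff_X]
    split_ifs
    · exact one_mem_ordGE
    · exact zero_mem _

lemma coeff_fn {i a : ℕ} (ha : 1 ≤ a) (hai : a ≤ i) {x : LaurentSeries ℚ} (hx : x ∈ B.fn i) :
    x.coeff (-a) = 0 := by
  obtain ⟨U, hU1, hU2, ⟨c, hU3⟩, rfl⟩ := hx
  have hH0 : ∀ j, (Polynomial.C B.ℓ : (LaurentSeries ℚ)[X]).coeff j ∈ ordGE 0 := fun j => by
    rw [Polynomial.coeff_C]
    split_ifs
    · exact B.ℓ_mem
    · exact zero_mem _
  have h1 : B.ℓ * U.eval B.F = (Polynomial.C B.ℓ).eval B.F * U.eval B.F := by rw [eval_C]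
  rw [h1, B.coeff_neg_eq hU3 hH0 (by omega)]
  refine B.coeff_modByMonic_eq_zero hU2 (B.weight_C B.ℓ_deg) ?_
  push_cast
  have : (a : ℤ) ≤ i := by exact_mod_cast hai
  nlinarith [B.δ.cast_nonneg (α := ℤ), B.degℓ.cast_nonneg (α := ℤ), (Nat.cast_nonneg i : (0:ℤ) ≤ i)]

end BranchData

end

section

namespace LaurentSeries

lemma exists_mem_ordGE_of_mul_mem {z : LaurentSeries ℚ} (hz : z ≠ 0) :
    ∃ v : ℕ, ∀ c : LaurentSeries ℚ, c * z ∈ ordGE 0 → c ∈ ordGE (-v) := by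
  refine ⟨z.order.toNat, fun c hc e he => ?_⟩
  by_contra h
  have hc0 : c ≠ 0 := by rintro rfl; simp at h
  have h1 : c.order ≤ e := HahnSeries.order_le_of_coeff_ne_zero h
  have h2 : (c * z).order = c.order + z.order := HahnSeries.order_mul hc0 hz
  have h3 : (c * z).coeff (c * z).order ≠ 0 := by
    rw [Ne, HahnSeries.coeff_order_eq_zero]; exact mul_ne_zero hc0 hz
  refine h3 (hc _ ?_)
  rw [h2]
  have := z.order.self_le_toNat
  omega

lemma coeff_C_mul (q : ℚ) (z : LaurentSeries ℚ) (e : ℤ) :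
    (HahnSeries.C q * z).coeff e = q * z.coeff e := by
  rw [HahnSeries.C_mul_eq_smul, HahnSeries.coeff_smul, smul_eq_mul]

/-- The Laurent polynomial with prescribed coefficients at the exponents `-(K + 1 + i)`. -/
noncomputable def polarPart (K : ℕ) {m : ℕ} (u : Fin m → ℚ) : LaurentSeries ℚ :=
  ∑ i : Fin m, HahnSeries.single (-((K : ℤ) + 1 + (i : ℕ))) (u i)

lemma coeff_polarPart (K : ℕ) {m : ℕ} (u : Fin m → ℚ) (i : Fin m) :
    (polarPart K u).coeff (-((K : ℤ) + 1 + i)) = u i := by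
  rw [polarPart, HahnSeries.coeff_sum, Finset.sum_eq_single i]
  · rw [HahnSeries.coeff_single_same]
  · intro j _ hj
    refine HahnSeries.coeff_single_of_ne fun h => hj (Fin.ext ?_)
    omega
  · simp

lemma polarPart_mem_degLE (K : ℕ) {m : ℕ} (u : Fin m → ℚ) : polarPart K u ∈ degLE (-K) := by
  refine sum_mem fun i _ e he => HahnSeries.coeff_single_of_ne ?_
  omega

lemma polarPart_mem_ordGE (K : ℕ) {m : ℕ} (u : Fin m → ℚ) :
    polarPart K u ∈ ordGE (-(K + m : ℕ)) := by
  refine sum_mem fun i _ e he => HahnSeries.coeff_single_of_ne ?_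
  have := i.2
  omega

lemma polarPart_add (K : ℕ) {m : ℕ} (u v : Fin m → ℚ) :
    polarPart K (u + v) = polarPart K u + polarPart K v := by
  simp [polarPart, Finset.sum_add_distrib, HahnSeries.single_add]

lemma polarPart_smul (K : ℕ) {m : ℕ} (c : ℚ) (u : Fin m → ℚ) :
    polarPart K (c • u) = HahnSeries.C c * polarPart K u := by
  rw [polarPart, polarPart, Finset.mul_sum]
  refine Finset.sum_congr rfl fun i _ => ?_
  rw [HahnSeries.C_apply, HahnSeries.single_mul_single, zero_add]; rfl

end LaurentSeries

namespace BranchData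
open LaurentSeries Polynomial

variable {f : LaurentSeries ℚ} (B : BranchData f)

/-- The polynomial with coefficients `polarPart K (u j)`. -/
noncomputable def polarPoly (K m : ℕ) (u : Fin B.P.natDegree × Fin m → ℚ) : (LaurentSeries ℚ)[X] :=
  ∑ j : Fin B.P.natDegree, Polynomial.monomial (j : ℕ) (polarPart K fun i => u (j, i))

lemma coeff_polarPoly (K m : ℕ) (u : Fin B.P.natDegree × Fin m → ℚ) (j : Fin B.P.natDegree) :
    (B.polarPoly K m u).coeff j = polarPart K fun i => u (j, i) := by
  rw [polarPoly, finsetSum_coeff, Finset.sum_eq_single j]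
  · rw [Polynomial.coeff_monomial, if_pos rfl]
  · intro i _ hi
    rw [Polynomial.coeff_monomial, if_neg fun h => hi (Fin.ext h)]
  · simp

lemma coeff_polarPoly_of_le (K m : ℕ) (u : Fin B.P.natDegree × Fin m → ℚ) {j : ℕ}
    (hj : B.P.natDegree ≤ j) : (B.polarPoly K m u).coeff j = 0 := by
  rw [polarPoly, finsetSum_coeff]
  refine Finset.sum_eq_zero fun i _ => ?_
  rw [Polynomial.coeff_monomial, if_neg]
  have := i.2
  omega

lemma degree_polarPoly_lt (K m : ℕ) (u : Fin B.P.natDegree × Fin m → ℚ) :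
    (B.polarPoly K m u).degree < B.P.degree := by
  rw [degree_eq_natDegree B.monic.ne_zero, degree_lt_iff_coeff_zero]
  exact fun j hj => B.coeff_polarPoly_of_le K m u hj

lemma polarPoly_add (K m : ℕ) (u v : Fin B.P.natDegree × Fin m → ℚ) :
    B.polarPoly K m (u + v) = B.polarPoly K m u + B.polarPoly K m v := by
  rw [polarPoly, polarPoly, polarPoly, ← Finset.sum_add_distrib]
  refine Finset.sum_congr rfl fun j _ => ?_
  rw [← map_add, ← polarPart_add]; rfl

lemma polarPoly_smul (K m : ℕ) (c : ℚ) (u : Fin B.P.natDegree × Fin m → ℚ) :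
    B.polarPoly K m (c • u) = Polynomial.C (HahnSeries.C c) * B.polarPoly K m u := by
  rw [polarPoly, polarPoly, Finset.mul_sum]
  refine Finset.sum_congr rfl fun j _ => ?_
  rw [C_mul_monomial, ← polarPart_smul]; rfl

lemma polarPoly_mem_ordGE (K m : ℕ) (u : Fin B.P.natDegree × Fin m → ℚ) (j : ℕ) :
    (B.polarPoly K m u).coeff j ∈ ordGE (-(K + m : ℕ)) := by
  by_cases hj : j < B.P.natDegree
  · rw [show j = ((⟨j, hj⟩ : Fin B.P.natDegree) : ℕ) from rfl, coeff_polarPoly]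
    exact polarPart_mem_ordGE K _
  · rw [B.coeff_polarPoly_of_le K m u (not_lt.1 hj)]
    exact zero_mem _

lemma F_pow_mem (i : ℕ) : B.F ^ i ∈ ordGE 0 := by
  induction i with
  | zero => rw [pow_zero]; exact one_mem_ordGE
  | succ i ih => rw [pow_succ]; exact mul_mem_ordGE_zero ih B.F_mem

lemma eval_mem_ordGE_of_coeff {U : (LaurentSeries ℚ)[X]} {n : ℤ} (hU : ∀ j, U.coeff j ∈ ordGE n) :
    U.eval B.F ∈ ordGE n := by
  rw [eval_eq_sum_range]
  refine sum_mem fun i hi => ?_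
  have := mul_mem_ordGE (hU i) (B.F_pow_mem i)
  rwa [add_zero] at this

/-- The pole orders of the functions in `B.fn 1`. -/
def poleOrders : Set ℕ :=
  {l | ∃ β ∈ B.fn 1, β.coeff (-l) ≠ 0 ∧ ∀ n : ℕ, l < n → β.coeff (-n) = 0}

/-- The conditions on a `polarPoly` to be polar and to have no pole along `F`. -/
noncomputable def conditions (K m : ℕ) (T : Finset ℕ) : (Fin B.P.natDegree × Fin m → ℚ) →ₗ[ℚ]
    ((Fin (B.P.natDegree - 1) × Fin (K + m) → ℚ) × (T → ℚ)) where
  toFun u :=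
    (fun p => ((B.polarPoly K m u).coeff p.1 -
      (B.polarPoly K m u).coeff (B.P.natDegree - 1) * B.Q.coeff p.1).coeff (-((p.2 : ℤ) + 1)),
     fun l => (B.ℓ * (B.polarPoly K m u).eval B.F).coeff (-(l : ℕ)))
  map_add' u v := by
    rw [polarPoly_add]
    refine Prod.ext (funext fun p => ?_) (funext fun l => ?_)
    · simp only [coeff_add, HahnSeries.coeff_sub, HahnSeries.coeff_add, add_mul, Prod.fst_add,
        Pi.add_apply]
      ring
    · simp only [eval_add, mul_add, HahnSeries.coeff_add, Prod.snd_add, Pi.add_apply]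
  map_smul' c u := by
    rw [polarPoly_smul]
    refine Prod.ext (funext fun p => ?_) (funext fun l => ?_)
    · simp only [Polynomial.coeff_C_mul, mul_assoc, ← mul_sub, LaurentSeries.coeff_C_mul,
        RingHom.id_apply, Prod.smul_fst, Pi.smul_apply, smul_eq_mul]
    · simp only [eval_mul, eval_C, mul_left_comm B.ℓ, LaurentSeries.coeff_C_mul,
        RingHom.id_apply, Prod.smul_snd, Pi.smul_apply, smul_eq_mul]

lemma exists_conditions_injective : ∃ K : ℕ, ∀ (m : ℕ) (T : Finset ℕ),
    (∀ l ∈ B.poleOrders, 1 ≤ l → l ≤ K + m → l ∈ T) →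
    LinearMap.ker (B.conditions K m T) = ⊥ := by
  obtain ⟨v, hv⟩ := exists_mem_ordGE_of_mul_mem (mul_ne_zero B.ℓ_ne_zero B.eval_ne_zero)
  refine ⟨max v (B.degℓ + 1 * (B.δ + 2) + B.δ * B.P.natDegree), fun m T hT => ?_⟩
  set K := max v (B.degℓ + 1 * (B.δ + 2) + B.δ * B.P.natDegree) with hK
  have hKv : v ≤ K := le_max_left _ _
  have hKN : B.degℓ + 1 * (B.δ + 2) + B.δ * B.P.natDegree ≤ K := le_max_right _ _
  rw [LinearMap.ker_eq_bot']
  intro u hu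
  set U := B.polarPoly K m u with hU
  set c := U.coeff (B.P.natDegree - 1) with hc
  have hu1 : ∀ p : Fin (B.P.natDegree - 1) × Fin (K + m),
      (U.coeff p.1 - c * B.Q.coeff p.1).coeff (-((p.2 : ℤ) + 1)) = 0 :=
    fun p => congrFun (congrArg Prod.fst hu) p
  have hu2 : ∀ l : T, (B.ℓ * U.eval B.F).coeff (-(l : ℕ)) = 0 :=
    fun p => congrFun (congrArg Prod.snd hu) p
  have hUo := B.polarPoly_mem_ordGE K m u
  have hQn := B.natDegree_Q
  have hpolar : ∀ j, U.coeff j - c * B.Q.coeff j ∈ ordGE 0 := by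
    intro j
    rcases lt_trichotomy j (B.P.natDegree - 1) with hj | hj | hj
    · intro e he
      by_cases h : e < -(K + m : ℕ)
      · have := mul_mem_ordGE (hUo (B.P.natDegree - 1)) (B.Q_mem j)
        rw [add_zero] at this
        exact sub_mem (hUo j) this e h
      · have := hu1 (⟨j, hj⟩, ⟨(-e - 1).toNat, by omega⟩)
        have e1 : (-((((-e - 1).toNat : ℕ) : ℤ) + 1)) = e := by omega
        simp only [e1] at this
        exact this
    · have : B.Q.coeff j = 1 := by
        rw [hj, ← hQn, Nat.add_sub_cancel]; exact B.Q_monic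
      rw [this, hj, mul_one, ← hc, sub_self]
      exact zero_mem _
    · rw [hU, B.coeff_polarPoly_of_le K m u (by omega),
        coeff_eq_zero_of_natDegree_lt (p := B.Q) (by omega), mul_zero, sub_zero]
      exact zero_mem _
  have hfn : B.ℓ * U.eval B.F ∈ B.fn 1 := by
    refine ⟨U, B.degree_polarPoly_lt K m u, fun j => ?_, ⟨c, hpolar⟩, rfl⟩
    by_cases hj : j < B.P.natDegree
    · have h1 : U.coeff j = _ := B.coeff_polarPoly K m u ⟨j, hj⟩
      rw [h1]
      refine degLE_mono ?_ (polarPart_mem_degLE K _)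
      have : B.δ * j ≤ B.δ * B.P.natDegree := by gcongr
      zify at this hKN
      push_cast
      linarith
    · rw [hU, B.coeff_polarPoly_of_le K m u (by omega)]
      exact zero_mem _
  have hWo : B.ℓ * U.eval B.F ∈ ordGE (-(K + m : ℕ)) := by
    have := mul_mem_ordGE B.ℓ_mem (B.eval_mem_ordGE_of_coeff hUo)
    rwa [zero_add] at this
  have hreg : B.ℓ * U.eval B.F ∈ ordGE 0 := by
    classical
    by_contra hne
    have hex : ∃ l : ℕ, 1 ≤ l ∧ l ≤ K + m ∧ (B.ℓ * U.eval B.F).coeff (-l) ≠ 0 := by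
      rw [mem_ordGE] at hne
      push Not at hne
      obtain ⟨e, he, hne⟩ := hne
      refine ⟨(-e).toNat, by omega, ?_, ?_⟩
      · by_contra h
        exact hne (hWo e (by omega))
      · rwa [show (-((-e).toNat : ℤ)) = e by omega]
    set S := (Finset.range (K + m + 1)).filter fun l : ℕ =>
      1 ≤ l ∧ (B.ℓ * U.eval B.F).coeff (-(l : ℤ)) ≠ 0 with hS
    obtain ⟨l0, h1, h2, h3⟩ := hex
    have hSne : S.Nonempty := ⟨l0, by simp [hS, h1, h3]; omega⟩
    have hmem := S.max'_mem hSne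
    set l := S.max' hSne with hl
    have hl' := hmem
    rw [hS, Finset.mem_filter, Finset.mem_range] at hl'
    have hmemT := hT l ⟨_, hfn, hl'.2.2, fun n hn => ?_⟩ hl'.2.1 (by omega)
    · exact hl'.2.2 (hu2 ⟨l, hmemT⟩)
    · by_contra h
      by_cases hnK : n ≤ K + m
      · have : n ∈ S := by
          rw [hS, Finset.mem_filter, Finset.mem_range]
          exact ⟨by omega, by omega, h⟩
        exact absurd (S.le_max' n this) (by omega)
      · exact h (hWo _ (by omega))
  have hc' : c ∈ ordGE (-v) := by
    refine hv c ?_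
    have h1 : B.ℓ * U.eval B.F - c * (B.ℓ * B.Q.eval B.F) =
        B.ℓ * (U - Polynomial.C c * B.Q).eval B.F := by
      simp; ring
    have h2 : B.ℓ * U.eval B.F - c * (B.ℓ * B.Q.eval B.F) ∈ ordGE 0 := by
      rw [h1]
      refine mul_mem_ordGE_zero B.ℓ_mem (B.eval_mem_ordGE fun j => ?_)
      rw [coeff_sub, Polynomial.coeff_C_mul]; exact hpolar j
    have := sub_mem hreg h2
    rwa [sub_sub_cancel] at this
  funext ⟨j, i⟩
  have h1 : U.coeff j = _ := B.coeff_polarPoly K m u j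
  have h2 : U.coeff j ∈ ordGE (-v) := by
    have h3 := mul_mem_ordGE hc' (B.Q_mem j)
    rw [add_zero] at h3
    have := add_mem (ordGE_mono (by omega) (hpolar j)) h3
    rwa [sub_add_cancel] at this
  have h3 := coeff_polarPart K (fun i => u (j, i)) i
  rw [← h1, h2 _ (by omega)] at h3
  exact h3.symm

lemma C_mul_mem_fn {i : ℕ} (q : ℚ) {x : LaurentSeries ℚ} (hx : x ∈ B.fn i) :
    HahnSeries.C q * x ∈ B.fn i := by
  obtain ⟨U, hU1, hU2, ⟨c, hU3⟩, rfl⟩ := hx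
  have hC : HahnSeries.C q ∈ ordGE 0 := fun e he => by
    rw [HahnSeries.C_apply]; exact HahnSeries.coeff_single_of_ne (by omega)
  have hC' : HahnSeries.C q ∈ degLE 0 := fun e he => by
    rw [HahnSeries.C_apply]; exact HahnSeries.coeff_single_of_ne (by omega)
  refine ⟨Polynomial.C (HahnSeries.C q) * U, ?_, ?_, ⟨HahnSeries.C q * c, fun j => ?_⟩, ?_⟩
  · rw [← Polynomial.smul_eq_C_mul]
    exact (degree_smul_le _ _).trans_lt hU1
  · have := (B.weight_C hC').mul hU2
    rwa [zero_add] at this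
  · rw [Polynomial.coeff_C_mul, mul_assoc, ← mul_sub]
    exact mul_mem_ordGE_zero hC (hU3 j)
  · rw [eval_mul, eval_C]; ring

theorem exists_pole : ∃ b : ℕ, ∀ l : ℕ, b ≤ l → ∃ β ∈ B.fn 1, β.coeff (-l) = 1 ∧
    ∀ n : ℕ, l < n → β.coeff (-n) = 0 := by
  classical
  obtain ⟨K, hK⟩ := B.exists_conditions_injective
  have hfin : (B.poleOrdersᶜ \ {0}).Finite := by
    by_contra hinf
    obtain ⟨S, hS, hcard⟩ := Set.Infinite.exists_subset_card_eq hinf (B.P.natDegree * K + 1)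
    set n := S.sup id with hn
    set T := (Finset.Icc 1 (K + n)).filter (· ∈ B.poleOrders) with hT
    have hker := hK n T (fun l h1 h2 h3 => by simp [hT, h1, h2, h3])
    have hle := LinearMap.finrank_le_finrank_of_injective (LinearMap.ker_eq_bot.1 hker)
    rw [Module.finrank_prod, Module.finrank_fintype_fun_eq_card, Module.finrank_fintype_fun_eq_card,
      Module.finrank_fintype_fun_eq_card, Fintype.card_prod, Fintype.card_prod, Fintype.card_fin,
      Fintype.card_fin, Fintype.card_fin, Fintype.card_fin, Fintype.card_coe] at hle
    have hd : Disjoint S T := by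
      rw [Finset.disjoint_left]
      intro l hl hl'
      exact (hS hl).1 (Finset.mem_filter.1 hl').2
    have hsub : S ∪ T ⊆ Finset.Icc 1 (K + n) := by
      refine Finset.union_subset (fun l hl => ?_) (Finset.filter_subset _ _)
      have h1 : l ≤ n := Finset.le_sup (f := id) hl
      have h2 : l ≠ 0 := fun h => (hS hl).2 h
      rw [Finset.mem_Icc]; omega
    have h3 := Finset.card_le_card hsub
    rw [Finset.card_union_of_disjoint hd, hcard, Nat.card_Icc] at h3
    obtain ⟨d, hd'⟩ := Nat.exists_eq_add_of_le' B.natDegree_pos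
    rw [hd'] at hle h3
    rw [Nat.add_sub_cancel] at hle h3
    nlinarith
  obtain ⟨b, hb⟩ := hfin.bddAbove
  refine ⟨b + 1, fun l hl => ?_⟩
  have hl' : l ∈ B.poleOrders := by
    by_contra h
    have := hb ⟨h, by simp; omega⟩
    omega
  obtain ⟨β, hβ, h1, h2⟩ := hl'
  refine ⟨_, B.C_mul_mem_fn (β.coeff (-l))⁻¹ hβ, ?_, fun n hn => ?_⟩
  · rw [LaurentSeries.coeff_C_mul, inv_mul_cancel₀ h1]
  · rw [LaurentSeries.coeff_C_mul, h2 n hn, mul_zero]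

end BranchData

end

section

lemma polyEval_comp (g : ℚ⟦X⟧) (p q : Polynomial (Polynomial ℚ)) :
    polyEval g (p.comp q) = polyEval (polyEval g q) p := by
  have : (polyEval g).comp Polynomial.C = Polynomial.coeToPowerSeries.ringHom := by
    ext <;> simp [polyEval]
  rw [Polynomial.comp, Polynomial.hom_eval₂, this]
  rfl

lemma polyEval_eq_eval_map (g : ℚ⟦X⟧) (p : Polynomial (Polynomial ℚ)) :
    polyEval g p = (p.map Polynomial.coeToPowerSeries.ringHom).eval g :=
  (Polynomial.eval_map _ _).symm

lemma LaurentSeries.coe_mem_degLE (p : Polynomial ℚ) :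
    HahnSeries.ofPowerSeries ℤ ℚ (p : ℚ⟦X⟧) ∈ degLE p.natDegree := by
  intro e he
  rw [PowerSeries.coeff_coe, if_neg (by omega), Polynomial.coeff_coe,
    Polynomial.coeff_eq_zero_of_natDegree_lt (by omega)]

/-- The branch data attached to an algebraic power series. -/
theorem IsAlgebraicPS.exists_branchData {f : ℚ⟦X⟧} (hf : IsAlgebraicPS f) :
    Nonempty (BranchData (HahnSeries.ofPowerSeries ℤ ℚ f)) := by
  classical
  obtain ⟨P, hP, hP'⟩ := exists_derivative_eval_ne_zero hf
  have hd : 1 ≤ P.natDegree := by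
    by_contra hlt
    rw [Polynomial.derivative_of_natDegree_zero (by omega), map_zero] at hP'
    exact hP' rfl
  have hP0 : P ≠ 0 := by rintro rfl; simp at hd
  set c := P.leadingCoeff with hc
  have hc0 : c ≠ 0 := Polynomial.leadingCoeff_ne_zero.2 hP0
  have hc0' : (c : ℚ⟦X⟧) ≠ 0 := by simpa using hc0
  set N := P.integralNormalization with hN
  have hcomp : N.comp (Polynomial.C c * Polynomial.X) = Polynomial.C (c ^ (P.natDegree - 1)) * P := by
    ext1 i
    rw [Polynomial.comp_C_mul_X_coeff, Polynomial.coeff_C_mul,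
      Polynomial.integralNormalization_coeff_mul_leadingCoeff_pow _ hd, mul_comm]
  have hNm : N.Monic := Polynomial.monic_integralNormalization hP0
  set F : ℚ⟦X⟧ := (c : ℚ⟦X⟧) * f with hF
  have hev : polyEval f (Polynomial.C c * Polynomial.X) = F := by
    simp only [map_mul, polyEval_C, polyEval_X]; rfl
  have hNF : polyEval F N = 0 := by
    have h := congrArg (polyEval f) hcomp
    rw [polyEval_comp, hev, map_mul, hP, mul_zero] at h
    exact h
  have hNF' : polyEval F (Polynomial.derivative N) ≠ 0 := by
    have h := congrArg (fun q => polyEval f (Polynomial.derivative q)) hcomp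
    simp only [Polynomial.derivative_comp, Polynomial.derivative_C_mul, Polynomial.derivative_X,
      mul_one] at h
    rw [map_mul, map_mul, polyEval_comp, hev, polyEval_C, polyEval_C] at h
    intro h0
    rw [h0, mul_zero] at h
    refine mul_ne_zero ?_ hP' h.symm
    simpa using pow_ne_zero (P.natDegree - 1) hc0
  set M := N.map (Polynomial.coeToPowerSeries.ringHom : Polynomial ℚ →+* ℚ⟦X⟧) with hM
  have hMm : M.Monic := hNm.map _
  have hroot : M.IsRoot F := by
    rw [Polynomial.IsRoot.def, hM, ← polyEval_eq_eval_map, hNF]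
  have hmul := (Polynomial.mul_divByMonic_eq_iff_isRoot (p := M) (a := F)).2 hroot
  set Q := M /ₘ (Polynomial.X - Polynomial.C F) with hQ
  have hQF : Q.eval F ≠ 0 := by
    have h := hNF'
    rw [polyEval_eq_eval_map, ← Polynomial.derivative_map, ← hM, ← hmul, Polynomial.derivative_mul] at h
    simpa using h
  have hinj : Function.Injective (HahnSeries.ofPowerSeries ℤ ℚ) := HahnSeries.ofPowerSeries_injective
  set φ := HahnSeries.ofPowerSeries ℤ ℚ with hφ
  have hdeg : (M.map φ).natDegree = P.natDegree := by
    rw [hMm.natDegree_map, hM, hNm.natDegree_map, hN, Polynomial.natDegree_integralNormalization]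
  have hcoeff : ∀ j, (M.map φ).coeff j = φ ((N.coeff j : Polynomial ℚ) : ℚ⟦X⟧) := by
    intro j
    rw [Polynomial.coeff_map, hM, Polynomial.coeff_map]; rfl
  refine ⟨{ P := M.map φ
            Q := Q.map φ
            F := φ F
            ℓ := φ (c : ℚ⟦X⟧)
            δ := (Finset.range P.natDegree).sup fun j => (N.coeff j).natDegree
            degℓ := c.natDegree
            monic := hMm.map _
            natDegree_pos := by rw [hdeg]; exact hd
            eq_mul := ?_
            eval_ne_zero := ?_
            F_mem := LaurentSeries.ofPowerSeries_mem_ordGE _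
            P_mem := fun j => ?_
            Q_mem := fun j => ?_
            P_deg := fun j hj => ?_
            ℓ_ne_zero := ?_
            ℓ_mem := LaurentSeries.ofPowerSeries_mem_ordGE _
            ℓ_deg := LaurentSeries.coe_mem_degLE c
            F_eq := ?_ }⟩
  · rw [← hmul, Polynomial.map_mul, Polynomial.map_sub, Polynomial.map_X, Polynomial.map_C]
  · rw [Polynomial.eval_map_apply, Ne, map_eq_zero_iff _ hinj]
    exact hQF
  · rw [Polynomial.coeff_map]; exact LaurentSeries.ofPowerSeries_mem_ordGE _
  · rw [Polynomial.coeff_map]; exact LaurentSeries.ofPowerSeries_mem_ordGE _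
  · rw [hcoeff, hdeg]
    rw [hdeg] at hj
    rcases hj.lt_or_eq with hlt | rfl
    · refine LaurentSeries.degLE_mono ?_ (LaurentSeries.coe_mem_degLE _)
      have h1 : (N.coeff j).natDegree ≤ (Finset.range P.natDegree).sup fun j => (N.coeff j).natDegree :=
        Finset.le_sup (f := fun j => (N.coeff j).natDegree) (Finset.mem_range.2 hlt)
      have h2 : (1 : ℤ) ≤ P.natDegree - j := by omega
      have h3 : ((N.coeff j).natDegree : ℤ) ≤ ((Finset.range P.natDegree).sup fun j => (N.coeff j).natDegree : ℕ) := by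
        exact_mod_cast h1
      nlinarith
    · rw [hN, Polynomial.integralNormalization_coeff_natDegree hP0]
      simpa using LaurentSeries.one_mem_degLE
  · rw [Ne, map_eq_zero_iff _ hinj]; exact hc0'
  · rw [hF, map_mul]

section growth
open LaurentSeries

lemma SubNorm.ls_ofPowerSeries (ρ : NNReal) (hρ : ρ ≠ 0) (z : ℚ⟦X⟧) :
    SubNorm.rat.ls ρ hρ (HahnSeries.ofPowerSeries ℤ ℚ z) = SubNorm.rat.ps ρ z := by
  rw [SubNorm.ls_apply, SubNorm.ps_apply, ← (Nat.cast_injective (R := ℤ)).tsum_eq]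
  · refine tsum_congr fun n => ?_
    rw [PowerSeries.coeff_coe, if_neg (by omega)]
    simp
  · intro e he
    by_contra hne
    apply he
    have : e < 0 := by
      by_contra h
      exact hne ⟨e.toNat, by simp; omega⟩
    beta_reduce
    rw [PowerSeries.coeff_coe, if_pos this]
    simp

lemma SubNorm.ls_lt_top_of_mem (ρ : NNReal) (hρ : ρ ≠ 0) {z : LaurentSeries ℚ} {n : ℤ}
    (hz : z ∈ degLE n) : SubNorm.rat.ls ρ hρ z < ⊤ := by
  classical
  rw [SubNorm.ls_apply, tsum_eq_sum (s := Finset.Icc z.order n)]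
  · exact ENNReal.sum_lt_top.2 fun i _ => ENNReal.mul_lt_top (by simp)
      (by rw [lt_top_iff_ne_top]; exact ENNReal.zpow_ne_top (by simpa using hρ) (by simp) _)
  · intro e he
    have : z.coeff e = 0 := by
      rcases lt_or_ge e z.order with h | h
      · exact HahnSeries.coeff_eq_zero_of_lt_order h
      · refine hz e ?_
        by_contra h'
        exact he (Finset.mem_Icc.2 ⟨h, by omega⟩)
    rw [this]; simp

/-- Functions in the filtration have the same radius of convergence as `f`. -/
lemma BranchData.fn_lt_top {f : LaurentSeries ℚ} (B : BranchData f) (ρ : NNReal) (hρ : ρ ≠ 0)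
    (hf : SubNorm.rat.ls ρ hρ f < ⊤) {i : ℕ} {z : LaurentSeries ℚ} (hz : z ∈ B.fn i) :
    SubNorm.rat.ls ρ hρ z < ⊤ := by
  obtain ⟨U, -, hU, -, rfl⟩ := hz
  have hl := SubNorm.ls_lt_top_of_mem ρ hρ B.ℓ_deg
  have hF : SubNorm.rat.ls ρ hρ B.F < ⊤ := by rw [B.F_eq]; exact SubNorm.mul_lt_top _ hl hf
  refine SubNorm.mul_lt_top _ hl ?_
  rw [Polynomial.eval_eq_sum_range]
  exact SubNorm.sum_lt_top _ _ _ fun j _ =>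
    SubNorm.mul_lt_top _ (SubNorm.ls_lt_top_of_mem ρ hρ (hU j)) (SubNorm.pow_lt_top _ hF j)

end growth

/-- Functions on the curve of `f` with controlled poles. -/
theorem IsAlgebraicPS.exists_filtration {f : ℚ⟦X⟧} (hf : IsAlgebraicPS f) :
    ∃ (A : ℕ → Set (LaurentSeries ℚ)) (b : ℕ) (r : NNReal) (hr : r ≠ 0),
      (∀ i j, ∀ x ∈ A i, ∀ y ∈ A j, x * y ∈ A (i + j)) ∧
      (∀ i, 1 ≤ i → ∀ x ∈ A i, ((HahnSeries.ofPowerSeries ℤ ℚ f) * x).coeff (-1) = 0) ∧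
      (∀ i, ∀ x ∈ A i, ∀ a : ℕ, 1 ≤ a → a ≤ i → x.coeff (-a) = 0) ∧
      (∀ l : ℕ, b ≤ l → ∃ β ∈ A 1, β.coeff (-l) = 1 ∧ ∀ n : ℕ, l < n → β.coeff (-n) = 0) ∧
      (∀ x ∈ A 1, SubNorm.rat.ls r hr x < ⊤) ∧
      SubNorm.rat.ls r hr (HahnSeries.ofPowerSeries ℤ ℚ f) < ⊤ := by
  obtain ⟨B⟩ := hf.exists_branchData
  obtain ⟨ρ, hρ, hb⟩ := hf.exists_bound
  obtain ⟨b, h⟩ := B.exists_pole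
  have hfb : SubNorm.rat.ls ρ hρ.ne' (HahnSeries.ofPowerSeries ℤ ℚ f) < ⊤ := by
    rwa [SubNorm.ls_ofPowerSeries]
  exact ⟨B.fn, b, ρ, hρ.ne', fun i j x hx y hy => B.mul_mem_fn hx hy,
    fun i hi x hx => B.coeff_mul_fn hi hx, fun i x hx a ha hai => B.coeff_fn ha hai hx, h,
    fun x hx => B.fn_lt_top ρ hρ.ne' hfb hx, hfb⟩

end

section

section charP
variable {𝔽 : Type*} [CommRing 𝔽]

lemma PowerSeries.one_sub_mul_divisorSeries {T : ℕ} (hT : 1 ≤ T) (c : 𝔽) :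
    (1 - C c * X ^ T) * (mk fun N => if N ≠ 0 ∧ T ∣ N then (T : 𝔽) * c ^ (N / T) else 0) =
      C (T * c) * X ^ T := by
  ext N
  rw [sub_mul, one_mul, map_sub, mul_assoc, coeff_C_mul, coeff_X_pow_mul', coeff_C_mul, coeff_X_pow,
    coeff_mk, coeff_mk]
  rcases lt_trichotomy N T with h | rfl | h
  · rw [if_neg (by omega : ¬ T ≤ N), if_neg (by omega : ¬ N = T), if_neg]
    · simp
    · rintro ⟨h0, h1⟩
      exact absurd (Nat.le_of_dvd (by omega) h1) (by omega)
  · have h0 : N ≠ 0 := by omega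
    simp [Nat.div_self hT, h0]
  · rw [if_pos h.le, if_neg (by omega : ¬ N = T), mul_zero]
    simp only [Nat.dvd_sub_self_right]
    by_cases hd : T ∣ N
    · obtain ⟨m, rfl⟩ := hd
      have hm : 2 ≤ m := by
        by_contra hlt
        have : m ≤ 1 := by omega
        nlinarith
      obtain ⟨k, rfl⟩ := Nat.exists_eq_add_of_le hm
      have e1 : T * (2 + k) - T = T * (1 + k) := by
        rw [Nat.sub_eq_iff_eq_add (by nlinarith)]; ring
      rw [e1, if_pos ⟨by positivity, by simp⟩, if_pos ⟨by positivity, by simp⟩,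
        Nat.mul_div_cancel_left _ (by omega), Nat.mul_div_cancel_left _ (by omega)]
      ring
    · rw [if_neg (fun h => hd h.2), if_neg]
      · simp
      · rintro ⟨h0, h1 | h1⟩
        · exact hd h1
        · omega

/-- In characteristic `p`, every Frobenius-compatible sequence is to any finite order the sequence of
coefficients of a logarithmic derivative. -/
lemma exists_logDeriv (p : ℕ) [hp : Fact p.Prime] [CharP 𝔽 p] (Q : ℕ → 𝔽)
    (hQ : ∀ m, 1 ≤ m → Q (p * m) = Q m ^ p) (T : ℕ) :
    ∃ w q : 𝔽⟦X⟧, constantCoeff w = 1 ∧ X * d⁄dX 𝔽 w = - q * w ∧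
      (∀ m, 1 ≤ m → coeff (p * m) q = coeff m q ^ p) ∧ constantCoeff q = 0 ∧
      ∀ N, 1 ≤ N → N ≤ T → coeff N q = Q N := by
  induction T with
  | zero =>
    refine ⟨1, 0, by simp, by simp, fun m hm => ?_, by simp, fun N h1 h2 => by omega⟩
    simp [hp.out.ne_zero]
  | succ T ih =>
    obtain ⟨w, q, hw, hwq, hF, h0, hN⟩ := ih
    by_cases hpT : p ∣ T + 1
    · refine ⟨w, q, hw, hwq, hF, h0, fun N h1 h2 => ?_⟩
      rcases h2.lt_or_eq with h | rfl
      · exact hN N h1 (by omega)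
      · obtain ⟨m, hm⟩ := hpT
        have hm1 : 1 ≤ m := by
          rcases Nat.eq_zero_or_pos m with rfl | h
          · omega
          · exact h
        have hmT : m ≤ T := by nlinarith [hp.out.two_le]
        rw [hm, hF m hm1, hQ m hm1, hN m hm1 hmT]
    · obtain ⟨c, hc⟩ : ∃ c : 𝔽, (T + 1 : ℕ) * c = Q (T + 1) - coeff (T + 1) q := by
        have : IsUnit ((T + 1 : ℕ) : 𝔽) := (CharP.isUnit_natCast_iff hp.out).2 hpT
        obtain ⟨i, hi⟩ := this.exists_right_inv
        exact ⟨i * (Q (T + 1) - coeff (T + 1) q), by rw [← mul_assoc, hi, one_mul]⟩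
      set e : 𝔽⟦X⟧ := mk fun N => if N ≠ 0 ∧ (T + 1) ∣ N then ((T + 1 : ℕ) : 𝔽) * c ^ (N / (T + 1)) else 0
        with he
      have hmul := one_sub_mul_divisorSeries (by omega : 1 ≤ T + 1) c
      rw [← he] at hmul
      have heN : ∀ N, N < T + 1 → coeff N e = 0 := by
        intro N hN
        rw [he, coeff_mk, if_neg]
        rintro ⟨h0, h1⟩
        exact absurd (Nat.le_of_dvd (by omega) h1) (by omega)
      refine ⟨w * (1 - C c * X ^ (T + 1)), q + e, by simp [hw], ?_, ?_, ?_, ?_⟩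
      · rw [Derivation.leibniz, map_sub, Derivation.leibniz, Derivation.leibniz_pow]
        simp only [smul_eq_mul, derivative_C, derivative_X, Derivation.map_one_eq_zero, mul_zero, zero_sub,
          add_zero, Nat.add_sub_cancel, mul_one, nsmul_eq_mul]
        rw [map_mul, map_natCast] at hmul
        push_cast at hmul ⊢
        linear_combination (1 - C c * X ^ (T + 1)) * hwq + w * hmul
      · intro m hm
        rw [map_add, map_add, add_pow_char, hF m hm, he, coeff_mk, coeff_mk]
        congr 1
        have hco : Nat.Coprime (T + 1) p := ((Nat.Prime.coprime_iff_not_dvd hp.out).2 hpT).symm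
        have hiff : (T + 1) ∣ p * m ↔ (T + 1) ∣ m := hco.dvd_mul_left
        by_cases hd : (T + 1) ∣ m
        · rw [if_pos ⟨by have := hp.out.pos; positivity, hiff.2 hd⟩, if_pos ⟨by omega, hd⟩, mul_pow,
            Nat.mul_div_assoc _ hd, ← pow_mul, mul_comm p, ← frobenius_def (p := p), map_natCast]
        · rw [if_neg (fun h => hd (hiff.1 h.2)), if_neg (fun h => hd h.2), zero_pow hp.out.ne_zero]
      · simp [h0, he]
      · intro N h1 h2
        rw [map_add]
        rcases h2.lt_or_eq with h | rfl
        · rw [heN N h, add_zero, hN N h1 (by omega)]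
        · rw [he, coeff_mk, if_pos ⟨by omega, dvd_rfl⟩, Nat.div_self (by omega), pow_one, hc]
          ring

lemma iterate_derivative_eq_zero (p : ℕ) [hp : Fact p.Prime] [CharP 𝔽 p] (u : 𝔽⟦X⟧) :
    (d⁄dX 𝔽)^[p] u = 0 := by
  ext n
  rw [coeff_iterate_derivative, map_zero]
  have : p ∣ (n + 1).ascFactorial p :=
    (Nat.dvd_factorial hp.out.pos le_rfl).trans (Nat.factorial_dvd_ascFactorial _ _)
  rw [(CharP.cast_eq_zero_iff 𝔽 p _).2 this, zero_mul]

/-- The `p`-curvature of the connection `u ↦ u' + b u` vanishes. -/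
lemma iterate_connection_eq_zero (p : ℕ) [hp : Fact p.Prime] [CharP 𝔽 p] (Q : ℕ → 𝔽)
    (hQ : ∀ m, 1 ≤ m → Q (p * m) = Q m ^ p) (u : 𝔽⟦X⟧) :
    (fun v => d⁄dX 𝔽 v - (mk fun n => Q (n + 1)) * v)^[p] u = 0 := by
  set b : 𝔽⟦X⟧ := mk fun n => Q (n + 1) with hb
  refine eq_of_forall_X_pow_dvd fun e => ?_
  rw [sub_zero]
  obtain ⟨w, q, hw, hwq, hF, h0, hN⟩ := exists_logDeriv p Q hQ (e + p)
  have hdiv : (X : 𝔽⟦X⟧) ^ (e + p) ∣ b * w + d⁄dX 𝔽 w := by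
    have h1 : (X : 𝔽⟦X⟧) ^ (e + p + 1) ∣ X * b - q := by
      rw [X_pow_dvd_iff]
      intro m hm
      rcases m with _ | m
      · simp [h0]
      · rw [map_sub, coeff_succ_X_mul, hb, coeff_mk, hN (m + 1) (by omega) (by omega), sub_self]
    obtain ⟨z, hz⟩ := h1
    refine ⟨z * w, X_mul_cancel ?_⟩
    linear_combination hwq + w * hz
  have key : ∀ i, i ≤ p → (X : 𝔽⟦X⟧) ^ (e + p - i) ∣
      w * (fun v => d⁄dX 𝔽 v - b * v)^[i] u - (d⁄dX 𝔽)^[i] (w * u) := by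
    intro i
    induction i with
    | zero => intro _; simp
    | succ i ih =>
      intro hi
      obtain ⟨z, hz⟩ := ih (by omega)
      obtain ⟨y, hy⟩ := hdiv
      rw [Function.iterate_succ_apply', Function.iterate_succ_apply']
      set v := (fun v => d⁄dX 𝔽 v - b * v)^[i] u with hv
      obtain ⟨k, hk⟩ := Nat.exists_eq_add_of_le (by omega : i + 1 ≤ e + p)
      have hz' := congrArg (d⁄dX 𝔽) hz
      rw [map_sub, Derivation.leibniz, Derivation.leibniz, Derivation.leibniz_pow,
        show e + p - i = k + 1 by omega] at hz'
      simp only [smul_eq_mul, derivative_X, mul_one, Nat.add_sub_cancel, nsmul_eq_mul] at hz'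
      rw [show e + p - (i + 1) = k by omega]
      rw [hk] at hy
      have : w * (d⁄dX 𝔽 v - b * v) - d⁄dX 𝔽 ((d⁄dX 𝔽)^[i] (w * u)) =
          X ^ k * (X * d⁄dX 𝔽 z + z * ((k + 1 : ℕ) : 𝔽⟦X⟧) - X ^ (i + 1) * y * v) := by
        linear_combination hz' - v * hy
      rw [this]
      exact dvd_mul_right _ _
  have h := key p le_rfl
  rw [iterate_derivative_eq_zero, sub_zero, Nat.add_sub_cancel] at h
  have hu : IsUnit w := by rw [isUnit_iff_constantCoeff, hw]; exact isUnit_one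
  exact (hu.dvd_mul_left).1 h

end charP

end

/-- A common denominator for the coefficients up to order `n` of exponentials of logarithms satisfying
Frobenius congruences at the primes `p ≥ B`. -/
noncomputable def expDenom (B n : ℕ) : ℕ :=
  B.factorial ^ n * ∏ p ∈ (Finset.range (n + 1)).filter Nat.Prime, p ^ ((n / p).factorial.factorization p)

lemma expDenom_pos (B n : ℕ) : 0 < expDenom B n := by
  refine Nat.mul_pos (pow_pos B.factorial_pos n) (Finset.prod_pos fun p hp => ?_)
  exact pow_pos (Finset.mem_filter.1 hp).2.pos _

lemma factorization_factorial_eq {p : ℕ} (hp : p.Prime) (n : ℕ) :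
    n.factorial.factorization p = (n / p).factorial.factorization p + n / p := by
  have : Fact p.Prime := ⟨hp⟩
  have h := padicValNat_mul_div_factorial (p := p) n
  rw [← Nat.factorization_def _ hp, ← Nat.factorization_def _ hp, Nat.factorization_factorial_mul hp] at h
  exact h.symm

lemma factorial_dvd_expDenom_mul {B n i : ℕ} (hi : i ≤ n) {u : ℤ}
    (hu : ∀ p : ℕ, p.Prime → B ≤ p → (p : ℤ) ^ (i / p) ∣ u) : (i.factorial : ℤ) ∣ expDenom B n * u := by
  rw [← Int.natAbs_dvd_natAbs, Int.natAbs_mul, Int.natAbs_natCast, Int.natAbs_natCast,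
    Nat.dvd_iff_prime_pow_dvd_dvd]
  intro p k hp hk
  have hk' : k ≤ i.factorial.factorization p :=
    (hp.pow_dvd_iff_le_factorization i.factorial_ne_zero).1 hk
  refine (pow_dvd_pow p hk').trans ?_
  rcases lt_or_ge p B with hB | hB
  · refine Dvd.dvd.mul_right (Dvd.dvd.mul_right ?_ _) _
    have h1 : i.factorial.factorization p ≤ n :=
      (Nat.factorization_factorial_le_div_pred hp i).trans ((Nat.div_le_self _ _).trans hi)
    exact (pow_dvd_pow p h1).trans (pow_dvd_pow_of_dvd (Nat.dvd_factorial hp.pos hB.le) n)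
  · rw [factorization_factorial_eq hp, pow_add]
    refine mul_dvd_mul (Dvd.dvd.mul_left ?_ _) ?_
    · by_cases hpn : p ∈ (Finset.range (n + 1)).filter Nat.Prime
      · refine Dvd.dvd.trans (pow_dvd_pow p ?_) (Finset.dvd_prod_of_mem _ hpn)
        exact (Nat.factorization_le_iff_dvd (Nat.factorial_ne_zero _) (Nat.factorial_ne_zero _)).2
          (Nat.factorial_dvd_factorial (Nat.div_le_div_right hi)) p
      · have : n < p := by
          by_contra h
          exact hpn (Finset.mem_filter.2 ⟨Finset.mem_range.2 (by omega), hp⟩)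
        rw [Nat.div_eq_of_lt (by omega)]
        simp
    · simpa [← Int.natAbs_dvd_natAbs, Int.natAbs_pow] using hu p hp hB

lemma exists_expDenom_le (B : ℕ) : ∃ C : ℝ, 1 ≤ C ∧ ∀ n, (expDenom B n : ℝ) ≤ C ^ n := by
  have hs : Summable fun k : ℕ => 1 / (k : ℝ) ^ (3 / 2 : ℝ) :=
    Real.summable_one_div_nat_rpow.2 (by norm_num)
  set S := ∑' k : ℕ, 1 / (k : ℝ) ^ (3 / 2 : ℝ) with hS
  have hS0 : 0 ≤ S := tsum_nonneg fun k => by positivity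
  refine ⟨B.factorial * Real.exp (4 * S), ?_, fun n => ?_⟩
  · have h1 : (1 : ℝ) ≤ B.factorial := by exact_mod_cast B.factorial_pos
    have h2 : 1 ≤ Real.exp (4 * S) := Real.one_le_exp (by positivity)
    nlinarith
  · rw [expDenom, mul_pow]
    push_cast
    refine mul_le_mul_of_nonneg_left ?_ (by positivity)
    calc ∏ p ∈ (Finset.range (n + 1)).filter Nat.Prime, (p : ℝ) ^ ((n / p).factorial.factorization p)
        ≤ ∏ p ∈ (Finset.range (n + 1)).filter Nat.Prime, Real.exp (4 * n * (1 / (p : ℝ) ^ (3 / 2 : ℝ))) := by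
          refine Finset.prod_le_prod (fun p _ => by positivity) fun p hp => ?_
          have hp := (Finset.mem_filter.1 hp).2
          have hp0 : (0 : ℝ) < p := by exact_mod_cast hp.pos
          have hp2 : (2 : ℝ) ≤ p := by exact_mod_cast hp.two_le
          rw [← Real.exp_log hp0, ← Real.exp_nat_mul, Real.exp_log hp0]
          refine Real.exp_le_exp.2 ?_
          have h1 : (((n / p).factorial.factorization p : ℕ) : ℝ) ≤ 2 * n / (p * p) := by
            have a1 : (((n / p).factorial.factorization p : ℕ) : ℝ) ≤ ((n / p / (p - 1) : ℕ) : ℝ) := by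
              exact_mod_cast Nat.factorization_factorial_le_div_pred hp _
            have a2 : ((n / p / (p - 1) : ℕ) : ℝ) ≤ (n : ℝ) / p / ((p - 1 : ℕ) : ℝ) :=
              Nat.cast_div_le.trans (by gcongr; exact Nat.cast_div_le)
            rw [Nat.cast_sub hp.one_le, Nat.cast_one] at a2
            refine a1.trans (a2.trans ?_)
            rw [div_div, div_le_div_iff₀ (by nlinarith) (by positivity)]
            nlinarith [mul_nonneg (Nat.cast_nonneg (α := ℝ) n) (mul_nonneg hp0.le (by linarith : (0 : ℝ) ≤ p - 2))]
          have h2 : Real.log p ≤ 2 * (p : ℝ) ^ (1 / 2 : ℝ) := by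
            have := Real.log_le_rpow_div hp0.le (by norm_num : (0 : ℝ) < 1 / 2)
            linarith
          have h3 : (p : ℝ) ^ (1 / 2 : ℝ) / (p * p) = 1 / (p : ℝ) ^ (3 / 2 : ℝ) := by
            rw [div_eq_div_iff (by positivity) (by positivity), ← Real.rpow_add hp0]
            norm_num [pow_two]
          calc _ ≤ 2 * n / (p * p) * (2 * (p : ℝ) ^ (1 / 2 : ℝ)) :=
                mul_le_mul h1 h2 (Real.log_nonneg (by linarith)) (by positivity)
            _ = 4 * n * ((p : ℝ) ^ (1 / 2 : ℝ) / (p * p)) := by ring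
            _ = _ := by rw [h3]
      _ = Real.exp (4 * n * ∑ p ∈ (Finset.range (n + 1)).filter Nat.Prime, 1 / (p : ℝ) ^ (3 / 2 : ℝ)) := by
          rw [← Real.exp_sum, Finset.mul_sum]
      _ ≤ Real.exp (n * (4 * S)) := by
          refine Real.exp_le_exp.2 ?_
          have := hs.sum_le_tsum ((Finset.range (n + 1)).filter Nat.Prime) (fun k _ => by positivity)
          rw [← hS] at this
          nlinarith [mul_le_mul_of_nonneg_left this (Nat.cast_nonneg (α := ℝ) n)]
      _ = _ := by rw [Real.exp_nat_mul]

section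

/-- The connection `u ↦ u' - b u`. -/
noncomputable def connection {R : Type*} [CommRing R] (b : R⟦X⟧) : R⟦X⟧ →ₗ[R] R⟦X⟧ :=
  (d⁄dX R).toLinearMap - LinearMap.mulLeft R b

lemma connection_apply {R : Type*} [CommRing R] (b u : R⟦X⟧) :
    connection b u = d⁄dX R u - b * u := rfl

lemma map_connection {R S : Type*} [CommRing R] [CommRing S] (φ : R →+* S) (b u : R⟦X⟧) :
    PowerSeries.map φ (connection b u) = connection (PowerSeries.map φ b) (PowerSeries.map φ u) := by
  rw [connection_apply, connection_apply, map_sub, map_mul]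
  congr 1
  ext n
  simp [PowerSeries.coeff_derivative]

lemma map_connection_pow {R S : Type*} [CommRing R] [CommRing S] (φ : R →+* S) (b u : R⟦X⟧) (n : ℕ) :
    PowerSeries.map φ ((connection b ^ n) u) =
      (connection (PowerSeries.map φ b) ^ n) (PowerSeries.map φ u) := by
  induction n with
  | zero => simp
  | succ n ih => rw [pow_succ', pow_succ', Module.End.mul_apply, Module.End.mul_apply, map_connection, ih]

lemma connection_pow_eq_zero {𝔽 : Type*} [CommRing 𝔽] (p : ℕ) [Fact p.Prime] [CharP 𝔽 p] (Q : ℕ → 𝔽)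
    (hQ : ∀ m, 1 ≤ m → Q (p * m) = Q m ^ p) (u : 𝔽⟦X⟧) :
    (connection (mk fun n => Q (n + 1)) ^ p) u = 0 := by
  rw [Module.End.pow_apply]
  exact iterate_connection_eq_zero p Q hQ u

section
variable {σ : Type*}

lemma exists_connection_pow_eq {p : ℕ} [hp : Fact p.Prime] (Q : ℕ → MvPolynomial σ ℤ)
    (hQ : ∀ m, 1 ≤ m → (p : MvPolynomial σ ℤ) ∣ Q (p * m) - Q m ^ p) (u : (MvPolynomial σ ℤ)⟦X⟧) :
    ∃ v, (connection (mk fun n => Q (n + 1)) ^ p) u = (p : MvPolynomial σ ℤ) • v := by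
  have h0 : PowerSeries.map (MvPolynomial.map (Int.castRingHom (ZMod p)))
      ((connection (mk fun n => Q (n + 1)) ^ p) u) = 0 := by
    rw [map_connection_pow]
    refine connection_pow_eq_zero p (fun n => MvPolynomial.map (Int.castRingHom (ZMod p)) (Q n)) (fun m hm => ?_) _
    have := hQ m hm
    rw [← map_natCast (MvPolynomial.C : ℤ →+* MvPolynomial σ ℤ)] at this
    have := (MvPolynomial.C_dvd_iff_zmod p _).1 (by simpa using this)
    rwa [_root_.map_sub, map_pow, sub_eq_zero] at this
  have h1 : ∀ n, ∃ v, coeff n ((connection (mk fun n => Q (n + 1)) ^ p) u) =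
      (p : MvPolynomial σ ℤ) * v := by
    intro n
    have h2 := congrArg (coeff n) h0
    rw [coeff_map, _root_.map_zero] at h2
    have := (MvPolynomial.C_dvd_iff_zmod p _).2 h2
    obtain ⟨v, hv⟩ := this
    exact ⟨v, by simpa using hv⟩
  choose v hv using h1
  exact ⟨mk v, by ext1 n; rw [hv, map_smul, coeff_mk, smul_eq_mul]⟩

lemma exists_connection_pow_mul_eq {p : ℕ} [hp : Fact p.Prime] (Q : ℕ → MvPolynomial σ ℤ)
    (hQ : ∀ m, 1 ≤ m → (p : MvPolynomial σ ℤ) ∣ Q (p * m) - Q m ^ p) (q : ℕ) (u : (MvPolynomial σ ℤ)⟦X⟧) :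
    ∃ v, (connection (mk fun n => Q (n + 1)) ^ (p * q)) u = (p : MvPolynomial σ ℤ) ^ q • v := by
  induction q with
  | zero => exact ⟨u, by simp⟩
  | succ q ih =>
    obtain ⟨v, hv⟩ := ih
    obtain ⟨w, hw⟩ := exists_connection_pow_eq Q hQ v
    refine ⟨w, ?_⟩
    rw [mul_add, mul_one, add_comm, pow_add, Module.End.mul_apply, hv, map_smul, hw, smul_smul, pow_succ]

lemma iterate_derivative_eq_connection_mul {R : Type*} [CommRing R] {b y : R⟦X⟧}
    (h : d⁄dX R y = - b * y) (n : ℕ) : (d⁄dX R)^[n] y = (connection b ^ n) 1 * y := by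
  induction n with
  | zero => simp
  | succ n ih =>
    rw [Function.iterate_succ_apply', ih, pow_succ', Module.End.mul_apply, connection_apply,
      Derivation.leibniz, h]
    simp only [smul_eq_mul]
    ring

/-- Denominators of the exponential of a logarithm satisfying Frobenius congruences. -/
theorem exists_integral_Exp (P : ℕ → MvPolynomial σ ℤ) {B : ℕ}
    (hP : ∀ p : ℕ, p.Prime → B ≤ p → ∀ n, 1 ≤ n → (p : MvPolynomial σ ℤ) ∣ P (p * n) - P n ^ p)
    {i n : ℕ} (hi : i ≤ n) :
    ∃ u : MvPolynomial σ ℤ, (expDenom B n : MvPolynomial σ ℚ) *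
      coeff i (Exp (mk fun m => ((-1) ^ (m + 1) / m : ℚ) • MvPolynomial.map (Int.castRingHom ℚ) (P m))) =
        MvPolynomial.map (Int.castRingHom ℚ) u := by
  classical
  set z : (MvPolynomial σ ℚ)⟦X⟧ := mk fun m => ((-1) ^ (m + 1) / m : ℚ) • MvPolynomial.map (Int.castRingHom ℚ) (P m) with hz
  have hz0 : constantCoeff z = 0 := by simp [hz]
  set Q : ℕ → MvPolynomial σ ℤ := fun n => (-1) ^ n * P n with hQ
  set b : (MvPolynomial σ ℤ)⟦X⟧ := mk fun n => Q (n + 1) with hb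
  have hdz : d⁄dX _ z = - PowerSeries.map (MvPolynomial.map (Int.castRingHom ℚ)) b := by
    ext1 n
    rw [PowerSeries.coeff_derivative, map_neg, coeff_map, hz, hb, coeff_mk, coeff_mk, hQ]
    have h1 : ((n : MvPolynomial σ ℚ) + 1) = MvPolynomial.C ((n : ℚ) + 1) := by simp
    have h2 : ((n : ℚ) + 1) ≠ 0 := by positivity
    simp only [MvPolynomial.smul_eq_C_mul, map_mul, map_pow, map_neg, map_one]
    rw [h1, mul_right_comm, ← MvPolynomial.C_mul]
    have h3 : ((-1) ^ (n + 1 + 1) / ((n + 1 : ℕ) : ℚ) * ((n : ℚ) + 1)) = - (-1) ^ (n + 1) := by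
      push_cast; field_simp; ring
    rw [h3]; simp
  have hY := iterate_derivative_eq_connection_mul (b := PowerSeries.map (MvPolynomial.map (Int.castRingHom ℚ)) b)
    (y := Exp z) (by rw [derivative_Exp hz0, hdz]) i
  set U := constantCoeff ((connection b ^ i) 1) with hU
  have hU1 : (i.factorial : MvPolynomial σ ℚ) * coeff i (Exp z) = MvPolynomial.map (Int.castRingHom ℚ) U := by
    have h := congrArg constantCoeff hY
    rw [constantCoeff_iterate_derivative, map_mul, constantCoeff_Exp, mul_one] at h
    rw [h, ← map_one (PowerSeries.map (MvPolynomial.map (Int.castRingHom ℚ))), ← map_connection_pow,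
      ← coeff_zero_eq_constantCoeff_apply, coeff_map, coeff_zero_eq_constantCoeff_apply]
  have hdiv : ∀ p : ℕ, p.Prime → B ≤ p → ((p : MvPolynomial σ ℤ) ^ (i / p)) ∣ U := by
    intro p hp hBp
    have : Fact p.Prime := ⟨hp⟩
    have hQp : ∀ m, 1 ≤ m → (p : MvPolynomial σ ℤ) ∣ Q (p * m) - Q m ^ p := by
      intro m hm
      have : Q (p * m) - Q m ^ p = (-1) ^ (p * m) * (P (p * m) - P m ^ p) := by
        simp only [hQ]; ring
      rw [this]
      exact (hP p hp hBp m hm).mul_left _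
    obtain ⟨v, hv⟩ := exists_connection_pow_mul_eq Q hQp (i / p) ((connection b ^ (i % p)) 1)
    have : U = (p : MvPolynomial σ ℤ) ^ (i / p) * constantCoeff v := by
      rw [hU, ← Nat.div_add_mod i p, pow_add, Module.End.mul_apply, hv]
      simp [PowerSeries.smul_eq_C_mul, Nat.div_add_mod]
    exact ⟨_, this⟩
  have hfac : (MvPolynomial.C (i.factorial : ℤ) : MvPolynomial σ ℤ) ∣ MvPolynomial.C (expDenom B n : ℤ) * U := by
    rw [MvPolynomial.C_dvd_iff_dvd_coeff]
    intro m
    rw [MvPolynomial.coeff_C_mul]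
    refine factorial_dvd_expDenom_mul hi fun p hp hBp => ?_
    have h := hdiv p hp hBp
    have e : ((p : MvPolynomial σ ℤ) ^ (i / p)) = MvPolynomial.C ((p : ℤ) ^ (i / p)) := by simp
    rw [e, MvPolynomial.C_dvd_iff_dvd_coeff] at h
    exact h m
  obtain ⟨u, hu⟩ := hfac
  refine ⟨u, ?_⟩
  have hne : (i.factorial : MvPolynomial σ ℚ) ≠ 0 := by exact_mod_cast i.factorial_ne_zero
  refine mul_left_cancel₀ hne ?_
  have hu' := congrArg (MvPolynomial.map (Int.castRingHom ℚ)) hu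
  simp only [map_mul, MvPolynomial.map_C] at hu'
  rw [mul_left_comm, hU1]
  simpa using hu'
end

end

section

section
variable {R S : Type*} [CommRing R] [CommRing S]

/-- The linear functional `X ^ e ↦ c e` on polynomials. -/
noncomputable def Polynomial.moment (c : ℕ → R) : Polynomial R →ₗ[R] R :=
  Polynomial.lsum fun e => LinearMap.id.smulRight (c e)

@[simp] lemma Polynomial.moment_monomial (c : ℕ → R) (e : ℕ) (r : R) :
    Polynomial.moment c (Polynomial.monomial e r) = r * c e := by
  simp [Polynomial.moment, Polynomial.lsum_apply]

lemma Polynomial.map_moment (φ : R →+* S) (c : ℕ → R) (z : Polynomial R) :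
    φ (Polynomial.moment c z) = Polynomial.moment (fun e => φ (c e)) (z.map φ) := by
  induction z using Polynomial.induction_on' with
  | add p q hp hq => simp only [map_add, Polynomial.map_add, hp, hq]
  | monomial e r => simp

lemma Polynomial.moment_congr {c c' : ℕ → R} {z : Polynomial R} (h : ∀ e, z.coeff e ≠ 0 → c e = c' e) :
    Polynomial.moment c z = Polynomial.moment c' z := by
  simp only [Polynomial.moment, Polynomial.lsum_apply, Polynomial.sum]
  refine Finset.sum_congr rfl fun e he => ?_
  simp [h e (Polynomial.mem_support_iff.1 he)]

lemma Polynomial.moment_pow_char (p : ℕ) [hp : Fact p.Prime] [CharP R p] {c c' : ℕ → R} {z : Polynomial R}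
    (h : ∀ e, z.coeff e ≠ 0 → c' (p * e) = c e ^ p) :
    Polynomial.moment c' (z ^ p) = Polynomial.moment c z ^ p := by
  rw [← z.sum_monomial_eq, Polynomial.sum, sum_pow_char, map_sum, map_sum, sum_pow_char]
  refine Finset.sum_congr rfl fun e he => ?_
  rw [Polynomial.monomial_pow, moment_monomial, moment_monomial, mul_pow, mul_comm e p,
    h e (Polynomial.mem_support_iff.1 he)]

/-- The polynomial `∑ l, u l X ^ (l + 1)`. -/
noncomputable def tailPoly {g : ℕ} (u : Fin g → R) : Polynomial R :=
  ∑ l, Polynomial.C (u l) * Polynomial.X ^ ((l : ℕ) + 1)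

lemma map_tailPoly {g : ℕ} (φ : R →+* S) (u : Fin g → R) :
    (tailPoly u).map φ = tailPoly fun l => φ (u l) := by
  simp [tailPoly, Polynomial.map_sum]

lemma natDegree_tailPoly_pow_le {g : ℕ} (u : Fin g → R) (n : ℕ) : (tailPoly u ^ n).natDegree ≤ n * g := by
  refine Polynomial.natDegree_pow_le_of_le n ?_
  refine Polynomial.natDegree_sum_le_of_forall_le _ _ fun l _ => ?_
  exact (Polynomial.natDegree_C_mul_X_pow_le _ _).trans l.2

lemma X_dvd_tailPoly {g : ℕ} (u : Fin g → R) : Polynomial.X ∣ tailPoly u :=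
  Finset.dvd_sum fun l _ => (dvd_pow_self _ (by omega)).mul_left _

/-- The polynomial whose value at `u` is the value of the functional `X ^ e ↦ a e` at
`(∑ l, u l X ^ (l + 1)) ^ n`. -/
noncomputable def momentPoly (a : ℕ → ℚ) (g n : ℕ) : MvPolynomial (Fin g) ℚ :=
  Polynomial.moment (fun e => MvPolynomial.C (a e)) (tailPoly MvPolynomial.X ^ n)

/-- The series `∑ (-1)^(m+1) P_m h^m / m` of the polynomials `P_m = momentPoly a g m`. -/
noncomputable def momentLog (a : ℕ → ℚ) (g : ℕ) : (MvPolynomial (Fin g) ℚ)⟦X⟧ :=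
  mk fun m => ((-1) ^ (m + 1) / m : ℚ) • momentPoly a g m

lemma constantCoeff_momentLog (a : ℕ → ℚ) (g : ℕ) : constantCoeff (momentLog a g) = 0 := by
  simp [momentLog]

/-- Integral form of `momentPoly`. -/
noncomputable def intMomentPoly (A : ℕ) (k : ℕ → ℤ) (g n : ℕ) : MvPolynomial (Fin g) ℤ :=
  Polynomial.moment (fun e => MvPolynomial.C ((A : ℤ) ^ (g * n - e) * k e)) (tailPoly MvPolynomial.X ^ n)

lemma pos_le_of_coeff_tailPoly_pow_ne_zero {g : ℕ} {u : Fin g → R} {n e : ℕ} (hn : 1 ≤ n)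
    (h : (tailPoly u ^ n).coeff e ≠ 0) : 1 ≤ e ∧ e ≤ g * n := by
  constructor
  · by_contra he
    have : e = 0 := by omega
    subst this
    apply h
    rw [← Polynomial.X_dvd_iff]
    exact (X_dvd_tailPoly u).trans (dvd_pow_self _ (by omega))
  · by_contra he
    apply h
    apply Polynomial.coeff_eq_zero_of_natDegree_lt
    have := natDegree_tailPoly_pow_le u n
    rw [mul_comm] at this
    omega

lemma map_intMomentPoly {a : ℕ → ℚ} {A : ℕ} {k : ℕ → ℤ} (hk : ∀ n, 1 ≤ n → (A : ℚ) ^ n * a n = k n)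
    (g : ℕ) {n : ℕ} (hn : 1 ≤ n) :
    MvPolynomial.map (Int.castRingHom ℚ) (intMomentPoly A k g n) = ((A : ℚ) ^ g) ^ n • momentPoly a g n := by
  rw [intMomentPoly, momentPoly, Polynomial.map_moment, Polynomial.map_pow, map_tailPoly]
  have e1 : (fun l => MvPolynomial.map (Int.castRingHom ℚ) (MvPolynomial.X l : MvPolynomial (Fin g) ℤ)) =
      MvPolynomial.X := by funext l; simp
  have e2 : ∀ z : Polynomial (MvPolynomial (Fin g) ℚ), ((A : ℚ) ^ g) ^ n •
      Polynomial.moment (fun e => MvPolynomial.C (a e)) z = Polynomial.moment (fun e =>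
        MvPolynomial.C (((A : ℚ) ^ g) ^ n * a e)) z := by
    intro z
    induction z using Polynomial.induction_on' with
    | add p q hp hq => simp only [map_add, smul_add, hp, hq]
    | monomial e r =>
      rw [Polynomial.moment_monomial, Polynomial.moment_monomial, MvPolynomial.smul_eq_C_mul, MvPolynomial.C_mul]
      ring
  rw [e1, e2]
  refine Polynomial.moment_congr fun e he => ?_
  obtain ⟨h1, h2⟩ := pos_le_of_coeff_tailPoly_pow_ne_zero hn he
  rw [MvPolynomial.map_C]
  congr 1
  simp only [map_mul, map_pow, eq_intCast, Int.cast_natCast]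
  rw [← hk e h1, ← mul_assoc, ← pow_add, Nat.sub_add_cancel h2, pow_mul]

lemma dvd_intMomentPoly_sub {A : ℕ} {k : ℕ → ℤ} {p : ℕ} (hp : p.Prime)
    (hk : ∀ n, 1 ≤ n → (p : ℤ) ∣ k (p * n) - k n ^ p) (g : ℕ) {n : ℕ} (hn : 1 ≤ n) :
    (p : MvPolynomial (Fin g) ℤ) ∣ intMomentPoly A k g (p * n) - intMomentPoly A k g n ^ p := by
  have : Fact p.Prime := ⟨hp⟩
  have e : (p : MvPolynomial (Fin g) ℤ) = MvPolynomial.C (p : ℤ) := by simp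
  rw [e, MvPolynomial.C_dvd_iff_zmod, map_sub, map_pow, sub_eq_zero]
  rw [intMomentPoly, intMomentPoly, Polynomial.map_moment, Polynomial.map_moment, Polynomial.map_pow,
    Polynomial.map_pow, mul_comm p n, pow_mul]
  refine Polynomial.moment_pow_char p fun e he => ?_
  rw [map_tailPoly] at he
  obtain ⟨h1, h2⟩ := pos_le_of_coeff_tailPoly_pow_ne_zero hn he
  rw [MvPolynomial.map_C, MvPolynomial.map_C, ← map_pow]
  congr 1
  have := (ZMod.intCast_zmod_eq_zero_iff_dvd _ p).2 (hk e h1)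
  push_cast at this
  simp only [map_mul, map_pow, eq_intCast, Int.cast_natCast, mul_pow]
  rw [← sub_eq_zero.1 this, ← pow_mul]
  congr 2
  rw [← mul_assoc, mul_comm p e, ← Nat.sub_mul]

end

lemma dvd_of_memPZp {p : ℕ} (hp : p.Prime) {m : ℤ} (h : MemPZp p m) : (p : ℤ) ∣ m := by
  obtain ⟨y, hy, he⟩ := h
  have h1 : (m : ℚ) * y.den = p * y.num := by
    rw [he, mul_assoc, Rat.mul_den_eq_num]
  have h2 : m * y.den = p * y.num := by exact_mod_cast h1
  have h3 : (p : ℤ) ∣ m * y.den := ⟨_, h2⟩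
  refine ((Nat.prime_iff_prime_int.1 hp).dvd_or_dvd h3).resolve_right fun h4 => hy ?_
  exact_mod_cast h4

lemma MemPZp.int_mul {p : ℕ} (m : ℤ) {x : ℚ} (h : MemPZp p x) : MemPZp p (m * x) := by
  obtain ⟨y, hy, rfl⟩ := h
  refine ⟨m * y, fun hd => hy (hd.trans ?_), by ring⟩
  have := Rat.mul_den_dvd (m : ℚ) y
  simpa using this

/-- Common denominators of exponential size for the powers of the exponential of `momentLog`. -/
theorem exists_denominator {a : ℕ → ℚ} (halg : IsAlgebraicPS (mk fun k => a (k + 1)))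
    {B : ℕ} (ha : ∀ p : ℕ, p.Prime → B ≤ p → ∀ n : ℕ, 1 ≤ n → MemPZp p (a (n * p) - a n)) (g : ℕ) :
    ∃ C : ℝ, 1 ≤ C ∧ ∀ n, ∃ Δ : ℕ, 1 ≤ Δ ∧ (Δ : ℝ) ≤ C ^ n ∧ ∀ i, i ≤ n → ∀ j : ℕ,
      ∃ u : MvPolynomial (Fin g) ℤ, (Δ : MvPolynomial (Fin g) ℚ) * coeff i (Exp (momentLog a g) ^ j) =
        MvPolynomial.map (Int.castRingHom ℚ) u := by
  obtain ⟨A, hA, hcoeff_int⟩ := halg.exists_integral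
  have : ∀ n, ∃ k : ℤ, 1 ≤ n → (A : ℚ) ^ n * a n = k := by
    intro n
    rcases n with _ | n
    · exact ⟨0, by simp⟩
    · obtain ⟨k, hk⟩ := hcoeff_int n
      exact ⟨k, fun _ => by simpa using hk⟩
  choose k hk using this
  obtain ⟨C, hC1, hC⟩ := exists_expDenom_le (B + A + 1)
  have hA' : (1 : ℝ) ≤ (A : ℝ) ^ g := one_le_pow₀ (by exact_mod_cast hA)
  refine ⟨(A : ℝ) ^ g * C, by nlinarith, fun n => ⟨(A ^ g) ^ n * expDenom (B + A + 1) n, ?_, ?_, ?_⟩⟩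
  · exact Nat.mul_pos (by positivity) (expDenom_pos _ _)
  · push_cast
    rw [mul_pow]
    exact mul_le_mul_of_nonneg_left (hC n) (by positivity)
  · intro i hi j
    have hkp : ∀ p : ℕ, p.Prime → B + A + 1 ≤ p → ∀ n, 1 ≤ n → (p : ℤ) ∣ k (p * n) - k n ^ p := by
      intro p hp hBp n hn
      have : Fact p.Prime := ⟨hp⟩
      have h1 : (p : ℤ) ∣ k (p * n) - A ^ ((p - 1) * n) * k n := by
        apply dvd_of_memPZp hp
        have h2 := MemPZp.int_mul ((A : ℤ) ^ (n * p)) (ha p hp (by omega) n hn)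
        convert h2 using 1
        push_cast
        rw [mul_sub, hk (n * p) (Nat.mul_pos hn hp.pos), mul_comm p n, ← hk n hn, ← mul_assoc, ← pow_add]
        congr 3
        obtain ⟨q, rfl⟩ := Nat.exists_eq_add_of_le hp.one_le
        simp; ring
      have hAp : ((A : ℤ) : ZMod p) ≠ 0 := by
        rw [Int.cast_natCast, Ne, ZMod.natCast_eq_zero_iff]
        intro h
        exact absurd (Nat.le_of_dvd hA h) (by omega)
      have h3 := (ZMod.intCast_zmod_eq_zero_iff_dvd _ p).2 h1
      rw [← ZMod.intCast_zmod_eq_zero_iff_dvd]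
      push_cast at h3 hAp ⊢
      rw [pow_mul, ZMod.pow_card_sub_one_eq_one hAp, one_pow, one_mul] at h3
      rw [ZMod.pow_card, h3]
    have hP : ∀ p : ℕ, p.Prime → B + A + 1 ≤ p → ∀ n, 1 ≤ n → (p : MvPolynomial (Fin g) ℤ) ∣
        (j : MvPolynomial (Fin g) ℤ) * intMomentPoly A k g (p * n) -
          ((j : MvPolynomial (Fin g) ℤ) * intMomentPoly A k g n) ^ p := by
      intro p hp hBp n hn
      have : Fact p.Prime := ⟨hp⟩
      have h1 := dvd_intMomentPoly_sub (A := A) hp (hkp p hp hBp) g hn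
      have h2 : (p : MvPolynomial (Fin g) ℤ) ∣ (j : MvPolynomial (Fin g) ℤ) - (j : MvPolynomial (Fin g) ℤ) ^ p := by
        have h : (p : ℤ) ∣ (j : ℤ) - (j : ℤ) ^ p := by
          rw [← ZMod.intCast_zmod_eq_zero_iff_dvd]; push_cast; rw [ZMod.pow_card, sub_self]
        have := map_dvd (MvPolynomial.C : ℤ →+* MvPolynomial (Fin g) ℤ) h
        simpa using this
      have := dvd_add (h1.mul_left (j : MvPolynomial (Fin g) ℤ))
        (h2.mul_right (intMomentPoly A k g n ^ p))
      convert this using 1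
      ring
    obtain ⟨u, hu⟩ := exists_integral_Exp _ hP hi
    have hz : (mk fun m => ((-1) ^ (m + 1) / m : ℚ) • MvPolynomial.map (Int.castRingHom ℚ)
        ((j : MvPolynomial (Fin g) ℤ) * intMomentPoly A k g m)) =
        rescale (MvPolynomial.C ((A : ℚ) ^ g)) (j • momentLog a g) := by
      ext1 m
      rw [coeff_mk, coeff_rescale, map_nsmul, momentLog, coeff_mk]
      rcases Nat.eq_zero_or_pos m with rfl | hm
      · simp
      · rw [map_mul, map_intMomentPoly hk g hm, map_natCast, nsmul_eq_mul]
        simp only [MvPolynomial.smul_eq_C_mul, map_pow]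
        ring
    have hE : Exp (rescale (MvPolynomial.C ((A : ℚ) ^ g)) (j • momentLog a g)) =
        rescale (MvPolynomial.C ((A : ℚ) ^ g)) (Exp (momentLog a g) ^ j) := by
      rw [← Exp_nsmul (constantCoeff_momentLog a g)]
      symm
      refine map_ratComp _ _ (fun n z hz => ?_) (by simp [constantCoeff_momentLog])
      rw [X_pow_dvd_iff] at hz ⊢
      intro m hm
      rw [coeff_rescale, hz m hm, mul_zero]
    rw [hz, hE, coeff_rescale] at hu
    refine ⟨MvPolynomial.C (((A : ℤ) ^ g) ^ (n - i)) * u, ?_⟩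
    rw [map_mul, ← hu, MvPolynomial.map_C]
    obtain ⟨d, rfl⟩ := Nat.exists_eq_add_of_le hi
    rw [Nat.add_sub_cancel_left]
    simp only [map_pow, map_natCast, Nat.cast_mul, Nat.cast_pow]
    ring

end

section

namespace PowerSeries

section mapCoeff
variable {L R : Type*} [CommRing L] [CommRing R]

/-- Apply an additive map to every coefficient of a power series. -/
noncomputable def mapCoeff (φ : L →+ R) : L⟦X⟧ →+ R⟦X⟧ where
  toFun z := mk fun n => φ (coeff n z)
  map_zero' := by ext; simp
  map_add' x y := by ext; simp

@[simp] lemma coeff_mapCoeff (φ : L →+ R) (n : ℕ) (z : L⟦X⟧) :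
    coeff n (mapCoeff φ z) = φ (coeff n z) := by
  simp [mapCoeff]

lemma X_pow_dvd_mapCoeff (φ : L →+ R) {n : ℕ} {z : L⟦X⟧} (h : (X : L⟦X⟧) ^ n ∣ z) :
    (X : R⟦X⟧) ^ n ∣ mapCoeff φ z := by
  rw [X_pow_dvd_iff] at h ⊢
  intro m hm
  rw [coeff_mapCoeff, h m hm, map_zero]

lemma mapCoeff_map_mul (φ : L →+ R) (j : R →+* L) (h : ∀ r x, φ (j r * x) = r * φ x)
    (u : R⟦X⟧) (z : L⟦X⟧) : mapCoeff φ (PowerSeries.map j u * z) = u * mapCoeff φ z := by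
  ext n
  rw [coeff_mapCoeff, coeff_mul, coeff_mul, map_sum]
  simp [h]

lemma mapCoeff_C_mul (φ : L →+ R) (x : L) (z : L⟦X⟧) :
    mapCoeff φ (C x * z) = mapCoeff (φ.comp (AddMonoidHom.mulLeft x)) z := by
  ext n
  simp

lemma mapCoeff_ratComp [Algebra ℚ L] [Algebra ℚ R] (φ : L →+ R) (c : ℕ → ℚ) {z : L⟦X⟧}
    (hz : constantCoeff z = 0) {K : ℕ} (hK : ∀ i, K ≤ i → c i ≠ 0 → mapCoeff φ (z ^ i) = 0) :
    mapCoeff φ (ratComp c z) = ∑ i ∈ Finset.range K, c i • mapCoeff φ (z ^ i) := by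
  ext n
  have h1 := coeff_ratComp_of_lt c hz (N := n + 1 + K) (n := n) (by omega)
  rw [coeff_mapCoeff, h1, map_sum, map_sum]
  symm
  refine (Finset.sum_subset (Finset.range_mono (by omega : K ≤ n + 1 + K)) ?_).trans ?_
  · intro i _ hi
    rcases eq_or_ne (c i) 0 with h | h
    · simp [h]
    · rw [hK i (by simpa using hi) h]; simp
  · refine Finset.sum_congr rfl fun i _ => ?_
    rw [map_rat_smul φ]
    rw [map_rat_smul (coeff n : R⟦X⟧ →ₗ[R] R), coeff_mapCoeff]

end mapCoeff

end PowerSeries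

namespace SubNorm
variable {R : Type*} [CommRing R] [Algebra ℚ R] (N : SubNorm R)

lemma ps_ratComp_le (ρ : NNReal) (c : ℕ → ℚ) (z : R⟦X⟧) :
    N.ps ρ (ratComp c z) ≤ ∑' i, ‖c i‖ₑ * N.ps ρ z ^ i := by
  calc N.ps ρ (ratComp c z)
      ≤ ∑' n, (∑' i, ‖c i‖ₑ * N (coeff n (z ^ i))) * (ρ : ENNReal) ^ n := by
        rw [ps_apply]
        refine ENNReal.tsum_le_tsum fun n => ?_
        gcongr
        rw [ratComp, coeff_mk]
        refine (N.sum_le _ _).trans ((Finset.sum_le_sum fun i _ => N.smul_le _ _).trans ?_)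
        exact ENNReal.sum_le_tsum _
    _ = ∑' i, ‖c i‖ₑ * N.ps ρ (z ^ i) := by
        simp_rw [← ENNReal.tsum_mul_right]
        rw [ENNReal.tsum_comm]
        refine tsum_congr fun i => ?_
        rw [ps_apply, ← ENNReal.tsum_mul_left]
        simp [mul_assoc]
    _ ≤ _ := by
        refine ENNReal.tsum_le_tsum fun i => ?_
        gcongr
        exact (N.ps ρ).pow_le _ _

lemma ps_Log_lt_top (ρ : NNReal) {z : R⟦X⟧} (h : N.ps ρ z ≤ 1 / 4) : N.ps ρ (Log z) < ⊤ := by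
  refine (N.ps_ratComp_le ρ _ z).trans_lt ?_
  calc _ ≤ ∑' i : ℕ, (1 / 4 : ENNReal) ^ i := by
        refine ENNReal.tsum_le_tsum fun i => ?_
        have : ‖((-1 : ℚ) ^ (i + 1) / (i : ℚ))‖ₑ ≤ 1 := by
          rw [← ofReal_norm, norm_div, norm_pow, norm_neg, norm_one, one_pow]
          rw [← ENNReal.ofReal_one]
          apply ENNReal.ofReal_le_ofReal
          rcases Nat.eq_zero_or_pos i with rfl | hi
          · simp
          · rw [div_le_one (by rw [norm_pos_iff]; positivity)]
            have : (1 : ℝ) ≤ i := by exact_mod_cast hi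
            rwa [show ‖(i : ℚ)‖ = (i : ℝ) by rw [← Rat.norm_cast_real]; simp]
        calc _ ≤ 1 * (1 / 4 : ENNReal) ^ i := by gcongr
          _ = _ := one_mul _
    _ < ⊤ := by
        rw [ENNReal.tsum_geometric]
        simp only [ENNReal.inv_lt_top, tsub_pos_iff_lt]
        rw [one_div]
        exact ENNReal.inv_lt_one.2 (by norm_num)

lemma ps_Exp_lt_top (ρ : NNReal) {z : R⟦X⟧} (h : N.ps ρ z < ⊤) : N.ps ρ (Exp z) < ⊤ := by
  refine (N.ps_ratComp_le ρ _ z).trans_lt ?_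
  obtain ⟨y, hy⟩ : ∃ y : NNReal, (y : ENNReal) = N.ps ρ z := ⟨_, ENNReal.coe_toNNReal h.ne⟩
  have hs : Summable fun i : ℕ => (y ^ i / (i.factorial : NNReal) : NNReal) := by
    rw [← NNReal.summable_coe]
    simpa using Real.summable_pow_div_factorial (y : ℝ)
  have := ENNReal.tsum_coe_ne_top_iff_summable.2 hs
  rw [lt_top_iff_ne_top]
  convert this using 3 with i
  rw [← hy]
  have : ‖(1 / (i.factorial : ℚ))‖ₑ = ((1 / (i.factorial : NNReal) : NNReal) : ENNReal) := by
    rw [enorm_eq_nnnorm]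
    congr 1
    ext
    rw [coe_nnnorm, ← Rat.norm_cast_real]
    simp
  rw [this]
  norm_cast
  rw [div_mul_eq_mul_div, one_mul]

lemma algebraMap_le (q : ℚ) : N (algebraMap ℚ R q) ≤ ‖q‖ₑ := by
  rw [Algebra.algebraMap_eq_smul_one]
  calc _ ≤ ‖q‖ₑ * N 1 := N.smul_le _ _
    _ ≤ ‖q‖ₑ * 1 := by gcongr; exact N.one_le
    _ = _ := mul_one _

/-- Elements of finite size after multiplication by a power of `d`. -/
def fin (d : R) (hd : N d < ⊤) : Subalgebra ℚ R where
  carrier := {z | ∃ c : ℕ, N (d ^ c * z) < ⊤}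
  mul_mem' := by
    rintro x y ⟨c, hx⟩ ⟨c', hy⟩
    refine ⟨c + c', ?_⟩
    rw [show d ^ (c + c') * (x * y) = (d ^ c * x) * (d ^ c' * y) by ring]
    exact N.mul_lt_top hx hy
  add_mem' := by
    rintro x y ⟨c, hx⟩ ⟨c', hy⟩
    refine ⟨c + c', ?_⟩
    rw [show d ^ (c + c') * (x + y) = d ^ c' * (d ^ c * x) + d ^ c * (d ^ c' * y) by ring]
    exact N.add_lt_top (N.mul_lt_top (N.pow_lt_top hd _) hx) (N.mul_lt_top (N.pow_lt_top hd _) hy)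
  algebraMap_mem' q := ⟨0, by simpa using (N.algebraMap_le q).trans_lt (by simp)⟩

lemma mem_fin_of_lt_top {d : R} {hd : N d < ⊤} {z : R} (h : N z < ⊤) : z ∈ N.fin d hd :=
  ⟨0, by simpa using h⟩

lemma exists_common_exponent {d : R} {hd : N d < ⊤} {g : ℕ} {x : Fin g → R}
    (h : ∀ l, x l ∈ N.fin d hd) : ∃ c : ℕ, ∀ l, N (d ^ c * x l) < ⊤ := by
  choose c hc using h
  refine ⟨∑ l, c l, fun l => ?_⟩
  obtain ⟨e, he⟩ : ∃ e, ∑ l, c l = e + c l :=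
    ⟨∑ l, c l - c l, by
      have := Finset.single_le_sum (f := c) (fun i _ => Nat.zero_le _) (Finset.mem_univ l)
      omega⟩
  rw [he, pow_add, mul_assoc]
  exact N.mul_lt_top (N.pow_lt_top hd _) (hc l)

end SubNorm

end

section

namespace LaurentSeries
variable {R : Type*} [CommRing R]

/-- A coefficient of a Laurent series, as an additive map. -/
def coeffHom (e : ℤ) : LaurentSeries R →+ R where
  toFun z := z.coeff e
  map_zero' := by simp
  map_add' x y := by simp

@[simp] lemma coeffHom_apply (e : ℤ) (z : LaurentSeries R) : coeffHom e z = z.coeff e := rfl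

/-- The part of a Laurent series with negative exponents, as an additive map. -/
def negHom : LaurentSeries R →+ LaurentSeries R where
  toFun z := HahnSeries.truncLT 0 z
  map_zero' := by simp
  map_add' x y := HahnSeries.truncLT_add _ _ _

lemma coeff_negHom (z : LaurentSeries R) (e : ℤ) :
    (negHom z).coeff e = if e < 0 then z.coeff e else 0 :=
  HahnSeries.coeff_truncLT _ _ _

/-- Base change of Laurent series with rational coefficients. -/
noncomputable def ratMap (R : Type*) [CommRing R] [Algebra ℚ R] :
    LaurentSeries ℚ →+* LaurentSeries R where
  toFun z := z.map (algebraMap ℚ R)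
  map_zero' := by ext; simp
  map_one' := by
    ext e
    rw [HahnSeries.map_coeff, HahnSeries.coeff_one, HahnSeries.coeff_one]
    split_ifs <;> simp
  map_add' x y := by ext; simp
  map_mul' x y := by
    ext e
    have hy : (y.map (algebraMap ℚ R)).support ⊆ y.support := fun i hi => by
      rw [HahnSeries.mem_support, HahnSeries.map_coeff] at hi
      rw [HahnSeries.mem_support]
      intro h
      exact hi (by rw [h, map_zero])
    have hx : (x.map (algebraMap ℚ R)).support ⊆ x.support := fun i hi => by
      rw [HahnSeries.mem_support, HahnSeries.map_coeff] at hi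
      rw [HahnSeries.mem_support]
      intro h
      exact hi (by rw [h, map_zero])
    rw [HahnSeries.coeff_mul_left' x.isPWO_support hx, HahnSeries.map_coeff,
      HahnSeries.coeff_mul, map_sum]
    simp only [map_mul, HahnSeries.map_coeff]
    symm
    refine Finset.sum_subset (fun p hp => ?_) fun p hp hp' => ?_
    · rw [Finset.mem_antidiagonal] at hp ⊢
      exact ⟨hp.1, hy hp.2.1, hp.2.2⟩
    · rw [Finset.mem_antidiagonal] at hp hp'
      have : (y.map (algebraMap ℚ R)).coeff p.2 = 0 := by
        by_contra h
        exact hp' ⟨hp.1, h, hp.2.2⟩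
      rw [HahnSeries.map_coeff] at this
      rw [this, mul_zero]

@[simp] lemma coeff_ratMap [Algebra ℚ R] (z : LaurentSeries ℚ) (e : ℤ) :
    (ratMap R z).coeff e = algebraMap ℚ R (z.coeff e) := rfl

/-- The coefficientwise coefficient of exponent `e`. -/
noncomputable def pr (e : ℤ) : (LaurentSeries R)⟦X⟧ →+ R⟦X⟧ := mapCoeff (coeffHom e)

@[simp] lemma coeff_pr (e : ℤ) (z : (LaurentSeries R)⟦X⟧) (n : ℕ) :
    coeff n (pr e z) = (coeff n z).coeff e := by
  simp [pr]

/-- The inclusion of constant Laurent series. -/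
noncomputable def cst : R⟦X⟧ →+* (LaurentSeries R)⟦X⟧ := PowerSeries.map HahnSeries.C

@[simp] lemma pr_cst_mul (e : ℤ) (u : R⟦X⟧) (z : (LaurentSeries R)⟦X⟧) :
    pr e (cst u * z) = u * pr e z :=
  mapCoeff_map_mul _ _ (fun r x => by
    rw [coeffHom_apply, HahnSeries.C_mul_eq_smul]; rfl) _ _

lemma ext_pr {z w : (LaurentSeries R)⟦X⟧} (h : ∀ e, pr e z = pr e w) : z = w := by
  ext n e
  rw [← coeff_pr, ← coeff_pr, h]

/-- Series without terms of exponent larger than `c`. -/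
def low (c : ℤ) : AddSubgroup (LaurentSeries R)⟦X⟧ where
  carrier := {z | ∀ e, c < e → pr e z = 0}
  add_mem' {x y} hx hy e he := by rw [map_add, hx e he, hy e he, add_zero]
  zero_mem' e _ := map_zero _
  neg_mem' {x} hx e he := by rw [map_neg, hx e he, neg_zero]

/-- Series without terms of exponent smaller than `c`. -/
def high (c : ℤ) : AddSubgroup (LaurentSeries R)⟦X⟧ where
  carrier := {z | ∀ e, e < c → pr e z = 0}
  add_mem' {x y} hx hy e he := by rw [map_add, hx e he, hy e he, add_zero]
  zero_mem' e _ := map_zero _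
  neg_mem' {x} hx e he := by rw [map_neg, hx e he, neg_zero]

lemma low_mono {c d : ℤ} (h : c ≤ d) : (low c : AddSubgroup (LaurentSeries R)⟦X⟧) ≤ low d :=
  fun _ hz e he => hz e (by omega)

lemma high_mono {c d : ℤ} (h : c ≤ d) : (high d : AddSubgroup (LaurentSeries R)⟦X⟧) ≤ high c :=
  fun _ hz e he => hz e (by omega)

lemma pr_mul_eq_zero {e : ℤ} {x y : (LaurentSeries R)⟦X⟧}
    (h : ∀ a b, a + b = e → pr a x = 0 ∨ pr b y = 0) : pr e (x * y) = 0 := by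
  ext n
  rw [coeff_pr, coeff_mul, HahnSeries.coeff_sum, map_zero]
  refine Finset.sum_eq_zero fun p _ => ?_
  rw [HahnSeries.coeff_mul]
  refine Finset.sum_eq_zero fun q hq => ?_
  rw [Finset.mem_antidiagonal] at hq
  rcases h q.1 q.2 hq.2.2 with h | h
  · rw [← coeff_pr, h]; simp
  · rw [← coeff_pr q.2, h]; simp

lemma mul_mem_low {c d : ℤ} {x y : (LaurentSeries R)⟦X⟧} (hx : x ∈ low c) (hy : y ∈ low d) :
    x * y ∈ low (c + d) := fun e he => pr_mul_eq_zero fun a b hab => by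
  by_cases h : c < a
  · exact Or.inl (hx a h)
  · exact Or.inr (hy b (by omega))

lemma mul_mem_high {c d : ℤ} {x y : (LaurentSeries R)⟦X⟧} (hx : x ∈ high c) (hy : y ∈ high d) :
    x * y ∈ high (c + d) := fun e he => pr_mul_eq_zero fun a b hab => by
  by_cases h : a < c
  · exact Or.inl (hx a h)
  · exact Or.inr (hy b (by omega))

lemma pr_C (e : ℤ) (x : LaurentSeries R) : pr e (C x) = C (x.coeff e) := by
  ext n
  rw [coeff_pr, coeff_C, coeff_C]
  split_ifs <;> simp

lemma pr_one (e : ℤ) : pr e (1 : (LaurentSeries R)⟦X⟧) = if e = 0 then 1 else 0 := by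
  rw [← map_one C, pr_C, HahnSeries.coeff_one]
  split_ifs <;> simp

lemma one_mem_low : (1 : (LaurentSeries R)⟦X⟧) ∈ low 0 := fun e he => by
  rw [pr_one, if_neg (by omega)]

lemma one_mem_high : (1 : (LaurentSeries R)⟦X⟧) ∈ high 0 := fun e he => by
  rw [pr_one, if_neg (by omega)]

lemma pow_mem_low {c : ℤ} {x : (LaurentSeries R)⟦X⟧} (hx : x ∈ low c) (i : ℕ) :
    x ^ i ∈ low (i * c) := by
  induction i with
  | zero => simpa using one_mem_low
  | succ i ih =>
    have := mul_mem_low ih hx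
    rw [pow_succ]
    convert this using 2
    push_cast; ring

lemma pow_mem_high {c : ℤ} {x : (LaurentSeries R)⟦X⟧} (hx : x ∈ high c) (i : ℕ) :
    x ^ i ∈ high (i * c) := by
  induction i with
  | zero => simpa using one_mem_high
  | succ i ih =>
    have := mul_mem_high ih hx
    rw [pow_succ]
    convert this using 2
    push_cast; ring

/-- Polynomials in `t⁻¹` as Laurent series. -/
noncomputable def polyInv : Polynomial R⟦X⟧ →+* (LaurentSeries R)⟦X⟧ :=
  Polynomial.eval₂RingHom cst (C (HahnSeries.single (-1) 1))

lemma polyInv_monomial (n : ℕ) (u : R⟦X⟧) :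
    polyInv (Polynomial.monomial n u) = cst u * C (HahnSeries.single (-n : ℤ) 1) := by
  rw [polyInv, Polynomial.coe_eval₂RingHom, Polynomial.eval₂_monomial, ← map_pow,
    HahnSeries.single_pow]
  simp

lemma pr_polyInv (e : ℤ) (P : Polynomial R⟦X⟧) :
    pr e (polyInv P) = if e ≤ 0 then P.coeff (-e).toNat else 0 := by
  induction P using Polynomial.induction_on' with
  | add p q hp hq => rw [map_add, map_add, hp, hq]; split_ifs <;> simp
  | monomial n u =>
    rw [polyInv_monomial, pr_cst_mul, pr_C, HahnSeries.coeff_single, Polynomial.coeff_monomial]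
    by_cases h : e = -n
    · subst h; simp
    · rw [if_neg h, map_zero, mul_zero]
      split_ifs with h1 h2
      · omega
      · rfl
      · rfl

lemma polyInv_tailPoly {g : ℕ} (u : Fin g → R⟦X⟧) (l : Fin g) :
    pr (-((l : ℕ) + 1 : ℕ)) (polyInv (tailPoly u)) = u l := by
  rw [pr_polyInv, if_pos (by omega), tailPoly, Polynomial.finsetSum_coeff]
  simp only [Polynomial.coeff_C_mul, Polynomial.coeff_X_pow]
  rw [Finset.sum_eq_single l]
  · simp
  · intro b _ hb
    rw [if_neg, mul_zero]
    intro h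
    apply hb
    ext
    simp at h
    omega
  · simp

lemma polyInv_tailPoly_mem_low {g : ℕ} (u : Fin g → R⟦X⟧) : polyInv (tailPoly u) ∈ low (-1) := by
  intro e he
  rw [pr_polyInv]
  split_ifs with h
  · obtain rfl : e = 0 := by omega
    simpa using Polynomial.X_dvd_iff.1 (X_dvd_tailPoly u)
  · rfl

lemma polyInv_tailPoly_mem_high {g : ℕ} (u : Fin g → R⟦X⟧) :
    polyInv (tailPoly u) ∈ high (-g) := by
  intro e he
  rw [pr_polyInv, if_pos (by omega)]
  apply Polynomial.coeff_eq_zero_of_natDegree_lt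
  have := natDegree_tailPoly_pow_le u 1
  rw [pow_one] at this
  omega

/-- Removing finitely many polar terms. -/
lemma sub_polyInv_tailPoly_mem_low {z : (LaurentSeries R)⟦X⟧} (hz : z ∈ low (-1)) (g : ℕ) :
    z - polyInv (tailPoly fun l : Fin g => pr (-((l : ℕ) + 1 : ℕ)) z) ∈ low (-g - 1) := by
  intro e he
  rw [map_sub, sub_eq_zero]
  by_cases h : -1 < e
  · rw [hz e h, polyInv_tailPoly_mem_low _ e h]
  · obtain ⟨l, hl⟩ : ∃ l : Fin g, e = -((l : ℕ) + 1 : ℕ) :=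
      ⟨⟨(-e - 1).toNat, by omega⟩, by simp; omega⟩
    rw [hl, polyInv_tailPoly]

lemma eq_polyInv_tailPoly {z : (LaurentSeries R)⟦X⟧} {g : ℕ} (hz : z ∈ low (-1))
    (hz' : z ∈ high (-g)) :
    z = polyInv (tailPoly fun l : Fin g => pr (-((l : ℕ) + 1 : ℕ)) z) := by
  refine ext_pr fun e => ?_
  by_cases h : -(g : ℤ) ≤ e
  · have := sub_polyInv_tailPoly_mem_low hz g e (by omega)
    rwa [map_sub, sub_eq_zero] at this
  · rw [hz' e (by omega), polyInv_tailPoly_mem_high _ e (by omega)]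

end LaurentSeries

end

section

namespace SubNorm
open LaurentSeries
variable {R : Type*} [CommRing R] [Algebra ℚ R] (N : SubNorm R)

lemma ps_C (ρ : NNReal) (x : R) : N.ps ρ (C x) = N x := by
  rw [ps_apply, tsum_eq_single 0]
  · simp
  · intro n hn
    rw [coeff_C, if_neg hn, N.zero, zero_mul]

lemma ls_C (r : NNReal) (hr : r ≠ 0) (x : R) : N.ls r hr (HahnSeries.C x) = N x := by
  rw [ls_apply, tsum_eq_single 0]
  · simp
  · intro n hn
    rw [HahnSeries.C_apply, HahnSeries.coeff_single_of_ne hn, N.zero, zero_mul]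

lemma ls_single_lt_top (r : NNReal) (hr : r ≠ 0) (n : ℤ) :
    N.ls r hr (HahnSeries.single n 1) < ⊤ := by
  rw [ls_apply, tsum_eq_single n]
  · rw [HahnSeries.coeff_single_same]
    refine ENNReal.mul_lt_top N.one_lt_top ?_
    rw [lt_top_iff_ne_top]
    exact ENNReal.zpow_ne_top (by simpa using hr) (by simp) _
  · intro m hm
    rw [HahnSeries.coeff_single_of_ne hm, N.zero, zero_mul]

lemma ls_ratMap_le (r : NNReal) (hr : r ≠ 0) (z : LaurentSeries ℚ) :
    N.ls r hr (ratMap R z) ≤ SubNorm.rat.ls r hr z := by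
  rw [ls_apply, ls_apply]
  refine ENNReal.tsum_le_tsum fun e => ?_
  gcongr
  rw [coeff_ratMap]
  exact N.algebraMap_le _

lemma ps_cst (r : NNReal) (hr : r ≠ 0) (ρ : NNReal) (u : R⟦X⟧) :
    (N.ls r hr).ps ρ (cst u) = N.ps ρ u := by
  rw [ps_apply, ps_apply]
  refine tsum_congr fun n => ?_
  rw [cst, PowerSeries.coeff_map, ls_C]

lemma ps_pr_le (r : NNReal) (hr : r ≠ 0) (ρ : NNReal) (e : ℤ) (z : (LaurentSeries R)⟦X⟧) :
    N.ps ρ (pr e z) * (r : ENNReal) ^ e ≤ (N.ls r hr).ps ρ z := by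
  rw [ps_apply, ps_apply, ← ENNReal.tsum_mul_right]
  refine ENNReal.tsum_le_tsum fun n => ?_
  rw [coeff_pr, mul_right_comm]
  gcongr
  exact N.coeff_le_ls r hr _ e

lemma ps_pr_lt_top (r : NNReal) (hr : r ≠ 0) (ρ : NNReal) (e : ℤ) {z : (LaurentSeries R)⟦X⟧}
    (h : (N.ls r hr).ps ρ z < ⊤) : N.ps ρ (pr e z) < ⊤ := by
  have h1 := (N.ps_pr_le r hr ρ e z).trans_lt h
  by_contra h2
  rw [not_lt_top_iff] at h2
  rw [h2, ENNReal.top_mul] at h1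
  · exact lt_irrefl _ h1
  · exact (ENNReal.zpow_pos (by simpa using hr) (by simp) _).ne'

/-- Coefficients of elements of bounded size are of bounded size. -/
lemma pr_mem_fin {r : NNReal} {hr : r ≠ 0} {ρ : NNReal} {d : R⟦X⟧} {hd : N.ps ρ d < ⊤}
    {hd' : (N.ls r hr).ps ρ (cst d) < ⊤} (e : ℤ) {z : (LaurentSeries R)⟦X⟧}
    (hz : z ∈ ((N.ls r hr).ps ρ).fin (cst d) hd') : pr e z ∈ (N.ps ρ).fin d hd := by
  obtain ⟨c, hc⟩ := hz
  refine ⟨c, ?_⟩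
  rw [← map_pow] at hc
  have := N.ps_pr_lt_top r hr ρ e hc
  rwa [pr_cst_mul] at this

lemma cst_mem_fin {r : NNReal} {hr : r ≠ 0} {ρ : NNReal} {d : R⟦X⟧} {hd : N.ps ρ d < ⊤}
    {hd' : (N.ls r hr).ps ρ (cst d) < ⊤} {z : R⟦X⟧}
    (hz : z ∈ (N.ps ρ).fin d hd) : cst z ∈ ((N.ls r hr).ps ρ).fin (cst d) hd' := by
  obtain ⟨c, hc⟩ := hz
  refine ⟨c, ?_⟩
  rw [← map_pow, ← map_mul, ps_cst]
  exact hc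

lemma polyInv_tailPoly_mem_fin {r : NNReal} {hr : r ≠ 0} {ρ : NNReal} {d : R⟦X⟧}
    {hd : N.ps ρ d < ⊤} {hd' : (N.ls r hr).ps ρ (cst d) < ⊤} {g : ℕ} {u : Fin g → R⟦X⟧}
    (hu : ∀ l, u l ∈ (N.ps ρ).fin d hd) :
    polyInv (tailPoly u) ∈ ((N.ls r hr).ps ρ).fin (cst d) hd' := by
  rw [tailPoly, map_sum]
  refine sum_mem fun l _ => ?_
  rw [Polynomial.C_mul_X_pow_eq_monomial, polyInv_monomial]
  refine mul_mem (N.cst_mem_fin (hu l)) (mem_fin_of_lt_top _ ?_)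
  rw [ps_C]
  exact N.ls_single_lt_top _ _ _

end SubNorm

end

section

namespace LaurentSeries
variable {R : Type*} [CommRing R] [Algebra ℚ R]

/-- The additive group spanned by the multiples of a set of Laurent series. -/
def spanPS (R : Type*) [CommRing R] [Algebra ℚ R] (A : Set (LaurentSeries ℚ)) :
    AddSubgroup (LaurentSeries R)⟦X⟧ :=
  AddSubgroup.closure {z | ∃ u : R⟦X⟧, ∃ x ∈ A, z = cst u * C (ratMap R x)}

lemma cst_mul_mem_spanPS {A : Set (LaurentSeries ℚ)} (u : R⟦X⟧) {x : LaurentSeries ℚ} (hx : x ∈ A) :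
    cst u * C (ratMap R x) ∈ spanPS R A := AddSubgroup.subset_closure ⟨u, x, hx, rfl⟩

lemma mul_mem_spanPS {A B D : Set (LaurentSeries ℚ)} (h : ∀ x ∈ A, ∀ y ∈ B, x * y ∈ D)
    {z w : (LaurentSeries R)⟦X⟧} (hz : z ∈ spanPS R A) (hw : w ∈ spanPS R B) :
    z * w ∈ spanPS R D := by
  induction hz using AddSubgroup.closure_induction with
  | mem z hz =>
    obtain ⟨u, x, hx, rfl⟩ := hz
    induction hw using AddSubgroup.closure_induction with
    | mem w hw =>
      obtain ⟨v, y, hy, rfl⟩ := hw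
      have := cst_mul_mem_spanPS (R := R) (u * v) (h x hx y hy)
      convert this using 1
      rw [map_mul, map_mul, map_mul]
      ring
    | zero => rw [mul_zero]; exact zero_mem _
    | add a b _ _ ha hb => rw [mul_add]; exact add_mem ha hb
    | neg a _ ha => rw [mul_neg]; exact neg_mem ha
  | zero => rw [zero_mul]; exact zero_mem _
  | add a b _ _ ha hb => rw [add_mul]; exact add_mem ha hb
  | neg a _ ha => rw [neg_mul]; exact neg_mem ha

lemma pow_mem_spanPS {A : ℕ → Set (LaurentSeries ℚ)}
    (h : ∀ i j, ∀ x ∈ A i, ∀ y ∈ A j, x * y ∈ A (i + j)) {z : (LaurentSeries R)⟦X⟧}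
    (hz : z ∈ spanPS R (A 1)) {i : ℕ} (hi : 1 ≤ i) : z ^ i ∈ spanPS R (A i) := by
  induction i, hi using Nat.le_induction with
  | base => simpa using hz
  | succ i _ ih => rw [pow_succ]; exact mul_mem_spanPS (h i 1) ih hz

lemma pr_eq_zero_of_mem_spanPS {A : Set (LaurentSeries ℚ)} {y : LaurentSeries ℚ} {e : ℤ}
    (h : ∀ x ∈ A, (y * x).coeff e = 0) {z : (LaurentSeries R)⟦X⟧} (hz : z ∈ spanPS R A) :
    pr e (C (ratMap R y) * z) = 0 := by
  induction hz using AddSubgroup.closure_induction with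
  | mem z hz =>
    obtain ⟨u, x, hx, rfl⟩ := hz
    rw [mul_left_comm, pr_cst_mul, ← map_mul, ← map_mul, pr_C, coeff_ratMap, h x hx]
    simp
  | zero => simp
  | add a b _ _ ha hb => rw [mul_add, map_add, ha, hb, add_zero]
  | neg a _ ha => rw [mul_neg, map_neg, ha, neg_zero]

omit [Algebra ℚ R] in
/-- A series whose product with `1 + Z` has poles of bounded order, and without polar terms in a
certain range, has poles of bounded order. -/
lemma mem_high_of_mul {m Z Y : (LaurentSeries R)⟦X⟧} {g M : ℕ} (hm : m * (1 + Z) = Y)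
    (hZ0 : constantCoeff Z = 0) (hZ : Z ∈ high (-M : ℤ)) (hY : Y ∈ high (-(g + M : ℕ) : ℤ))
    (hpr : ∀ l : ℕ, g < l → l ≤ g + M → pr (-l : ℤ) m = 0) : m ∈ high (-g : ℤ) := by
  have key : ∀ n, ∀ e : ℤ, e < -g → (coeff n m).coeff e = 0 := by
    intro n
    induction n using Nat.strong_induction_on with
    | _ n ih =>
    intro e he
    by_cases h : -(g + M : ℤ) ≤ e
    · have := hpr (-e).toNat (by omega) (by omega)
      rw [show (-((-e).toNat : ℤ)) = e by omega] at this
      rw [← coeff_pr, this, map_zero]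
    · have h1 : m = Y - m * Z := by rw [← hm]; ring
      rw [h1, map_sub, HahnSeries.coeff_sub, ← coeff_pr, hY e (by push_cast; omega), map_zero,
        zero_sub, neg_eq_zero, coeff_mul, HahnSeries.coeff_sum]
      refine Finset.sum_eq_zero fun p hp => ?_
      rw [Finset.HasAntidiagonal.mem_antidiagonal] at hp
      rcases Nat.eq_zero_or_pos p.2 with h0 | h0
      · rw [h0, coeff_zero_eq_constantCoeff_apply, hZ0, mul_zero, HahnSeries.coeff_zero]
      · rw [HahnSeries.coeff_mul]
        refine Finset.sum_eq_zero fun q hq => ?_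
        rw [Finset.mem_antidiagonal] at hq
        by_cases h2 : q.1 < -g
        · rw [ih p.1 (by omega) _ h2, zero_mul]
        · rw [← coeff_pr q.2, hZ q.2 (by omega), map_zero, mul_zero]
  intro e he
  ext n
  rw [coeff_pr, key n e he, map_zero]

end LaurentSeries

namespace PowerSeries
variable {S : Type*} [CommRing S] [Algebra ℚ S]

lemma X_sq_dvd_Exp_sub {z : S⟦X⟧} (hz : constantCoeff z = 0) : (X : S⟦X⟧) ^ 2 ∣ Exp z - (1 + z) := by
  simpa [Exp, Finset.sum_range_succ] using X_pow_dvd_ratComp_sub (fun i => 1 / (i.factorial : ℚ)) hz 2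

lemma X_sq_dvd_Log_sub {z : S⟦X⟧} (hz : constantCoeff z = 0) : (X : S⟦X⟧) ^ 2 ∣ Log z - z := by
  simpa [Log, Finset.sum_range_succ] using
    X_pow_dvd_ratComp_sub (fun i => (-1) ^ (i + 1) / (i : ℚ)) hz 2

end PowerSeries

namespace SubNorm
variable {R : Type*} [CommRing R] [Algebra ℚ R] (N : SubNorm R)

lemma nsmul_lt_top (k : ℕ) {x : R} (hx : N x < ⊤) : N (k • x) < ⊤ := by
  simpa using N.sum_lt_top (Finset.range k) (fun _ => x) (fun _ _ => hx)

lemma mem_fin_one {hd : N 1 < ⊤} {z : R} : z ∈ N.fin 1 hd ↔ N z < ⊤ :=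
  ⟨fun ⟨c, hc⟩ => by simpa using hc, fun h => N.mem_fin_of_lt_top h⟩

lemma det_adjugate_lt_top {n : ℕ} {E : Matrix (Fin n) (Fin n) R} (h : ∀ i j, N (E i j) < ⊤) :
    N E.det < ⊤ ∧ ∀ i j, N (E.adjugate i j) < ⊤ := by
  let T := N.fin 1 N.one_lt_top
  let E' : Matrix (Fin n) (Fin n) T := Matrix.of fun i j => ⟨E i j, N.mem_fin_of_lt_top (h i j)⟩
  have hE : E = T.val.toRingHom.mapMatrix E' := by ext; rfl
  constructor
  · rw [hE, ← RingHom.map_det, ← N.mem_fin_one (hd := N.one_lt_top)]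
    exact E'.det.2
  · intro i j
    rw [hE, ← RingHom.map_adjugate, ← N.mem_fin_one (hd := N.one_lt_top)]
    exact (E'.adjugate i j).2

end SubNorm

namespace LaurentSeries
variable {R : Type*} [CommRing R] [Algebra ℚ R]

/-- Multiplication by `-k` on the formal group: solving for the function. -/
theorem exists_function (N : SubNorm R) {A : ℕ → Set (LaurentSeries ℚ)} {b : ℕ} {r : NNReal}
    {hr : r ≠ 0} {g : ℕ}
    (hβ : ∀ l : ℕ, b ≤ l → ∃ β ∈ A 1, β.coeff (-l) = 1 ∧ ∀ n : ℕ, l < n → β.coeff (-n) = 0)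
    (hAr : ∀ x ∈ A 1, SubNorm.rat.ls r hr x < ⊤) (hg : b ≤ g + 1) (ρ : NNReal)
    {V : (LaurentSeries R)⟦X⟧} (hV0 : constantCoeff V = 0)
    (hVh : V ∈ high (-g : ℤ)) (hVN : (N.ls r hr).ps ρ V ≤ 1 / 4) (k : ℕ) :
    ∃ d : R⟦X⟧, constantCoeff d = 1 ∧ N.ps ρ d < ⊤ ∧
      ∀ hd : (N.ls r hr).ps ρ (cst d) < ⊤,
      ∃ W ∈ ((N.ls r hr).ps ρ).fin (cst d) hd, W ∈ spanPS R (A 1) ∧ X ^ 2 ∣ W ∧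
        (1 + W) * Exp (-(k • Log V)) ∈ high (-g : ℤ) := by
  set v := Exp (-(k • Log V)) with hv
  have hL0 : constantCoeff (k • Log V) = 0 := by simp
  have hvN : (N.ls r hr).ps ρ v < ⊤ :=
    SubNorm.ps_Exp_lt_top _ _ ((SubNorm.neg_le _ _).trans_lt
      (SubNorm.nsmul_lt_top _ _ (SubNorm.ps_Log_lt_top _ _ hVN)))
  have hv0 : constantCoeff v = 1 := by simp [hv]
  have hvinv : v * (1 + V) ^ k = 1 := by
    rw [← Exp_Log hV0, ← Exp_nsmul (by simp), hv, Exp_neg_mul hL0]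
  have hv2 : X ^ 2 ∣ v - (1 - k • V) := by
    have h1 := X_sq_dvd_Exp_sub (z := -(k • Log V)) (by simp)
    have h2 := (X_sq_dvd_Log_sub hV0).mul_left (k : (LaurentSeries R)⟦X⟧)
    have : v - (1 - k • V) = (v - (1 + -(k • Log V))) - k * (Log V - V) := by
      simp only [nsmul_eq_mul]; ring
    rw [this]
    exact dvd_sub h1 h2
  clear_value v
  choose β hβA hβ1 hβ0 using fun i : Fin (k * g) => hβ (g + 1 + i) (by omega)
  let E : Matrix (Fin (k * g)) (Fin (k * g)) R⟦X⟧ :=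
    Matrix.of fun i j => pr (-(g + 1 + i : ℕ)) (C (ratMap R (β j)) * v)
  have hE : ∀ i j, E i j = pr (-(g + 1 + i : ℕ)) (C (ratMap R (β j)) * v) := fun _ _ => rfl
  let e : Fin (k * g) → R⟦X⟧ := fun i => pr (-(g + 1 + i : ℕ)) v
  have he : ∀ i, e i = pr (-(g + 1 + i : ℕ)) v := fun _ => rfl
  have hβN : ∀ i, (N.ls r hr).ps ρ (C (ratMap R (β i))) < ⊤ := fun i => by
    rw [SubNorm.ps_C]
    exact (N.ls_ratMap_le r hr _).trans_lt (hAr _ (hβA i))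
  have hEN : ∀ i j, N.ps ρ (E i j) < ⊤ := fun i j =>
    N.ps_pr_lt_top r hr ρ _ (SubNorm.mul_lt_top _ (hβN j) hvN)
  have heN : ∀ i, N.ps ρ (e i) < ⊤ := fun i => N.ps_pr_lt_top r hr ρ _ hvN
  have he2 : ∀ i, X ^ 2 ∣ e i := fun i => by
    have h1 := X_pow_dvd_mapCoeff (coeffHom (-(g + 1 + i : ℕ))) hv2
    change _ ∣ pr _ _ at h1
    rwa [map_sub, map_sub, map_nsmul, pr_one, if_neg (by omega),
      hVh _ (by push_cast; omega), nsmul_zero, sub_zero, sub_zero] at h1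
  have hdet : constantCoeff E.det = 1 := by
    rw [RingHom.map_det, Matrix.det_of_isUpperTriangular]
    · refine Finset.prod_eq_one fun i _ => ?_
      rw [RingHom.mapMatrix_apply, Matrix.map_apply, hE, ← coeff_zero_eq_constantCoeff_apply,
        coeff_pr, coeff_zero_eq_constantCoeff_apply, map_mul, hv0, mul_one, constantCoeff_C,
        coeff_ratMap, hβ1, map_one]
    · intro i j hij
      rw [RingHom.mapMatrix_apply, Matrix.map_apply, hE, ← coeff_zero_eq_constantCoeff_apply,
        coeff_pr, coeff_zero_eq_constantCoeff_apply, map_mul, hv0, mul_one, constantCoeff_C,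
        coeff_ratMap, hβ0, map_zero]
      have : (j : ℕ) < i := hij
      omega
  obtain ⟨hdN, hadjN⟩ := (N.ps ρ).det_adjugate_lt_top hEN
  refine ⟨E.det, hdet, hdN, fun hd => ?_⟩
  obtain ⟨u, hu⟩ : ∃ u, E.det * u = 1 := by
    have : IsUnit E.det := isUnit_iff_constantCoeff.2 (by rw [hdet]; exact isUnit_one)
    exact this.exists_right_inv
  let w : Fin (k * g) → R⟦X⟧ := u • (E.adjugate.mulVec (-e))
  have hw : ∀ i, w i = u * ∑ j, E.adjugate i j * (-e j) := fun i => rfl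
  have hEw : E.mulVec w = -e := by
    rw [Matrix.mulVec_smul, Matrix.mulVec_mulVec, Matrix.mul_adjugate, Matrix.smul_mulVec,
      Matrix.one_mulVec, smul_smul, mul_comm u E.det, hu, one_smul]
  have hw2 : ∀ i, X ^ 2 ∣ w i := fun i => by
    rw [hw]
    exact (Finset.dvd_sum fun j _ => ((he2 j).neg_right).mul_left _).mul_left _
  have hwN : ∀ i, w i ∈ (N.ps ρ).fin E.det hdN := fun i => by
    refine ⟨1, ?_⟩
    rw [hw, pow_one, ← mul_assoc, hu, one_mul]
    exact SubNorm.sum_lt_top _ _ _ fun j _ =>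
      SubNorm.mul_lt_top _ (hadjN i j) ((SubNorm.neg_le _ _).trans_lt (heN j))
  have h1 : ((∑ i, cst (w i) * C (ratMap R (β i))) : (LaurentSeries R)⟦X⟧)
      ∈ high (-(g + k * g : ℕ) : ℤ) := by
    refine sum_mem fun i _ ε hε => ?_
    rw [pr_cst_mul, pr_C, coeff_ratMap]
    have := hβ0 i (-ε).toNat (by omega)
    rw [show (-((-ε).toNat : ℤ)) = ε by omega] at this
    rw [this]
    simp
  refine ⟨∑ i, cst (w i) * C (ratMap R (β i)), ?_, ?_, ?_, ?_⟩
  · exact sum_mem fun i _ => mul_mem (N.cst_mem_fin (hwN i)) (SubNorm.mem_fin_of_lt_top _ (hβN i))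
  · exact sum_mem fun i _ => cst_mul_mem_spanPS _ (hβA i)
  · refine Finset.dvd_sum fun i _ => Dvd.dvd.mul_right ?_ _
    have := map_dvd (cst : R⟦X⟧ →+* (LaurentSeries R)⟦X⟧) (hw2 i)
    rwa [map_pow, cst, PowerSeries.map_X] at this
  · refine mem_high_of_mul (Z := (1 + V) ^ k - 1) (M := k * g)
      (Y := 1 + ∑ i, cst (w i) * C (ratMap R (β i))) ?_ ?_ ?_ ?_ ?_
    · rw [add_sub_cancel, mul_assoc, hvinv, mul_one]
    · simp [hV0]
    · refine sub_mem ?_ (high_mono (by simp; positivity) one_mem_high)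
      have := pow_mem_high (add_mem (high_mono (by omega) one_mem_high) hVh) k
      convert this using 2
      push_cast; ring
    · exact add_mem (high_mono (by omega) one_mem_high) h1
    · intro l hl hl'
      obtain ⟨i, hi⟩ : ∃ i : Fin (k * g), l = g + 1 + i := ⟨⟨l - (g + 1), by omega⟩, by simp; omega⟩
      have h2 := congrFun hEw i
      rw [add_mul, one_mul, map_add, Finset.sum_mul, map_sum, hi, ← he]
      simp_rw [mul_assoc, pr_cst_mul, ← hE]
      rw [Matrix.mulVec, dotProduct, Pi.neg_apply] at h2
      rw [Finset.sum_congr rfl fun x _ => mul_comm (w x) (E i x), h2, add_neg_cancel]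

end LaurentSeries

end

section

namespace LaurentSeries
variable {R : Type*} [CommRing R]

lemma pr_mapCoeff_negHom (e : ℤ) (z : (LaurentSeries R)⟦X⟧) :
    pr e (mapCoeff negHom z) = if e < 0 then pr e z else 0 := by
  ext n
  rw [coeff_pr, coeff_mapCoeff, coeff_negHom]
  split_ifs <;> simp

lemma pow_sub_pow_mem_low {a b : (LaurentSeries R)⟦X⟧} {c : ℤ} (ha : a ∈ low 0) (hb : b ∈ low 0)
    (hab : a - b ∈ low c) (i : ℕ) : a ^ i - b ^ i ∈ low c := by
  induction i with
  | zero => simp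
  | succ i ih =>
    have h1 := mul_mem_low ih ha
    have h2 := mul_mem_low (pow_mem_low hb i) hab
    rw [add_zero] at h1
    rw [mul_zero, zero_add] at h2
    have := add_mem h1 h2
    convert this using 1
    ring

lemma constantCoeff_polyInv_tailPoly {g : ℕ} {x : Fin g → R⟦X⟧} (hx : ∀ l, constantCoeff (x l) = 0) :
    constantCoeff (polyInv (tailPoly x)) = 0 := by
  rw [tailPoly, map_sum, map_sum]
  refine Finset.sum_eq_zero fun l _ => ?_
  rw [Polynomial.C_mul_X_pow_eq_monomial, polyInv_monomial, map_mul, cst,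
    ← coeff_zero_eq_constantCoeff_apply (PowerSeries.map _ _), PowerSeries.coeff_map,
    coeff_zero_eq_constantCoeff_apply, hx, map_zero, zero_mul]

variable [Algebra ℚ R]

/-- Multiplication by `-k` on the formal group. -/
theorem exists_neg_nsmul (N : SubNorm R) {A : ℕ → Set (LaurentSeries ℚ)} {b : ℕ} {r : NNReal}
    {hr : r ≠ 0} {g : ℕ} {f : ℚ⟦X⟧}
    (hA : ∀ i j, ∀ x ∈ A i, ∀ y ∈ A j, x * y ∈ A (i + j))
    (hAf : ∀ i, 1 ≤ i → ∀ x ∈ A i, ((HahnSeries.ofPowerSeries ℤ ℚ f) * x).coeff (-1) = 0)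
    (hAp : ∀ i, ∀ x ∈ A i, ∀ a : ℕ, 1 ≤ a → a ≤ i → x.coeff (-a) = 0)
    (hβ : ∀ l : ℕ, b ≤ l → ∃ β ∈ A 1, β.coeff (-l) = 1 ∧ ∀ n : ℕ, l < n → β.coeff (-n) = 0)
    (hAr : ∀ x ∈ A 1, SubNorm.rat.ls r hr x < ⊤) (hg : b ≤ g + 1) (ρ : NNReal)
    {x : Fin g → R⟦X⟧} (hx : ∀ l, constantCoeff (x l) = 0)
    (hVN : (N.ls r hr).ps ρ (polyInv (tailPoly x)) ≤ 1 / 4) (k : ℕ) :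
    ∃ d : R⟦X⟧, constantCoeff d = 1 ∧ N.ps ρ d < ⊤ ∧ ∃ x' : Fin g → R⟦X⟧,
      (∀ l, X ^ 2 ∣ x' l + k • x l) ∧ (∃ c : ℕ, ∀ l, N.ps ρ (d ^ c * x' l) < ⊤) ∧
      pr (-1) (C (ratMap R (HahnSeries.ofPowerSeries ℤ ℚ f)) * Log (polyInv (tailPoly x'))) =
        -(k • pr (-1) (C (ratMap R (HahnSeries.ofPowerSeries ℤ ℚ f)) *
          Log (polyInv (tailPoly x)))) := by
  have hV0 := constantCoeff_polyInv_tailPoly hx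
  have hVx := polyInv_tailPoly x
  obtain ⟨d, hd1, hdN, hW⟩ := exists_function N hβ hAr hg ρ hV0 (polyInv_tailPoly_mem_high x) hVN k
  have hd' : (N.ls r hr).ps ρ (cst d) < ⊤ := by rwa [SubNorm.ps_cst]
  obtain ⟨W, hWfin, hWspan, hW2, hm⟩ := hW hd'
  generalize polyInv (tailPoly x) = V at *
  have hW0 : constantCoeff W = 0 := by
    rw [← X_dvd_iff]
    exact (dvd_pow_self X two_ne_zero).trans hW2
  set L := Log W - k • Log V with hL
  have hL0 : constantCoeff L = 0 := by simp [hL]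
  have hExpL : Exp L = (1 + W) * Exp (-(k • Log V)) := by
    rw [hL, sub_eq_add_neg, Exp_add (by simp) (by simp), Exp_Log hW0]
  rw [← hExpL] at hm
  have hLV : X ^ 2 ∣ L + k • V := by
    have h1 := X_sq_dvd_Log_sub hW0
    have h2 := (X_sq_dvd_Log_sub hV0).mul_left (k : (LaurentSeries R)⟦X⟧)
    have : L + k • V = (Log W - W) + W - k * (Log V - V) := by
      rw [hL]; simp only [nsmul_eq_mul]; ring
    rw [this]
    exact dvd_sub (dvd_add h1 hW2) h2
  have hLf : pr (-1) (C (ratMap R (HahnSeries.ofPowerSeries ℤ ℚ f)) * L) =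
      -(k • pr (-1) (C (ratMap R (HahnSeries.ofPowerSeries ℤ ℚ f)) * Log V)) := by
    have : pr (-1) (C (ratMap R (HahnSeries.ofPowerSeries ℤ ℚ f)) * Log W) = 0 := by
      rw [pr, mapCoeff_C_mul, Log, mapCoeff_ratComp _ _ hW0 (K := 0)]
      · simp
      · intro i _ hi
        have hi1 : 1 ≤ i := by
          rcases Nat.eq_zero_or_pos i with rfl | h
          · simp at hi
          · exact h
        rw [← mapCoeff_C_mul]
        exact pr_eq_zero_of_mem_spanPS (hAf i hi1) (pow_mem_spanPS hA hWspan hi1)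
    rw [hL, mul_sub, map_sub, this, zero_sub, mul_smul_comm, map_nsmul]
  have hLfin : ∀ a : ℕ, 1 ≤ a → pr (-a : ℤ) L ∈ (N.ps ρ).fin d hdN := by
    intro a ha
    rw [hL, map_sub, map_nsmul]
    refine sub_mem ?_ (nsmul_mem ?_ _)
    · rw [pr, Log, mapCoeff_ratComp _ _ hW0 (K := a)]
      · refine sum_mem fun i _ => Subalgebra.smul_mem _ ?_ _
        exact N.pr_mem_fin (hd' := hd') _ (pow_mem hWfin i)
      · intro i hi _
        have := pr_eq_zero_of_mem_spanPS (y := 1) (e := (-a : ℤ)) (fun x hx => by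
          rw [one_mul]; exact hAp i x hx a ha hi) (pow_mem_spanPS hA hWspan (ha.trans hi))
        rwa [map_one, map_one, one_mul] at this
    · exact SubNorm.mem_fin_of_lt_top _ (N.ps_pr_lt_top r hr ρ _ (SubNorm.ps_Log_lt_top _ _ hVN))
  clear_value L
  set M := mapCoeff negHom L with hM
  have hMpr : ∀ a : ℕ, 1 ≤ a → pr (-a : ℤ) M = pr (-a : ℤ) L := fun a ha => by
    rw [hM, pr_mapCoeff_negHom, if_pos (by omega)]
  have hMlow : M ∈ low (-1) := fun e he => by
    rw [hM, pr_mapCoeff_negHom, if_neg (by omega)]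
  have hM0 : constantCoeff M = 0 := by
    rw [← coeff_zero_eq_constantCoeff_apply, hM, coeff_mapCoeff, coeff_zero_eq_constantCoeff_apply,
      hL0, map_zero]
  have hLMhigh : L - M ∈ high 0 := fun e he => by
    rw [map_sub, hM, pr_mapCoeff_negHom, if_pos he, sub_self]
  clear_value M
  have hExpM : Exp M = Exp L * Exp (-(L - M)) := by
    rw [← Exp_add hL0 (by simp [hL0, hM0])]
    congr 1
    ring
  have hExpMhigh : Exp M - 1 ∈ high (-g : ℤ) := by
    refine sub_mem ?_ (high_mono (by omega) one_mem_high)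
    rw [hExpM]
    have : Exp (-(L - M)) ∈ high 0 := by
      intro e he
      rw [pr, Exp, mapCoeff_ratComp _ _ (by simp [hL0, hM0]) (K := 0)]
      · simp
      · intro i _ _
        have := pow_mem_high (neg_mem hLMhigh) i
        rw [mul_zero] at this
        exact this e he
    simpa using mul_mem_high hm this
  have hpowM : ∀ i : ℕ, ∀ e : ℤ, -(i : ℤ) < e → pr e (M ^ i) = 0 := fun i e he =>
    pow_mem_low hMlow i e (by omega)
  have hprExp : ∀ e : ℤ, ∀ K : ℕ, -(K : ℤ) < e →
      pr e (Exp M) = ∑ i ∈ Finset.range K, (1 / (i.factorial : ℚ)) • pr e (M ^ i) := by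
    intro e K hK
    rw [pr, Exp, mapCoeff_ratComp _ _ hM0 (K := K)]
    intro i hi _
    exact hpowM i e (by omega)
  have hExpMlow : Exp M - 1 ∈ low (-1) := by
    intro e he
    rw [map_sub, hprExp e 1 (by omega)]
    simp
  have hV' := eq_polyInv_tailPoly hExpMlow hExpMhigh
  refine ⟨d, hd1, hdN, fun l => pr (-((l : ℕ) + 1 : ℕ)) (Exp M - 1), fun l => ?_, ?_, ?_⟩
  · have h1 : X ^ 2 ∣ (Exp M - 1) - M := by
      have := X_sq_dvd_Exp_sub hM0
      rwa [← sub_sub] at this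
    have h2 := X_pow_dvd_mapCoeff (coeffHom (-((l : ℕ) + 1 : ℕ))) h1
    have h3 := X_pow_dvd_mapCoeff (coeffHom (-((l : ℕ) + 1 : ℕ))) hLV
    have h4 := dvd_add h2 h3
    change _ ∣ pr _ _ + pr _ _ at h4
    rwa [map_sub _ _ M, map_add _ L, hMpr _ (by omega), ← add_assoc, sub_add_cancel, map_nsmul, hVx] at h4
  · apply (N.ps ρ).exists_common_exponent (hd := hdN)
    intro l
    rw [map_sub, pr_one, if_neg (by omega), sub_zero, hprExp _ (l + 2) (by omega)]
    refine sum_mem fun i _ => Subalgebra.smul_mem _ ?_ _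
    have h1 := pow_sub_pow_mem_low (low_mono (by omega) hMlow)
      (low_mono (by omega) (polyInv_tailPoly_mem_low _)) (sub_polyInv_tailPoly_mem_low hMlow g) i
      (-((l : ℕ) + 1 : ℕ)) (by have := l.2; push_cast; omega)
    rw [map_sub, sub_eq_zero] at h1
    rw [h1]
    refine N.pr_mem_fin (hd' := hd') _ (pow_mem (N.polyInv_tailPoly_mem_fin (hd := hdN) fun l => ?_) i)
    rw [hMpr _ (by omega)]
    exact hLfin _ (by omega)
  · rw [← hV', Log_Exp_sub_one hM0, ← hLf, ← sub_eq_zero, ← map_sub, ← mul_sub]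
    have h1 : C (ratMap R (HahnSeries.ofPowerSeries ℤ ℚ f)) ∈ high 0 := fun e he => by
      rw [pr_C, coeff_ratMap, PowerSeries.coeff_coe, if_pos he]
      simp
    have h2 := mul_mem_high h1 (neg_mem hLMhigh)
    rw [neg_sub] at h2
    exact h2 (-1) (by omega)

end LaurentSeries

end

section

namespace PowerSeries
variable {T : Type*} [CommRing T]

lemma X_pow_dvd_eval_X {N : ℕ} {P : Polynomial T⟦X⟧} (h : ∀ m < N, P.coeff m = 0) :
    (X : T⟦X⟧) ^ N ∣ P.eval X := by
  obtain ⟨Q, rfl⟩ := Polynomial.X_pow_dvd_iff.2 h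
  rw [Polynomial.eval_mul, Polynomial.eval_pow, Polynomial.eval_X]
  exact dvd_mul_right _ _

/-- The diagonal `z(X, X)` of a power series `z` in two variables. -/
noncomputable def diagFun (z : T⟦X⟧⟦X⟧) : T⟦X⟧ :=
  mk fun n => coeff n ((trunc (n + 1) z).eval X)

lemma X_pow_dvd_diagFun_sub (N : ℕ) (z : T⟦X⟧⟦X⟧) :
    (X : T⟦X⟧) ^ N ∣ diagFun z - (trunc N z).eval X := by
  rw [X_pow_dvd_iff]
  intro m hm
  have h : (X : T⟦X⟧) ^ (m + 1) ∣ (trunc (m + 1) z - trunc N z).eval X :=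
    X_pow_dvd_eval_X fun i hi => by
      rw [Polynomial.coeff_sub, coeff_trunc, coeff_trunc, if_pos hi, if_pos (by omega), sub_self]
  rw [Polynomial.eval_sub] at h
  have := X_pow_dvd_iff.1 h m (by omega)
  rw [map_sub] at this ⊢
  rwa [diagFun, coeff_mk]

lemma eq_diagFun {z : T⟦X⟧⟦X⟧} {w : T⟦X⟧} (h : ∀ N, (X : T⟦X⟧) ^ N ∣ w - (trunc N z).eval X) :
    w = diagFun z :=
  eq_of_forall_X_pow_dvd fun N => by
    have := dvd_sub (h N) (X_pow_dvd_diagFun_sub N z)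
    rwa [sub_sub_sub_cancel_right] at this

/-- The diagonal of a power series in two variables, as a ring homomorphism. -/
noncomputable def diag : T⟦X⟧⟦X⟧ →+* T⟦X⟧ :=
  RingHom.mk' ⟨⟨diagFun, by
    symm
    refine eq_diagFun fun N => ?_
    rcases N with _ | N
    · simp
    · rw [trunc_one, Polynomial.eval_one, sub_self]
      exact dvd_zero _⟩, fun z w => by
    symm
    refine eq_diagFun fun N => ?_
    have h1 := X_pow_dvd_diagFun_sub N z
    have h2 := X_pow_dvd_diagFun_sub N w
    have h3 : (X : T⟦X⟧) ^ N ∣ (trunc N z * trunc N w - trunc N (z * w)).eval X :=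
      X_pow_dvd_eval_X fun i hi => by
        rw [Polynomial.coeff_sub, coeff_trunc, if_pos hi, coeff_mul_eq_coeff_trunc_mul_trunc _ _ hi,
          ← Polynomial.coe_mul, Polynomial.coeff_coe, sub_self]
    rw [Polynomial.eval_sub, Polynomial.eval_mul] at h3
    have := dvd_add (dvd_add (h1.mul_right (diagFun w)) (h2.mul_left ((trunc N z).eval X))) h3
    convert this using 1
    dsimp only
    ring⟩ fun z w => by
    symm
    refine eq_diagFun fun N => ?_
    have h1 := X_pow_dvd_diagFun_sub N z
    have h2 := X_pow_dvd_diagFun_sub N w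
    have := dvd_add h1 h2
    convert this using 1
    rw [map_add, Polynomial.eval_add]
    dsimp
    ring

lemma X_pow_dvd_diag_sub (N : ℕ) (z : T⟦X⟧⟦X⟧) :
    (X : T⟦X⟧) ^ N ∣ diag z - (trunc N z).eval X := X_pow_dvd_diagFun_sub N z

lemma X_pow_dvd_diag {N : ℕ} {z : T⟦X⟧⟦X⟧} (h : (X : T⟦X⟧⟦X⟧) ^ N ∣ z) : (X : T⟦X⟧) ^ N ∣ diag z := by
  have h1 := X_pow_dvd_diag_sub N z
  have h2 : trunc N z = 0 := by
    ext1 i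
    rw [coeff_trunc, Polynomial.coeff_zero]
    split_ifs with hi
    · exact X_pow_dvd_iff.1 h i hi
    · rfl
  rwa [h2, Polynomial.eval_zero, sub_zero] at h1

lemma coeff_diag {N : ℕ} {z : T⟦X⟧⟦X⟧} (h : (X : T⟦X⟧⟦X⟧) ^ N ∣ z) :
    coeff N (diag z) = constantCoeff (coeff N z) := by
  have h1 := X_pow_dvd_iff.1 (X_pow_dvd_diag_sub (N + 1) z) N (Nat.lt_succ_self N)
  have h2 : trunc (N + 1) z = Polynomial.monomial N (coeff N z) := by
    ext1 i
    rw [coeff_trunc, Polynomial.coeff_monomial]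
    split_ifs with hi hj hj
    · rw [hj]
    · exact X_pow_dvd_iff.1 h i (by omega)
    · omega
    · rfl
  rw [map_sub, h2, Polynomial.eval_monomial, sub_eq_zero] at h1
  rw [h1, ← coeff_zero_eq_constantCoeff_apply]
  simpa using coeff_mul_X_pow (coeff N z) N 0

@[simp] lemma diag_C (c : T⟦X⟧) : diag (C c) = c := by
  symm
  refine eq_diagFun fun N => ?_
  rcases N with _ | N
  · simp
  · simp [trunc_C]

@[simp] lemma diag_X : diag (X : T⟦X⟧⟦X⟧) = X := by
  symm
  refine eq_diagFun fun N => ?_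
  rcases N with _ | _ | N
  · simp
  · have : trunc 1 (X : T⟦X⟧⟦X⟧) = 0 := by
      ext1 i
      rw [coeff_trunc]
      split_ifs with hi
      · obtain rfl : i = 0 := by omega
        simp
      · simp
    simp [this]
  · simp [trunc_X]

variable {R : Type*} [CommRing R]

/-- `∑ uₙ Xⁿ ↦ ∑ φ(uₙ) Xⁿ`. -/
noncomputable def diagMap (φ : R →+* T⟦X⟧) : R⟦X⟧ →+* T⟦X⟧ := diag.comp (PowerSeries.map φ)

lemma X_pow_dvd_diagMap (φ : R →+* T⟦X⟧) {N : ℕ} {z : R⟦X⟧} (h : (X : R⟦X⟧) ^ N ∣ z) :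
    (X : T⟦X⟧) ^ N ∣ diagMap φ z := by
  refine X_pow_dvd_diag ?_
  have := map_dvd (PowerSeries.map φ) h
  rwa [map_pow, map_X] at this

lemma coeff_diagMap (φ : R →+* T⟦X⟧) {N : ℕ} {z : R⟦X⟧} (h : (X : R⟦X⟧) ^ N ∣ z) :
    coeff N (diagMap φ z) = constantCoeff (φ (coeff N z)) := by
  rw [diagMap, RingHom.comp_apply, coeff_diag, PowerSeries.coeff_map]
  have := map_dvd (PowerSeries.map φ) h
  rwa [map_pow, map_X] at this

@[simp] lemma diagMap_X (φ : R →+* T⟦X⟧) : diagMap φ X = X := by simp [diagMap]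

@[simp] lemma diagMap_C (φ : R →+* T⟦X⟧) (r : R) : diagMap φ (C r) = φ r := by simp [diagMap]

lemma X_pow_dvd_diagMap_sub (φ : R →+* T⟦X⟧) (N : ℕ) (z : R⟦X⟧) :
    (X : T⟦X⟧) ^ N ∣ diagMap φ z - ∑ i ∈ Finset.range N, φ (coeff i z) * X ^ i := by
  have := X_pow_dvd_diag_sub N (PowerSeries.map φ z)
  rw [Polynomial.eval, eval₂_trunc_eq_sum_range] at this
  simpa [diagMap] using this

end PowerSeries

end

section

section
variable {R : Type*} [CommRing R]

lemma tailPoly_mul {g : ℕ} (c : R) (u : Fin g → R) :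
    tailPoly (fun l => c * u l) = Polynomial.C c * tailPoly u := by
  simp only [tailPoly, Finset.mul_sum, map_mul, mul_assoc]

lemma Polynomial.moment_C_mul (c : ℕ → R) (r : R) (P : Polynomial R) :
    Polynomial.moment c (Polynomial.C r * P) = r * Polynomial.moment c P := by
  rw [← Polynomial.smul_eq_C_mul, map_smul, smul_eq_mul]

lemma coeff_zero_tailPoly_pow {g : ℕ} (u : Fin g → R) {n : ℕ} (hn : 1 ≤ n) :
    (tailPoly u ^ n).coeff 0 = 0 := by
  rw [← Polynomial.X_dvd_iff]
  exact (X_dvd_tailPoly u).trans (dvd_pow_self _ (by omega))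
end

lemma PowerSeries.X_pow_dvd_mapCoeff_ratComp_sub {L R : Type*} [CommRing L] [CommRing R] [Algebra ℚ L]
    [Algebra ℚ R] (φ : L →+ R) (c : ℕ → ℚ) {z : L⟦X⟧} (hz : constantCoeff z = 0) (N : ℕ) :
    (X : R⟦X⟧) ^ N ∣ mapCoeff φ (ratComp c z) - ∑ i ∈ Finset.range N, c i • mapCoeff φ (z ^ i) := by
  have h := X_pow_dvd_mapCoeff φ (X_pow_dvd_ratComp_sub c hz N)
  rw [map_sub, map_sum] at h
  simpa only [map_rat_smul (mapCoeff φ)] using h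

namespace LaurentSeries
variable {R : Type*} [CommRing R] [Algebra ℚ R]

/-- The coefficient of `T⁻¹` in `f(T) z`. -/
noncomputable def residue (R : Type*) [CommRing R] [Algebra ℚ R] (f : ℚ⟦X⟧) :
    (LaurentSeries R)⟦X⟧ →+ R⟦X⟧ :=
  mapCoeff ((coeffHom (-1)).comp (AddMonoidHom.mulLeft (ratMap R (HahnSeries.ofPowerSeries ℤ ℚ f))))

lemma residue_apply (f : ℚ⟦X⟧) (z : (LaurentSeries R)⟦X⟧) :
    residue R f z = pr (-1) (C (ratMap R (HahnSeries.ofPowerSeries ℤ ℚ f)) * z) :=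
  (mapCoeff_C_mul _ _ _).symm

lemma residue_polyInv_monomial (a : ℕ → ℚ) {e : ℕ} (he : 1 ≤ e) (u : R⟦X⟧) :
    residue R (mk fun k => a (k + 1)) (polyInv (Polynomial.monomial e u)) = u * algebraMap ℚ R⟦X⟧ (a e) := by
  rw [residue_apply, polyInv_monomial, mul_left_comm, ← map_mul, pr_cst_mul, pr_C]
  congr 1
  rw [IsScalarTower.algebraMap_apply ℚ R R⟦X⟧, PowerSeries.algebraMap_apply, Algebra.algebraMap_self, RingHom.id_apply]
  obtain ⟨e, rfl⟩ := Nat.exists_eq_add_of_le' he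
  rw [show (-1 : ℤ) = (e : ℤ) + -((e + 1 : ℕ) : ℤ) by push_cast; ring, HahnSeries.coeff_mul_single_add,
    mul_one, coeff_ratMap, HahnSeries.ofPowerSeries_apply_coeff, coeff_mk]

lemma residue_polyInv (a : ℕ → ℚ) {P : Polynomial R⟦X⟧} (hP : P.coeff 0 = 0) :
    residue R (mk fun k => a (k + 1)) (polyInv P) =
      Polynomial.moment (fun e => algebraMap ℚ R⟦X⟧ (a e)) P := by
  rw [P.as_sum_support, map_sum, map_sum, map_sum]
  refine Finset.sum_congr rfl fun e he => ?_
  rw [Polynomial.moment_monomial, residue_polyInv_monomial]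
  by_contra h
  obtain rfl : e = 0 := by omega
  exact (Polynomial.mem_support_iff.1 he) hP

lemma residue_Log {g : ℕ} (a : ℕ → ℚ) {x : Fin g → R⟦X⟧} (hx : ∀ l, constantCoeff (x l) = 0) (N : ℕ) :
    (X : R⟦X⟧) ^ N ∣ residue R (mk fun k => a (k + 1)) (Log (polyInv (tailPoly x))) -
      ∑ i ∈ Finset.range N, ((-1) ^ (i + 1) / i : ℚ) •
        Polynomial.moment (fun e => algebraMap ℚ R⟦X⟧ (a e)) (tailPoly x ^ i) := by
  have h := X_pow_dvd_mapCoeff_ratComp_sub ((coeffHom (-1)).comp (AddMonoidHom.mulLeft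
    (ratMap R (HahnSeries.ofPowerSeries ℤ ℚ (mk fun k => a (k + 1))))))
    (fun i => (-1) ^ (i + 1) / (i : ℚ)) (constantCoeff_polyInv_tailPoly hx) N
  refine h.trans (dvd_of_eq ?_)
  refine congrArg₂ _ rfl (Finset.sum_congr rfl fun i _ => ?_)
  rw [← residue, ← map_pow]
  rcases Nat.eq_zero_or_pos i with rfl | hi
  · simp
  · rw [residue_polyInv _ (coeff_zero_tailPoly_pow x hi)]

/-- Substitution in `momentLog`. -/
theorem diagMap_momentLog (a : ℕ → ℚ) {g : ℕ} (ξ : Fin g → R⟦X⟧) :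
    diagMap (MvPolynomial.aeval ξ : MvPolynomial (Fin g) ℚ →ₐ[ℚ] R⟦X⟧).toRingHom (momentLog a g) =
      residue R (mk fun k => a (k + 1)) (Log (polyInv (tailPoly fun l => X * ξ l))) := by
  refine eq_of_forall_X_pow_dvd fun N => ?_
  have h1 := X_pow_dvd_diagMap_sub
    (MvPolynomial.aeval ξ : MvPolynomial (Fin g) ℚ →ₐ[ℚ] R⟦X⟧).toRingHom N (momentLog a g)
  have h2 := residue_Log a (x := fun l => X * ξ l) (fun l => by simp) N
  have h3 : ∀ i, (MvPolynomial.aeval ξ : MvPolynomial (Fin g) ℚ →ₐ[ℚ] R⟦X⟧).toRingHom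
      (coeff i (momentLog a g)) * X ^ i = ((-1) ^ (i + 1) / i : ℚ) •
        Polynomial.moment (fun e => algebraMap ℚ R⟦X⟧ (a e)) ((tailPoly fun l => X * ξ l) ^ i) := by
    intro i
    rw [momentLog, coeff_mk, AlgHom.toRingHom_eq_coe, RingHom.coe_coe, map_smul, smul_mul_assoc, tailPoly_mul,
      mul_pow, ← map_pow, Polynomial.moment_C_mul, mul_comm, momentPoly,
      ← RingHom.coe_coe, Polynomial.map_moment, Polynomial.map_pow, map_tailPoly]
    simp
  rw [Finset.sum_congr rfl fun i _ => h3 i] at h1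
  have := dvd_sub h1 h2
  rwa [sub_sub_sub_cancel_right] at this

end LaurentSeries

end

section

section
variable {σ : Type*}

lemma MvPolynomial.IsHomogeneous.aeval_mul_X {R : Type*} [CommRing R] {F : MvPolynomial σ R} {N : ℕ}
    (hF : F.IsHomogeneous N) (c : R) :
    MvPolynomial.aeval (fun l => MvPolynomial.C c * MvPolynomial.X l : σ → MvPolynomial σ R) F =
      MvPolynomial.C (c ^ N) * F := by
  conv_lhs => rw [F.as_sum]
  conv_rhs => rw [F.as_sum]
  rw [map_sum, Finset.mul_sum]
  refine Finset.sum_congr rfl fun m hm => ?_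
  rw [MvPolynomial.aeval_monomial, MvPolynomial.algebraMap_eq]
  simp only [mul_pow]
  rw [Finsupp.prod_mul]
  have h1 : (m.prod fun _ e => (MvPolynomial.C c : MvPolynomial σ R) ^ e) = MvPolynomial.C (c ^ N) := by
    rw [Finsupp.prod, Finset.prod_pow_eq_pow_sum, map_pow]
    congr 1
    by_contra h
    exact MvPolynomial.mem_support_iff.1 hm (hF.coeff_eq_zero h)
  rw [h1, MvPolynomial.monomial_eq]
  ring

lemma PowerSeries.diagMap_C_self {R : Type*} [CommRing R] (z : R⟦X⟧) : diagMap (C : R →+* R⟦X⟧) z = z := by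
  refine eq_of_forall_X_pow_dvd fun N => ?_
  have h1 := X_pow_dvd_diagMap_sub (C : R →+* R⟦X⟧) N z
  have h2 : (X : R⟦X⟧) ^ N ∣ z - ∑ i ∈ Finset.range N, C (coeff i z) * X ^ i := by
    rw [X_pow_dvd_iff]
    intro m hm
    simp [coeff_X_pow, hm]
  have := dvd_sub h1 h2
  rwa [sub_sub_sub_cancel_right] at this

/-- The generic point. -/
noncomputable def genPoint (g : ℕ) (l : Fin g) : (MvPolynomial (Fin g) ℚ)⟦X⟧ :=
  X * C (MvPolynomial.X l)

lemma constantCoeff_genPoint {g : ℕ} (l : Fin g) : constantCoeff (genPoint g l) = 0 := by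
  simp [genPoint]

lemma momentLog_eq_residue (a : ℕ → ℚ) (g : ℕ) :
    momentLog a g = LaurentSeries.residue _ (mk fun k => a (k + 1))
      (Log (LaurentSeries.polyInv (tailPoly (genPoint g)))) := by
  have h : (MvPolynomial.aeval fun l => C (MvPolynomial.X l) :
      MvPolynomial (Fin g) ℚ →ₐ[ℚ] (MvPolynomial (Fin g) ℚ)⟦X⟧).toRingHom = C := by
    refine MvPolynomial.ringHom_ext (fun q => ?_) fun l => ?_
    · simp [IsScalarTower.algebraMap_apply ℚ (MvPolynomial (Fin g) ℚ) (MvPolynomial (Fin g) ℚ)⟦X⟧,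
        MvPolynomial.algebraMap_eq]
    · simp
  have := LaurentSeries.diagMap_momentLog a 
    (fun l : Fin g => (C (MvPolynomial.X l) : (MvPolynomial (Fin g) ℚ)⟦X⟧))
  rw [h, diagMap_C_self] at this
  exact this

lemma SubNorm.ps_X_mul_C {R : Type*} [CommRing R] [Algebra ℚ R] (N : SubNorm R) (ρ : NNReal) (w : R) :
    N.ps ρ (X * C w) = ρ * N w := by
  rw [ps_apply, tsum_eq_single 1]
  · rw [show (1 : ℕ) = 0 + 1 from rfl, coeff_succ_X_mul]
    simp [mul_comm]
  · intro n hn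
    rcases n with _ | n
    · simp [N.zero]
    · rw [coeff_succ_X_mul, coeff_C, if_neg (by omega), N.zero, zero_mul]

open LaurentSeries in
lemma SubNorm.exists_radius {R : Type*} [CommRing R] [Algebra ℚ R] (N : SubNorm R) (r : NNReal) (hr : r ≠ 0)
    {g : ℕ} {y : Fin g → R} (hy : ∀ l, N (y l) < ⊤) :
    ∃ ρ : NNReal, 0 < ρ ∧ ρ ≤ 1 ∧ (N.ls r hr).ps ρ (polyInv (tailPoly fun l => X * C (y l))) ≤ 1 / 4 := by
  have h : polyInv (tailPoly fun l => X * C (y l)) =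
      X * C (∑ l : Fin g, HahnSeries.C (y l) * HahnSeries.single (-((l : ℕ) + 1 : ℕ) : ℤ) 1) := by
    rw [tailPoly, map_sum, map_sum, Finset.mul_sum]
    refine Finset.sum_congr rfl fun l _ => ?_
    rw [Polynomial.C_mul_X_pow_eq_monomial, polyInv_monomial, cst, map_mul, map_mul, map_X, PowerSeries.map_C,
      mul_assoc]
  rw [h]
  set w : LaurentSeries R := ∑ l : Fin g, HahnSeries.C (y l) * HahnSeries.single (-((l : ℕ) + 1 : ℕ) : ℤ) 1
  have hw : N.ls r hr w < ⊤ := SubNorm.sum_lt_top _ _ _ fun l _ =>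
    (N.ls r hr).mul_lt_top (by rw [ls_C]; exact hy l) (N.ls_single_lt_top r hr _)
  lift N.ls r hr w to NNReal using hw.ne with M hM
  refine ⟨1 / (4 * (M + 1)), by positivity, ?_, ((N.ls r hr).ps_X_mul_C _ _).le.trans ?_⟩
  · rw [div_le_one (by positivity)]
    have : (0 : NNReal) ≤ M := zero_le
    nlinarith
  · rw [← hM, ← ENNReal.coe_mul]
    have : (1 / 4 : ENNReal) = ((1 / 4 : NNReal) : ENNReal) := by
      rw [ENNReal.coe_div (by norm_num)]; simp
    rw [this, ENNReal.coe_le_coe, div_mul_eq_mul_div, one_mul, div_le_div_iff₀ (by positivity) (by norm_num)]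
    nlinarith
end

end

section
open LaurentSeries

/-- `ψ` is the substitution expressing multiplication by `-k` on the formal group in terms of the
generic point. -/
structure IsNegMul (a : ℕ → ℚ) (g : ℕ) (ρ : NNReal) (k : ℕ)
    (ψ : (MvPolynomial (Fin g) ℚ)⟦X⟧ →+* (MvPolynomial (Fin g) ℚ)⟦X⟧) : Prop where
  X_pow_dvd : ∀ n z, X ^ n ∣ z → X ^ n ∣ ψ z
  coeff_eq : ∀ n z, X ^ n ∣ z → (coeff n z).IsHomogeneous n →
    coeff n (ψ z) = MvPolynomial.C ((-k : ℚ) ^ n) * coeff n z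
  map_Exp : ψ (Exp (momentLog a g)) = Exp (- momentLog a g) ^ k
  finite : ∃ d, constantCoeff d = 1 ∧ (SubNorm.mvPoly (Fin g)).ps ρ d < ⊤ ∧
    ∀ l, (SubNorm.mvPoly (Fin g)).ps ρ (d * ψ (genPoint g l)) < ⊤

theorem exists_isNegMul {a : ℕ → ℚ} (hf : IsAlgebraicPS (mk fun k => a (k + 1))) :
    ∃ b : ℕ, ∀ g : ℕ, b ≤ g + 1 → ∃ ρ : NNReal, 0 < ρ ∧ ρ ≤ 1 ∧
      (SubNorm.mvPoly (Fin g)).ps ρ (Exp (momentLog a g)) < ⊤ ∧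
      (SubNorm.mvPoly (Fin g)).ps ρ (Exp (-momentLog a g)) < ⊤ ∧
      ∀ k, ∃ ψ, IsNegMul a g ρ k ψ := by
  obtain ⟨A, b, r, hr, hA, hAf, hAp, hβ, hAr, hfr⟩ := hf.exists_filtration
  refine ⟨b, fun g hg => ?_⟩
  set N := SubNorm.mvPoly (Fin g) with hN
  obtain ⟨ρ, hρ, hρ1, hV⟩ := N.exists_radius r hr (fun l : Fin g => SubNorm.mvPoly_lt_top (MvPolynomial.X l))
  have hℓ : N.ps ρ (momentLog a g) < ⊤ := by
    rw [momentLog_eq_residue, residue_apply]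
    refine N.ps_pr_lt_top r hr ρ _ (SubNorm.mul_lt_top _ ?_ (SubNorm.ps_Log_lt_top _ _ hV))
    rw [SubNorm.ps_C]
    exact (N.ls_ratMap_le r hr _).trans_lt hfr
  have hℓ' : N.ps ρ (-momentLog a g) < ⊤ := ((N.ps ρ).neg_le _).trans_lt hℓ
  refine ⟨ρ, hρ, hρ1, N.ps_Exp_lt_top ρ hℓ, N.ps_Exp_lt_top ρ hℓ', fun k => ?_⟩
  obtain ⟨d, hd1, hdN, x', hx', ⟨c, hc⟩, hΛ⟩ := exists_neg_nsmul N hA hAf hAp hβ hAr hg ρ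
    (constantCoeff_genPoint (g := g)) hV k
  have hξ : ∀ l, ∃ ξ, x' l = X * ξ := by
    intro l
    have h1 : X ∣ x' l + k • genPoint g l := (dvd_pow_self X two_ne_zero).trans (hx' l)
    have h2 : X ∣ k • genPoint g l := dvd_nsmul_of_dvd _ (dvd_mul_right _ _)
    exact (dvd_add_left h2).1 h1
  choose ξ hξ using hξ
  have hξ0 : ∀ l, constantCoeff (ξ l) = MvPolynomial.C (-k : ℚ) * MvPolynomial.X l := by
    intro l
    have h := X_pow_dvd_iff.1 (hx' l) 1 (by norm_num)
    rw [map_add, hξ, map_nsmul, genPoint, show (1 : ℕ) = 0 + 1 from rfl, coeff_succ_X_mul, coeff_succ_X_mul] at h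
    simp only [coeff_zero_eq_constantCoeff, constantCoeff_C, nsmul_eq_mul] at h
    rw [map_neg, map_natCast]
    linear_combination h
  obtain rfl : x' = fun l => X * ξ l := funext hξ
  set φ := (MvPolynomial.aeval ξ : MvPolynomial (Fin g) ℚ →ₐ[ℚ] (MvPolynomial (Fin g) ℚ)⟦X⟧).toRingHom with hφ
  have hψℓ : diagMap φ (momentLog a g) = -(k • momentLog a g) := by
    rw [hφ, diagMap_momentLog, residue_apply, hΛ, ← residue_apply, momentLog_eq_residue]
  refine ⟨diagMap φ, fun n z => X_pow_dvd_diagMap φ, fun n z hz hh => ?_, ?_, d ^ c, ?_, ?_, fun l => ?_⟩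
  · rw [coeff_diagMap _ hz, ← hh.aeval_mul_X]
    have : (constantCoeff : (MvPolynomial (Fin g) ℚ)⟦X⟧ →+* _).comp φ =
        (MvPolynomial.aeval fun l => MvPolynomial.C (-k : ℚ) * MvPolynomial.X l :
          MvPolynomial (Fin g) ℚ →ₐ[ℚ] MvPolynomial (Fin g) ℚ).toRingHom := by
      refine MvPolynomial.ringHom_ext (fun q => ?_) fun l => ?_
      · simp [hφ, IsScalarTower.algebraMap_apply ℚ (MvPolynomial (Fin g) ℚ) (MvPolynomial (Fin g) ℚ)⟦X⟧,
          MvPolynomial.algebraMap_eq]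
      · simp [hφ, hξ0]
    exact congrArg (fun h => h (coeff n z)) this
  · rw [Exp, map_ratComp _ _ (fun n z => X_pow_dvd_diagMap φ) (constantCoeff_momentLog a g), hψℓ, ← Exp,
      ← smul_neg, Exp_nsmul]
    rw [map_neg, constantCoeff_momentLog, neg_zero]
  · simp [hd1]
  · exact SubNorm.pow_lt_top _ hdN c
  · convert hc l using 3
    simp [genPoint, hφ]

end

section
open LaurentSeries

open Matrix in
/-- A form of Siegel's lemma. -/
lemma exists_rat_solution {α β : Type*} [Fintype α] [Fintype β] (hα : 0 < Fintype.card α)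
    (hβ : Fintype.card β = 2 * Fintype.card α) (A : α → β → ℚ) (D : ℕ) (hD : 1 ≤ D)
    (hDA : ∀ i j, ∃ z : ℤ, D * A i j = z) (H : ℝ) (hH : 1 ≤ H) (hA : ∀ i j, D * |(A i j : ℝ)| ≤ H) :
    ∃ t : β → ℤ, t ≠ 0 ∧ (∀ i, ∑ j, (t j : ℚ) * A i j = 0) ∧
      ∀ j, |(t j : ℝ)| ≤ Fintype.card β * H := by
  choose z hz using hDA
  let _ : SeminormedAddCommGroup (Matrix α β ℤ) := Matrix.seminormedAddCommGroup
  obtain ⟨t, ht0, ht, htn⟩ := Int.Matrix.exists_ne_zero_int_vec_norm_le (Matrix.of z) (by omega) hα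
  refine ⟨t, ht0, fun i => ?_, fun j => ?_⟩
  · have h := congrFun ht i
    rw [Matrix.mulVec, dotProduct] at h
    have h' : (D : ℚ) * ∑ j, (t j : ℚ) * A i j = 0 := by
      rw [Finset.mul_sum, ← Int.cast_zero (R := ℚ), ← Pi.zero_apply (M := fun _ => ℤ) i, ← h, Int.cast_sum]
      refine Finset.sum_congr rfl fun j _ => ?_
      rw [mul_left_comm, hz, Int.cast_mul, Matrix.of_apply, mul_comm]
    exact (mul_eq_zero.1 h').resolve_left (by positivity)
  · have h1 : ‖t j‖ ≤ ‖t‖ := norm_le_pi_norm t j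
    rw [Int.norm_eq_abs] at h1
    refine h1.trans (htn.trans ?_)
    have hα' : (0 : ℝ) < Fintype.card α := by exact_mod_cast hα
    have e : (Fintype.card α : ℝ) / (Fintype.card β - Fintype.card α) = 1 := by
      rw [hβ]
      push_cast
      rw [div_eq_one_iff_eq] <;> linarith
    rw [e, Real.rpow_one]
    refine mul_le_mul_of_nonneg_left (max_le hH ?_) (by positivity)
    refine (Matrix.norm_le_iff (by linarith)).2 fun i j => ?_
    refine le_trans (le_of_eq ?_) (hA i j)
    rw [Int.norm_eq_abs, Matrix.of_apply, ← abs_of_nonneg (Nat.cast_nonneg (α := ℝ) D), ← abs_mul]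
    congr 1
    exact_mod_cast congrArg (fun q : ℚ => (q : ℝ)) (hz i j).symm

/-- Power series in `X` whose `n`-th coefficient is homogeneous of degree `n`. -/
def homogPS (g : ℕ) : Subring (MvPolynomial (Fin g) ℚ)⟦X⟧ where
  carrier := {z | ∀ n, (coeff n z).IsHomogeneous n}
  mul_mem' {z w} hz hw n := by
    rw [coeff_mul]
    refine MvPolynomial.IsHomogeneous.sum _ _ _ fun p hp => ?_
    rw [← Finset.HasAntidiagonal.mem_antidiagonal.1 hp]
    exact (hz _).mul (hw _)
  one_mem' n := by
    rw [coeff_one]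
    split_ifs with h
    · rw [h]; exact MvPolynomial.isHomogeneous_one _ _
    · exact MvPolynomial.isHomogeneous_zero _ _ _
  add_mem' {z w} hz hw n := by
    rw [map_add]
    exact (hz n).add (hw n)
  zero_mem' n := by
    rw [map_zero]
    exact MvPolynomial.isHomogeneous_zero _ _ _
  neg_mem' {z} hz n := by
    rw [map_neg]
    exact (hz n).neg

lemma MvPolynomial.IsHomogeneous.rat_smul {g n : ℕ} {p : MvPolynomial (Fin g) ℚ} (hp : p.IsHomogeneous n)
    (q : ℚ) : (q • p).IsHomogeneous n := by
  rw [MvPolynomial.smul_eq_C_mul]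
  exact hp.C_mul q

lemma ratComp_mem_homogPS {g : ℕ} (c : ℕ → ℚ) {z : (MvPolynomial (Fin g) ℚ)⟦X⟧} (hz : z ∈ homogPS g) :
    ratComp c z ∈ homogPS g := fun n => by
  rw [ratComp, coeff_mk]
  exact MvPolynomial.IsHomogeneous.sum _ _ _ fun i _ => (pow_mem hz i n).rat_smul _

lemma genPoint_mem_homogPS {g : ℕ} (l : Fin g) : genPoint g l ∈ homogPS g := fun n => by
  rcases n with _ | n
  · simpa [genPoint] using MvPolynomial.isHomogeneous_zero _ _ _
  · rw [genPoint, coeff_succ_X_mul, coeff_C]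
    split_ifs with h
    · rw [h]; exact MvPolynomial.isHomogeneous_X _ _
    · exact MvPolynomial.isHomogeneous_zero _ _ _

lemma coeff_tailPoly_pow_isHomogeneous (g n e : ℕ) :
    (((tailPoly MvPolynomial.X : Polynomial (MvPolynomial (Fin g) ℚ)) ^ n).coeff e).IsHomogeneous n := by
  induction n generalizing e with
  | zero =>
    rw [pow_zero, Polynomial.coeff_one]
    split_ifs
    · exact MvPolynomial.isHomogeneous_one _ _
    · exact MvPolynomial.isHomogeneous_zero _ _ _
  | succ n ih =>
    rw [pow_succ, Polynomial.coeff_mul]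
    refine MvPolynomial.IsHomogeneous.sum _ _ _ fun p _ => (ih _).mul ?_
    rw [tailPoly, Polynomial.finsetSum_coeff]
    refine MvPolynomial.IsHomogeneous.sum _ _ _ fun l _ => ?_
    rw [Polynomial.coeff_C_mul_X_pow]
    split_ifs
    · exact MvPolynomial.isHomogeneous_X _ _
    · exact MvPolynomial.isHomogeneous_zero _ _ _

lemma momentLog_mem_homogPS (a : ℕ → ℚ) (g : ℕ) : momentLog a g ∈ homogPS g := fun n => by
  rw [momentLog, coeff_mk]
  refine MvPolynomial.IsHomogeneous.rat_smul ?_ _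
  rw [momentPoly, Polynomial.moment, Polynomial.lsum_apply, Polynomial.sum]
  refine MvPolynomial.IsHomogeneous.sum _ _ _ fun e _ => ?_
  simpa using (coeff_tailPoly_pow_isHomogeneous g n e).mul (MvPolynomial.isHomogeneous_C _ (a e))

end

/-- The monomials in the coordinates of the generic point. -/
noncomputable def genMon (g : ℕ) (α : Fin g → ℕ) : (MvPolynomial (Fin g) ℚ)⟦X⟧ :=
  ∏ l, genPoint g l ^ α l

lemma genMon_eq {g : ℕ} (α : Fin g → ℕ) :
    genMon g α = X ^ (∑ l, α l) * C (∏ l, MvPolynomial.X l ^ α l) := by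
  simp only [genMon, genPoint, mul_pow, Finset.prod_mul_distrib, map_prod, map_pow, Finset.prod_pow_eq_pow_sum]

lemma genMon_mem_homogPS {g : ℕ} (α : Fin g → ℕ) : genMon g α ∈ homogPS g :=
  prod_mem fun l _ => pow_mem (genPoint_mem_homogPS l) _

lemma coeff_genMon_mul_integral {g N : ℕ} {Δ : ℕ} {z : (MvPolynomial (Fin g) ℚ)⟦X⟧}
    (h : ∀ i ≤ N, ∃ u : MvPolynomial (Fin g) ℤ, (Δ : MvPolynomial (Fin g) ℚ) * coeff i z =
      MvPolynomial.map (Int.castRingHom ℚ) u) (α : Fin g → ℕ) {i : ℕ} (hi : i ≤ N) :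
    ∃ u : MvPolynomial (Fin g) ℤ, (Δ : MvPolynomial (Fin g) ℚ) * coeff i (genMon g α * z) =
      MvPolynomial.map (Int.castRingHom ℚ) u := by
  rw [genMon_eq, mul_assoc, coeff_X_pow_mul', coeff_C_mul]
  split_ifs with hα
  · obtain ⟨u, hu⟩ := h (i - ∑ l, α l) (by omega)
    refine ⟨(∏ l, MvPolynomial.X l ^ α l) * u, ?_⟩
    rw [mul_left_comm, hu, map_mul, map_prod]
    simp
  · exact ⟨0, by simp⟩

lemma SubNorm.ps_genPoint_le {g : ℕ} {ρ : NNReal} (hρ : ρ ≤ 1) (l : Fin g) :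
    (SubNorm.mvPoly (Fin g)).ps ρ (genPoint g l) ≤ 1 := by
  have h : SubNorm.mvPoly (Fin g) (MvPolynomial.X l) ≤ 1 := by
    rw [mvPoly_apply, tsum_eq_single (Finsupp.single l 1)]
    · rw [MvPolynomial.coeff_X]; simp
    · intro m hm
      rw [MvPolynomial.coeff_X, if_neg hm.symm, enorm_zero]
  rw [genPoint, ps_X_mul_C]
  exact mul_le_one' (by exact_mod_cast hρ) h

lemma SubNorm.ps_genMon_le {g : ℕ} {ρ : NNReal} (hρ : ρ ≤ 1) (α : Fin g → ℕ) :
    (SubNorm.mvPoly (Fin g)).ps ρ (genMon g α) ≤ 1 := by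
  refine (SubNorm.prod_le _ _ _).trans ?_
  refine Finset.prod_le_one' fun l _ => ?_
  exact (SubNorm.pow_le _ _ _).trans (pow_le_one' (ps_genPoint_le hρ l) _)

/-- The auxiliary function. -/
noncomputable def auxFun (a : ℕ → ℚ) {g E m : ℕ} (t : (Fin g → Fin E) × Fin m → ℤ) :
    (MvPolynomial (Fin g) ℚ)⟦X⟧ :=
  ∑ p, (t p : ℚ) • (genMon g (fun l => p.1 l) * Exp (momentLog a g) ^ (p.2 : ℕ))

lemma auxFun_mem_homogPS (a : ℕ → ℚ) {g E m : ℕ} (t : (Fin g → Fin E) × Fin m → ℤ) :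
    auxFun a t ∈ homogPS g := by
  refine sum_mem fun p _ => ?_
  rw [Int.cast_smul_eq_zsmul]
  exact zsmul_mem (mul_mem (genMon_mem_homogPS _)
    (pow_mem (ratComp_mem_homogPS _ (momentLog_mem_homogPS a g)) _)) _

lemma IsNegMul.ps_map_auxFun_le {a : ℕ → ℚ} {g : ℕ} {ρ : NNReal} {k : ℕ}
    {ψ : (MvPolynomial (Fin g) ℚ)⟦X⟧ →+* (MvPolynomial (Fin g) ℚ)⟦X⟧} (hψ : IsNegMul a g ρ k ψ)
    {d : (MvPolynomial (Fin g) ℚ)⟦X⟧} {M D : NNReal} (hD : 1 ≤ D)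
    (hdM : (SubNorm.mvPoly (Fin g)).ps ρ d ≤ M)
    (hdψ : ∀ l, (SubNorm.mvPoly (Fin g)).ps ρ (d * ψ (genPoint g l)) ≤ M)
    (hY : (SubNorm.mvPoly (Fin g)).ps ρ (Exp (-momentLog a g)) ≤ D)
    {E m : ℕ} (t : (Fin g → Fin E) × Fin m → ℤ) {T : NNReal} (hT : ∀ p, ‖t p‖₊ ≤ T) :
    (SubNorm.mvPoly (Fin g)).ps ρ (d ^ (g * E) * ψ (auxFun a t)) ≤
      ((E ^ g * m * (T * (M ^ (g * E) * D ^ (k * m))) : NNReal) : ENNReal) := by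
  set N := (SubNorm.mvPoly (Fin g)).ps ρ
  have key : ∀ p : (Fin g → Fin E) × Fin m, N (d ^ (g * E) * ψ ((t p : ℚ) •
      (genMon g (fun l => p.1 l) * Exp (momentLog a g) ^ (p.2 : ℕ)))) ≤
      ((T * (M ^ (g * E) * D ^ (k * m)) : NNReal) : ENNReal) := by
    intro p
    have e : d ^ (g * E) * ψ ((t p : ℚ) • (genMon g (fun l => p.1 l) * Exp (momentLog a g) ^ (p.2 : ℕ))) =
        (t p : ℚ) • ((∏ l, (d * ψ (genPoint g l)) ^ (p.1 l : ℕ) * d ^ (E - p.1 l)) *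
          Exp (-momentLog a g) ^ (k * p.2)) := by
      have h1 : d ^ (g * E) = ∏ l : Fin g, (d ^ (p.1 l : ℕ) * d ^ (E - p.1 l)) := by
        have : ∀ l, d ^ (p.1 l : ℕ) * d ^ (E - p.1 l) = d ^ E := fun l => by
          rw [← pow_add, Nat.add_sub_cancel' (p.1 l).2.le]
        simp [this, pow_mul, mul_comm g]
      rw [map_rat_smul ψ, mul_smul_comm, map_mul, map_pow, hψ.map_Exp, ← pow_mul, genMon, map_prod, ← mul_assoc,
        h1, ← Finset.prod_mul_distrib]
      congr 3
      funext l
      rw [map_pow]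
      ring
    rw [e]
    refine (N.smul_le _ _).trans ?_
    rw [ENNReal.coe_mul, ENNReal.coe_mul]
    refine mul_le_mul' ?_ ((N.mul_le _ _).trans (mul_le_mul' ?_ ?_))
    · rw [enorm_eq_nnnorm, ENNReal.coe_le_coe]
      refine le_trans (le_of_eq ?_) (hT p)
      ext
      simp
    · refine (SubNorm.prod_le _ _ _).trans ?_
      rw [mul_comm g, pow_mul, ENNReal.coe_pow]
      have : ∀ l ∈ Finset.univ, N ((d * ψ (genPoint g l)) ^ (p.1 l : ℕ) * d ^ (E - p.1 l)) ≤ ((M ^ E : NNReal) : ENNReal) := by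
        intro l _
        refine (N.mul_le _ _).trans ((mul_le_mul' (N.pow_le _ _) (N.pow_le _ _)).trans ?_)
        refine (mul_le_mul' (pow_le_pow_left' (hdψ l) _) (pow_le_pow_left' hdM _)).trans (le_of_eq ?_)
        rw [← pow_add, Nat.add_sub_cancel' (p.1 l).2.le, ENNReal.coe_pow]
      refine (Finset.prod_le_prod' this).trans (le_of_eq ?_)
      simp
    · refine (SubNorm.pow_le _ _ _).trans ((pow_le_pow_left' hY _).trans ?_)
      rw [← ENNReal.coe_pow, ENNReal.coe_le_coe]
      exact pow_le_pow_right₀ hD (Nat.mul_le_mul_left k p.2.2.le)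
  rw [auxFun, map_sum, Finset.mul_sum]
  refine (N.sum_le _ _).trans ((Finset.sum_le_sum fun p _ => key p).trans (le_of_eq ?_))
  rw [Finset.sum_const, nsmul_eq_mul, Finset.card_univ, Fintype.card_prod, Fintype.card_fun, Fintype.card_fin,
    Fintype.card_fin, Fintype.card_fin]
  push_cast
  rfl

/-- A nonzero auxiliary function cannot vanish to high order. -/
lemma IsNegMul.le_of_ne_zero {a : ℕ → ℚ} {g : ℕ} {ρ : NNReal} {k : ℕ}
    {ψ : (MvPolynomial (Fin g) ℚ)⟦X⟧ →+* (MvPolynomial (Fin g) ℚ)⟦X⟧} (hψ : IsNegMul a g ρ k ψ)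
    {F d : (MvPolynomial (Fin g) ℚ)⟦X⟧} (hF : F ∈ homogPS g) (hF0 : F ≠ 0) {n : ℕ}
    (hn : ∀ i < n, coeff i F = 0) {C₁ : ℝ} (hC₁ : 1 ≤ C₁)
    (hcoeff_int : ∀ i, ∃ Δ : ℕ, 1 ≤ Δ ∧ (Δ : ℝ) ≤ C₁ ^ i ∧ ∃ u : MvPolynomial (Fin g) ℤ,
      (Δ : MvPolynomial (Fin g) ℚ) * coeff i F = MvPolynomial.map (Int.castRingHom ℚ) u)
    (hd : constantCoeff d = 1) {K : NNReal} (hK : (SubNorm.mvPoly (Fin g)).ps ρ (d * ψ F) ≤ K) :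
    ∃ N, n ≤ N ∧ (k * ρ / C₁) ^ N ≤ (K : ℝ) := by
  classical
  have hex : ∃ N, coeff N F ≠ 0 := by
    by_contra! h
    exact hF0 (PowerSeries.ext fun N => by rw [h, map_zero])
  set N := Nat.find hex with hN
  have hNF : coeff N F ≠ 0 := Nat.find_spec hex
  have hdvd : X ^ N ∣ F := X_pow_dvd_iff.2 fun m hm => by simpa using Nat.find_min hex hm
  refine ⟨N, ?_, ?_⟩
  · by_contra h
    exact hNF (hn N (by omega))
  obtain ⟨Δ, hΔ1, hΔC, u, hu⟩ := hcoeff_int N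
  obtain ⟨γ, hγ⟩ := MvPolynomial.ne_zero_iff.1 hNF
  have hlow : 1 ≤ (Δ : ℝ) * |((MvPolynomial.coeff γ (coeff N F) : ℚ) : ℝ)| := by
    have h1 : (Δ : ℚ) * MvPolynomial.coeff γ (coeff N F) = (MvPolynomial.coeff γ u : ℤ) := by
      have := congrArg (MvPolynomial.coeff γ) hu
      rw [MvPolynomial.coeff_map, ← map_natCast MvPolynomial.C, MvPolynomial.coeff_C_mul] at this
      simpa using this
    have h2 : MvPolynomial.coeff γ u ≠ 0 := by
      intro h0
      rw [h0, Int.cast_zero, mul_eq_zero] at h1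
      rcases h1 with h1 | h1
      · exact absurd h1 (by positivity)
      · exact hγ h1
    have h3 : (1 : ℝ) ≤ |((MvPolynomial.coeff γ u : ℤ) : ℝ)| := by exact_mod_cast Int.one_le_abs h2
    have h4 : (Δ : ℝ) * ((MvPolynomial.coeff γ (coeff N F) : ℚ) : ℝ) = ((MvPolynomial.coeff γ u : ℤ) : ℝ) := by
      exact_mod_cast congrArg (fun q : ℚ => (q : ℝ)) h1
    rwa [← h4, abs_mul, abs_of_nonneg (Nat.cast_nonneg _)] at h3
  have hcoeff : coeff N (d * ψ F) = MvPolynomial.C ((-k : ℚ) ^ N) * coeff N F := by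
    rw [← hψ.coeff_eq N F hdvd (hF N)]
    obtain ⟨w, hw⟩ := hψ.X_pow_dvd N F hdvd
    rw [hw, mul_left_comm, coeff_X_pow_mul', coeff_X_pow_mul', if_pos le_rfl, if_pos le_rfl]
    simp [hd]
  have hup : (k : ℝ) ^ N * |((MvPolynomial.coeff γ (coeff N F) : ℚ) : ℝ)| * ρ ^ N ≤ K := by
    have h1 := (mul_le_mul_left ((SubNorm.enorm_coeff_le_mvPoly (coeff N (d * ψ F)) γ)) _).trans
      (((SubNorm.mvPoly (Fin g)).coeff_le_ps ρ (d * ψ F) N).trans hK)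
    rw [hcoeff, MvPolynomial.coeff_C_mul, enorm_eq_nnnorm, ← ENNReal.coe_pow, ← ENNReal.coe_mul,
      ENNReal.coe_le_coe, ← NNReal.coe_le_coe] at h1
    refine le_trans (le_of_eq ?_) h1
    push_cast
    rw [← Rat.norm_cast_real]
    push_cast
    rw [norm_mul, norm_pow, norm_neg, Real.norm_natCast, Real.norm_eq_abs]
  have hC₁' : (0 : ℝ) < C₁ ^ N := by positivity
  rw [div_pow, mul_pow, div_le_iff₀ hC₁']
  set q := |((MvPolynomial.coeff γ (coeff N F) : ℚ) : ℝ)|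
  have hq : 0 ≤ q := abs_nonneg _
  have hk : (0 : ℝ) ≤ (k : ℝ) ^ N * (ρ : ℝ) ^ N := by positivity
  calc (k : ℝ) ^ N * (ρ : ℝ) ^ N ≤ (k : ℝ) ^ N * (ρ : ℝ) ^ N * (Δ * q) := le_mul_of_one_le_right hk hlow
    _ = ((k : ℝ) ^ N * q * ρ ^ N) * Δ := by ring
    _ ≤ K * C₁ ^ N := mul_le_mul hup hΔC (by positivity) K.2

/-- Construction of the auxiliary function by Siegel's lemma. -/
lemma exists_auxFun {a : ℕ → ℚ} {g : ℕ} {ρ : NNReal} (hρ0 : 0 < ρ) (hρ1 : ρ ≤ 1) {D : NNReal} (hD : 1 ≤ D)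
    (hY : (SubNorm.mvPoly (Fin g)).ps ρ (Exp (momentLog a g)) ≤ D) {C₁ : ℝ} (hC₁ : 1 ≤ C₁)
    (hden : ∀ n, ∃ Δ : ℕ, 1 ≤ Δ ∧ (Δ : ℝ) ≤ C₁ ^ n ∧ ∀ i, i ≤ n → ∀ j : ℕ, ∃ u : MvPolynomial (Fin g) ℤ,
      (Δ : MvPolynomial (Fin g) ℚ) * coeff i (Exp (momentLog a g) ^ j) = MvPolynomial.map (Int.castRingHom ℚ) u)
    {E m n : ℕ} (hn : 1 ≤ n) (h : E ^ g * m = 2 * n ^ g) :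
    ∃ t : (Fin g → Fin E) × Fin m → ℤ, t ≠ 0 ∧ (∀ i < n, coeff i (auxFun a t) = 0) ∧
      ∀ p, |(t p : ℝ)| ≤ (2 * n ^ g : ℕ) * (C₁ ^ (g * n) * D ^ m / ρ ^ (g * n)) := by
  classical
  obtain ⟨Δ, hΔ1, hΔC, hΔ⟩ := hden (g * n)
  set e : (Fin g → Fin n) → (Fin g →₀ ℕ) := fun γ => Finsupp.equivFunOnFinite.symm (fun l => (γ l : ℕ)) with he
  set A : (Fin g → Fin n) → (Fin g → Fin E) × Fin m → ℚ := fun γ p =>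
    MvPolynomial.coeff (e γ) (coeff (∑ l, (γ l : ℕ))
      (genMon g (fun l => p.1 l) * Exp (momentLog a g) ^ (p.2 : ℕ))) with hAdef
  have hγn : ∀ γ : Fin g → Fin n, ∑ l, (γ l : ℕ) ≤ g * n := fun γ =>
    (Finset.sum_le_sum fun l _ => (γ l).2.le).trans (by simp)
  have hρ0' : (0 : ℝ) < ρ := hρ0
  have hρ1' : (ρ : ℝ) ≤ 1 := hρ1
  have hD' : (1 : ℝ) ≤ D := hD
  have hbound : ∀ γ p, |(A γ p : ℝ)| * ρ ^ (∑ l, (γ l : ℕ)) ≤ D ^ m := by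
    intro γ p
    set N := (SubNorm.mvPoly (Fin g)).ps ρ
    set z := genMon g (fun l => p.1 l) * Exp (momentLog a g) ^ (p.2 : ℕ) with hz
    have h1 : N z ≤ (D : ENNReal) ^ m := by
      refine (N.mul_le _ _).trans ((mul_le_mul' (SubNorm.ps_genMon_le hρ1 _)
        ((N.pow_le _ _).trans (pow_le_pow_left' hY _))).trans ?_)
      rw [one_mul]
      exact pow_le_pow_right' (by exact_mod_cast hD) p.2.2.le
    have h2 := (mul_le_mul_left (SubNorm.enorm_coeff_le_mvPoly (coeff (∑ l, (γ l : ℕ)) z) (e γ)) _).trans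
      (((SubNorm.mvPoly (Fin g)).coeff_le_ps ρ z (∑ l, (γ l : ℕ))).trans h1)
    rw [enorm_eq_nnnorm, ← ENNReal.coe_pow, ← ENNReal.coe_mul, ← ENNReal.coe_pow,
      ENNReal.coe_le_coe, ← NNReal.coe_le_coe] at h2
    push_cast at h2
    rwa [← Rat.norm_cast_real, Real.norm_eq_abs] at h2
  have hH : ∀ γ p, (Δ : ℝ) * |(A γ p : ℝ)| ≤ C₁ ^ (g * n) * D ^ m / ρ ^ (g * n) := by
    intro γ p
    rw [mul_div_assoc]
    refine mul_le_mul hΔC ?_ (abs_nonneg _) (by positivity)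
    rw [le_div_iff₀ (by positivity)]
    refine le_trans ?_ (hbound γ p)
    exact mul_le_mul_of_nonneg_left (pow_le_pow_of_le_one hρ0'.le hρ1' (hγn γ)) (abs_nonneg _)
  have hH1 : 1 ≤ C₁ ^ (g * n) * (D : ℝ) ^ m / (ρ : ℝ) ^ (g * n) := by
    rw [one_le_div (by positivity)]
    exact (pow_le_one₀ hρ0'.le hρ1').trans (one_le_mul_of_one_le_of_one_le (one_le_pow₀ hC₁) (one_le_pow₀ hD'))
  have hcard : Fintype.card ((Fin g → Fin E) × Fin m) = 2 * n ^ g := by simp [h]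
  obtain ⟨t, ht0, ht, htb⟩ := exists_rat_solution (α := Fin g → Fin n) (β := (Fin g → Fin E) × Fin m)
    (by rw [Fintype.card_fun, Fintype.card_fin, Fintype.card_fin]; positivity)
    (by rw [hcard]; simp) A Δ hΔ1 (fun γ p => by
      obtain ⟨u, hu⟩ := coeff_genMon_mul_integral (fun i hi => hΔ i hi p.2) (fun l => (p.1 l : ℕ)) (hγn γ)
      refine ⟨MvPolynomial.coeff (e γ) u, ?_⟩
      have := congrArg (MvPolynomial.coeff (e γ)) hu
      rw [MvPolynomial.coeff_map, ← map_natCast MvPolynomial.C, MvPolynomial.coeff_C_mul] at this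
      simpa using this) _ hH1 hH
  refine ⟨t, ht0, fun i hi => ?_, fun p => by simpa only [hcard] using htb p⟩
  ext γ
  rw [MvPolynomial.coeff_zero]
  by_cases hγ : γ.degree = i
  · have hγl : ∀ l, γ l < n := fun l => by
      have := Finsupp.le_degree l γ
      omega
    have h1 := ht fun l => ⟨γ l, hγl l⟩
    have h2 : e (fun l => ⟨γ l, hγl l⟩) = γ := by ext l; simp [he]
    have h3 : ∑ l, γ l = i := by rw [← hγ, Finsupp.degree_eq_sum]
    rw [← h1, auxFun, map_sum, MvPolynomial.coeff_sum]
    refine Finset.sum_congr rfl fun p _ => ?_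
    rw [hAdef]
    simp only [h2, h3]
    rw [PowerSeries.coeff_smul, MvPolynomial.coeff_smul, smul_eq_mul]
  · exact MvPolynomial.IsHomogeneous.coeff_eq_zero (auxFun_mem_homogPS a t i) hγ

lemma coeff_auxFun_integral {a : ℕ → ℚ} {g E m i : ℕ} (t : (Fin g → Fin E) × Fin m → ℤ) {Δ : ℕ}
    (hΔ : ∀ i', i' ≤ i → ∀ j : ℕ, ∃ u : MvPolynomial (Fin g) ℤ, (Δ : MvPolynomial (Fin g) ℚ) *
      coeff i' (Exp (momentLog a g) ^ j) = MvPolynomial.map (Int.castRingHom ℚ) u) :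
    ∃ u : MvPolynomial (Fin g) ℤ, (Δ : MvPolynomial (Fin g) ℚ) * coeff i (auxFun a t) =
      MvPolynomial.map (Int.castRingHom ℚ) u := by
  choose u hu using fun p : (Fin g → Fin E) × Fin m =>
    coeff_genMon_mul_integral (fun i' hi' => hΔ i' hi' p.2) (fun l => (p.1 l : ℕ)) le_rfl
  refine ⟨∑ p, t p • u p, ?_⟩
  rw [auxFun, map_sum, Finset.mul_sum, map_sum]
  refine Finset.sum_congr rfl fun p _ => ?_
  rw [Int.cast_smul_eq_zsmul, map_zsmul, mul_smul_comm, hu, map_zsmul]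

lemma exists_mul_pow_lt_two_pow (K : ℝ) (s μ : ℕ) (hμ : 1 ≤ μ) :
    ∃ E : ℕ, 1 ≤ E ∧ K * ((μ * E : ℕ) : ℝ) ^ s < 2 ^ (μ * E) := by
  have h := (tendsto_pow_const_div_const_pow_of_one_lt s (one_lt_two (α := ℝ))).const_mul K
  rw [mul_zero] at h
  have h' := (h.eventually (gt_mem_nhds zero_lt_one)).and (Filter.eventually_ge_atTop 1)
  obtain ⟨E₀, hE₀⟩ := Filter.eventually_atTop.1 h'
  refine ⟨max E₀ 1, le_max_right _ _, ?_⟩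
  have h1 : E₀ ≤ μ * max E₀ 1 := (le_max_left _ _).trans (Nat.le_mul_of_pos_left _ hμ)
  have h2 := (hE₀ _ h1).1
  rwa [← mul_div_assoc, div_lt_one (by positivity)] at h2

/-- The generic point satisfies a nontrivial polynomial relation with `Exp (momentLog a g)`. -/
theorem exists_relation {a : ℕ → ℚ} (halg : IsAlgebraicPS (mk fun k => a (k + 1))) {B : ℕ}
    (ha : ∀ p : ℕ, p.Prime → B ≤ p → ∀ n, 1 ≤ n → MemPZp p (a (n * p) - a n)) :
    ∃ b : ℕ, ∀ g : ℕ, b ≤ g + 1 → ∃ E m, ∃ t : (Fin g → Fin E) × Fin m → ℤ, t ≠ 0 ∧ auxFun a t = 0 := by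
  obtain ⟨b, hb⟩ := exists_isNegMul halg
  refine ⟨b, fun g hg => ?_⟩
  obtain ⟨ρ, hρ0, hρ1, hY, hY', hψ⟩ := hb g hg
  obtain ⟨C₁, hC₁, hden⟩ := exists_denominator halg ha g
  set N := (SubNorm.mvPoly (Fin g)).ps ρ
  obtain ⟨D, hD, hYD, hYD'⟩ : ∃ D : NNReal, 1 ≤ D ∧ N (Exp (momentLog a g)) ≤ D ∧
      N (Exp (-momentLog a g)) ≤ D := by
    refine ⟨max 1 (max (N (Exp (momentLog a g))).toNNReal (N (Exp (-momentLog a g))).toNNReal), le_max_left _ _, ?_, ?_⟩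
    · rw [← ENNReal.coe_toNNReal hY.ne, ENNReal.coe_le_coe]
      exact (le_max_left _ _).trans (le_max_right _ _)
    · rw [← ENNReal.coe_toNNReal hY'.ne, ENNReal.coe_le_coe]
      exact (le_max_right _ _).trans (le_max_right _ _)
  have hρ0' : (0 : ℝ) < ρ := hρ0
  have hρ1' : (ρ : ℝ) ≤ 1 := hρ1
  have hC₁0 : 0 < C₁ := one_pos.trans_le hC₁
  set c : ℝ := ρ / C₁ with hc
  have hc0 : 0 < c := by positivity
  have hc1 : c ≤ 1 := (div_le_one hC₁0).2 (hρ1'.trans hC₁)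
  obtain ⟨k, hk⟩ := exists_nat_ge (4 / c ^ (g + 1))
  have hk4 : 4 ≤ k * c * c ^ g := by
    rw [div_le_iff₀ (by positivity)] at hk
    calc (4 : ℝ) ≤ k * c ^ (g + 1) := hk
      _ = _ := by ring
  have hk1 : 1 ≤ k * c := by
    have : k * c * c ^ g ≤ k * c := mul_le_of_le_one_right (by positivity) (pow_le_one₀ hc0.le hc1)
    linarith
  obtain ⟨ψ, hψ⟩ := hψ k
  obtain ⟨d, hd1, hdρ, hdψ⟩ := hψ.finite
  obtain ⟨M, hMd, hMψ⟩ : ∃ M : NNReal, N d ≤ M ∧ ∀ l, N (d * ψ (genPoint g l)) ≤ M := by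
    refine ⟨(N d).toNNReal + ∑ l, (N (d * ψ (genPoint g l))).toNNReal, ?_, fun l => ?_⟩
    · rw [← ENNReal.coe_toNNReal hdρ.ne, ENNReal.coe_le_coe]
      exact le_self_add
    · rw [← ENNReal.coe_toNNReal (hdψ l).ne, ENNReal.coe_le_coe]
      exact (Finset.single_le_sum (f := fun l => (N (d * ψ (genPoint g l))).toNNReal)
        (fun _ _ => zero_le) (Finset.mem_univ l)).trans le_add_self
  obtain ⟨μ, hμ1, hμ⟩ : ∃ μ : ℕ, 1 ≤ μ ∧ (M : ℝ) ^ g ≤ 2 ^ μ := by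
    obtain ⟨μ, hμ⟩ := pow_unbounded_of_one_lt ((M : ℝ) ^ g) one_lt_two
    exact ⟨μ + 1, by omega, hμ.le.trans (pow_le_pow_right₀ one_le_two (Nat.le_succ μ))⟩
  set m := 2 * μ ^ g
  obtain ⟨E, hE1, hE⟩ := exists_mul_pow_lt_two_pow (4 * (D : ℝ) ^ (m + k * m)) (2 * g) μ hμ1
  have hn : 1 ≤ μ * E := Nat.mul_pos hμ1 hE1
  have hcard : E ^ g * m = 2 * (μ * E) ^ g := by rw [mul_pow]; simp only [m]; ring
  obtain ⟨t, ht0, ht, htb⟩ := exists_auxFun hρ0 hρ1 hD hYD hC₁ hden hn hcard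
  refine ⟨E, m, t, ht0, ?_⟩
  by_contra hF0
  set n := μ * E
  set T : NNReal := (2 * n ^ g : ℕ) * (C₁.toNNReal ^ (g * n) * D ^ m / ρ ^ (g * n)) with hT
  have hTb : ∀ p, ‖t p‖₊ ≤ T := by
    intro p
    rw [← NNReal.coe_le_coe, hT]
    push_cast
    rw [Real.coe_toNNReal _ hC₁0.le]
    have := htb p
    push_cast at this
    simpa [Int.norm_eq_abs] using this
  obtain ⟨N', hN', hle⟩ := hψ.le_of_ne_zero (auxFun_mem_homogPS a t) hF0 ht hC₁ (fun i => by
    obtain ⟨Δ, h1, h2, h3⟩ := hden i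
    exact ⟨Δ, h1, h2, coeff_auxFun_integral t h3⟩) (d := d ^ (g * E)) (by rw [map_pow, hd1, one_pow])
    (hψ.ps_map_auxFun_le hD hMd hMψ hYD' t hTb)
  have hle' : (k * c) ^ n ≤ (2 * (n : ℝ) ^ g) * ((2 * (n : ℝ) ^ g) * (D ^ m / c ^ (g * n)) *
      ((M : ℝ) ^ (g * E) * (D : ℝ) ^ (k * m))) := by
    refine (pow_le_pow_right₀ hk1 hN').trans ?_
    rw [hc, ← mul_div_assoc]
    refine hle.trans (le_of_eq ?_)
    have hcardR : (E : ℝ) ^ g * m = 2 * (n : ℝ) ^ g := by exact_mod_cast hcard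
    rw [hT, NNReal.coe_mul, NNReal.coe_mul, NNReal.coe_pow, NNReal.coe_natCast, NNReal.coe_natCast, hcardR]
    push_cast
    rw [Real.coe_toNNReal _ hC₁0.le, div_pow]
    field_simp
  have hM2 : (M : ℝ) ^ (g * E) ≤ 2 ^ n := by
    rw [pow_mul]
    exact (pow_le_pow_left₀ (by positivity) hμ E).trans (le_of_eq (pow_mul 2 μ E).symm)
  have h4 : (4 : ℝ) ^ n ≤ 4 * (D : ℝ) ^ (m + k * m) * (n : ℝ) ^ (2 * g) * 2 ^ n := by
    calc (4 : ℝ) ^ n ≤ (k * c * c ^ g) ^ n := pow_le_pow_left₀ (by norm_num) hk4 n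
      _ = (k * c) ^ n * c ^ (g * n) := by rw [mul_pow, ← pow_mul]
      _ ≤ (2 * (n : ℝ) ^ g) * ((2 * (n : ℝ) ^ g) * (D ^ m / c ^ (g * n)) *
      ((M : ℝ) ^ (g * E) * (D : ℝ) ^ (k * m))) * c ^ (g * n) := by gcongr
      _ = 4 * (D : ℝ) ^ (m + k * m) * (n : ℝ) ^ (2 * g) * (M : ℝ) ^ (g * E) := by
        field_simp
        ring
      _ ≤ _ := by gcongr
  have h5 : (4 : ℝ) ^ n = 2 ^ n * 2 ^ n := by rw [← mul_pow]; norm_num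
  rw [h5] at h4
  exact absurd (le_of_mul_le_mul_right h4 (by positivity)) (not_le.2 hE)

/-- Specialisation of the coordinates of the generic point of dimension `g + 1` along the
weighted curve `(1, w, w ^ E, w ^ (E ^ 2), …)`. -/
noncomputable def weightHom (g E : ℕ) : MvPolynomial (Fin (g + 1)) ℚ →+* Polynomial ℚ :=
  MvPolynomial.eval₂Hom Polynomial.C (Fin.cons 1 fun l : Fin g => Polynomial.X ^ (E ^ (l : ℕ)))

lemma map_weightHom_genMon {g E : ℕ} (α : Fin (g + 1) → Fin E) :
    PowerSeries.map (weightHom g E) (genMon (g + 1) (fun l => α l)) =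
      X ^ (∑ l, (α l : ℕ)) * C (Polynomial.X ^ (finFunctionFinEquiv fun l => α (Fin.succ l) : ℕ)) := by
  rw [genMon_eq, map_mul, map_pow, map_X, map_C]
  congr 2
  simp [weightHom, Fin.prod_univ_succ, ← pow_mul, Finset.prod_pow_eq_pow_sum, mul_comm]

lemma X_pow_dvd_map {S T : Type*} [CommRing S] [CommRing T] (φ : S →+* T) (n : ℕ) (z : S⟦X⟧)
    (h : X ^ n ∣ z) : X ^ n ∣ PowerSeries.map φ z := by
  simpa using map_dvd (PowerSeries.map φ) h

lemma map_Exp_momentLog {g E : ℕ} (hE : 1 ≤ E) (a : ℕ → ℚ) :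
    PowerSeries.map Polynomial.constantCoeff (PowerSeries.map (weightHom g E) (Exp (momentLog a (g + 1)))) =
      Exp (mk fun n => (-1) ^ (n + 1) / n * a n : ℚ⟦X⟧) := by
  have h := map_ratComp ((PowerSeries.map Polynomial.constantCoeff).comp (PowerSeries.map (weightHom g E)))
    (fun i => 1 / (i.factorial : ℚ)) (fun n z hz => by
      rw [RingHom.comp_apply]
      exact X_pow_dvd_map _ n _ (X_pow_dvd_map _ n _ hz))
    (constantCoeff_momentLog a (g + 1))
  rw [RingHom.comp_apply, RingHom.comp_apply] at h
  rw [Exp, Exp, h]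
  congr 1
  ext n
  rw [coeff_map, coeff_map, momentLog, coeff_mk, coeff_mk, map_rat_smul (weightHom g E),
    map_rat_smul Polynomial.constantCoeff, smul_eq_mul, momentPoly, Polynomial.map_moment,
    Polynomial.map_moment, Polynomial.map_pow, Polynomial.map_pow, map_tailPoly, map_tailPoly]
  congr 1
  have h1 : tailPoly (fun l => Polynomial.constantCoeff (weightHom g E (MvPolynomial.X l))) =
      (Polynomial.X : Polynomial ℚ) := by
    rw [tailPoly, Fin.sum_univ_succ]
    have : ∀ x, 0 ≠ E ^ x := fun x => (pow_pos hE x).ne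
    simp [weightHom, this]
  have h2 : ∀ e, Polynomial.constantCoeff (weightHom g E (MvPolynomial.C (a e))) = a e := by
    simp [weightHom]
  rw [h1]
  simp only [h2]
  rw [Polynomial.X_pow_eq_monomial, Polynomial.moment_monomial, one_mul]

/-- A nontrivial relation for the generic point specialises to one in one variable. -/
lemma isAlgebraicPS_of_auxFun_eq_zero {a : ℕ → ℚ} {g E m : ℕ} {t : (Fin (g + 1) → Fin E) × Fin m → ℤ}
    (ht : t ≠ 0) (h : auxFun a t = 0) :
    IsAlgebraicPS (Exp (mk fun n => (-1) ^ (n + 1) / n * a n : ℚ⟦X⟧)) := by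
  classical
  set W : (Fin (g + 1) → Fin E) × Fin m → ℕ := fun p => finFunctionFinEquiv fun l => p.1 (Fin.succ l) with hW
  obtain ⟨p₀, hp₀, hmin⟩ : ∃ p₀, t p₀ ≠ 0 ∧ ∀ p, t p ≠ 0 → W p₀ ≤ W p := by
    obtain ⟨p, hp⟩ := Function.ne_iff.1 ht
    obtain ⟨p₀, h1, h2⟩ := Finset.exists_min_image (Finset.univ.filter fun p => t p ≠ 0) W ⟨p, by simpa using hp⟩
    exact ⟨p₀, by simpa using h1, fun p hp => h2 p (by simpa using hp)⟩
  have hE : 1 ≤ E := (Nat.zero_le _).trans_lt (p₀.1 0).2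
  set y := Exp (mk fun n => (-1) ^ (n + 1) / n * a n : ℚ⟦X⟧)
  set Y := PowerSeries.map (weightHom g E) (Exp (momentLog a (g + 1)))
  have hrel : ∑ p, (t p : ℚ) • (X ^ (∑ l, (p.1 l : ℕ)) * C (Polynomial.X ^ (W p - W p₀)) * Y ^ (p.2 : ℕ)) = 0 := by
    have h1 := congrArg (PowerSeries.map (weightHom g E)) h
    rw [map_zero, auxFun, map_sum] at h1
    have h2 : (C (Polynomial.X ^ W p₀) : (Polynomial ℚ)⟦X⟧) * ∑ p, (t p : ℚ) •
        (X ^ (∑ l, (p.1 l : ℕ)) * C (Polynomial.X ^ (W p - W p₀)) * Y ^ (p.2 : ℕ)) = 0 := by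
      rw [← h1, Finset.mul_sum]
      refine Finset.sum_congr rfl fun p _ => ?_
      by_cases hp : t p = 0
      · rw [hp, Int.cast_zero, zero_smul, zero_smul, map_zero, mul_zero]
      · rw [map_rat_smul (PowerSeries.map (weightHom g E)), map_mul, map_weightHom_genMon, mul_smul_comm]
        congr 1
        have : Polynomial.X ^ (finFunctionFinEquiv fun l => p.1 (Fin.succ l) : ℕ) =
            (Polynomial.X ^ W p₀ * Polynomial.X ^ (W p - W p₀) : Polynomial ℚ) := by
          rw [← pow_add, Nat.add_sub_cancel' (hmin p hp)]
        rw [this, map_mul, map_pow (PowerSeries.map (weightHom g E))]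
        ring
    refine (mul_eq_zero.1 h2).resolve_left fun h3 => ?_
    have := congrArg (coeff 0) h3
    simp at this
  have hrel' := congrArg (PowerSeries.map Polynomial.constantCoeff) hrel
  rw [map_zero, map_sum] at hrel'
  refine ⟨∑ p, Polynomial.monomial (p.2 : ℕ) (Polynomial.monomial (∑ l, (p.1 l : ℕ)) ((t p : ℚ) * 0 ^ (W p - W p₀))),
    ?_, ?_⟩
  · intro h0
    have h1 := congrArg (fun P => (P.coeff (p₀.2 : ℕ)).coeff (∑ l, (p₀.1 l : ℕ))) h0
    simp only [Polynomial.finsetSum_coeff, Polynomial.coeff_zero] at h1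
    rw [Finset.sum_eq_single p₀] at h1
    · simp only [Polynomial.coeff_monomial, if_true, Nat.sub_self, pow_zero, mul_one, Int.cast_eq_zero] at h1
      exact hp₀ h1
    · intro p _ hp
      rw [Polynomial.coeff_monomial]
      split_ifs with h2
      · rw [Polynomial.coeff_monomial]
        split_ifs with h3
        · by_contra h4
          obtain ⟨h5, h6⟩ := mul_ne_zero_iff.1 h4
          have h7 : W p = W p₀ := by
            have := hmin p (by exact_mod_cast h5)
            by_contra h8
            exact h6 (zero_pow (by omega))
          have h8 := finFunctionFinEquiv.injective (Fin.ext h7)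
          refine hp (Prod.ext ?_ (Fin.ext h2))
          have h9 : ∀ l : Fin g, p.1 l.succ = p₀.1 l.succ := fun l => congrFun h8 l
          funext l
          refine Fin.cases ?_ h9 l
          rw [Fin.sum_univ_succ, Fin.sum_univ_succ] at h3
          simp only [h9] at h3
          exact Fin.ext (by omega)
        · rfl
      · exact Polynomial.coeff_zero _
    · simp
  · rw [← hrel', Polynomial.eval₂_finsetSum]
    refine Finset.sum_congr rfl fun p _ => ?_
    have h1 : ∀ (e : ℕ) (q : ℚ), Polynomial.coeToPowerSeries.ringHom (Polynomial.monomial e q) = q • (X ^ e : ℚ⟦X⟧) := by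
      intro e q
      ext n
      simp [coeff_monomial, coeff_X_pow]
    have h2 : Polynomial.constantCoeff (Polynomial.X ^ (W p - W p₀) : Polynomial ℚ) = 0 ^ (W p - W p₀) := by
      rw [map_pow]
      simp
    rw [Polynomial.eval₂_monomial, h1, map_rat_smul (PowerSeries.map Polynomial.constantCoeff),
      map_mul (PowerSeries.map Polynomial.constantCoeff), map_mul (PowerSeries.map Polynomial.constantCoeff),
      map_pow (PowerSeries.map Polynomial.constantCoeff), map_pow (PowerSeries.map Polynomial.constantCoeff),
      map_X, map_C, h2, map_Exp_momentLog hE, smul_mul_assoc, mul_smul]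
    congr 1
    rw [smul_eq_C_mul]
    ring

lemma coeff_Exp_neg (a : ℕ → ℚ) (n : ℕ) :
    coeff n (Exp (mk fun n : ℕ => - (a n / n) : ℚ⟦X⟧)) =
      (-1) ^ n * coeff n (Exp (mk fun n : ℕ => (-1) ^ (n + 1) / n * a n : ℚ⟦X⟧)) := by
  have h := map_ratComp (rescale (-1 : ℚ)) (fun i => 1 / (i.factorial : ℚ))
    (z := (mk fun n : ℕ => (-1) ^ (n + 1) / n * a n : ℚ⟦X⟧)) (fun n z hz => by
      rw [X_pow_dvd_iff] at hz ⊢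
      intro m hm
      rw [coeff_rescale, hz m hm, mul_zero]) (by simp)
  have h1 : rescale (-1 : ℚ) (mk fun n : ℕ => (-1) ^ (n + 1) / n * a n : ℚ⟦X⟧) =
      (mk fun n : ℕ => - (a n / n) : ℚ⟦X⟧) := by
    ext n
    have : ((-1 : ℚ) ^ n) * (-1) ^ n = 1 := by rw [← mul_pow]; norm_num
    rw [coeff_rescale, coeff_mk, coeff_mk, pow_succ]
    linear_combination (- (a n / n)) * this
  rw [Exp, ← h1, ← h, coeff_rescale, Exp]

lemma MemZp.of_mul_pow_eq_int {p : ℕ} (hp : p.Prime) {A : ℕ} (hA : ¬ p ∣ A) {n : ℕ} {x : ℚ} {k : ℤ}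
    (h : (A : ℚ) ^ n * x = k) : MemZp p x := by
  intro hx
  have hA0 : (A : ℚ) ^ n ≠ 0 := pow_ne_zero _ (Nat.cast_ne_zero.2 fun h0 => hA (h0 ▸ dvd_zero p))
  have hx' : x = k / ((A ^ n : ℤ) : ℚ) := by
    push_cast
    rw [← h, mul_div_cancel_left₀ _ hA0]
  have h1 : (x.den : ℤ) ∣ (A : ℤ) ^ n := by
    rw [hx', ← Rat.divInt_eq_div]
    exact Rat.den_dvd _ _
  have h2 : x.den ∣ A ^ n := by exact_mod_cast h1
  exact hA (hp.dvd_of_dvd_pow (hx.trans h2))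

theorem gauss_property_of_congruences {a : ℕ → ℚ} (halg : IsAlgebraicPS (mk fun k => a (k + 1))) {B : ℕ}
    (ha : ∀ p : ℕ, p.Prime → B ≤ p → ∀ n, 1 ≤ n → MemPZp p (a (n * p) - a n)) :
    ∃ B : ℕ, ∀ p : ℕ, p.Prime → B ≤ p → ∀ n, 1 ≤ n → MemNPZp n p (a (n * p) - a n) := by
  obtain ⟨b, hb⟩ := exists_relation halg ha
  obtain ⟨E, m, t, ht, h⟩ := hb (b + 1) (by omega)
  obtain ⟨A, hA, hcoeff_int⟩ := (isAlgebraicPS_of_auxFun_eq_zero ht h).exists_integral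
  refine ⟨A + 1, fun p hp hAp n hn => gauss_of_integral hp a (fun i => ?_) hn⟩
  obtain ⟨k, hk⟩ := hcoeff_int i
  refine MemZp.of_mul_pow_eq_int hp (A := A) (n := i + 1) (k := (-1) ^ i * k)
    (fun hpA => absurd (Nat.le_of_dvd hA hpA) (by omega)) ?_
  rw [coeff_Exp_neg]
  push_cast
  rw [← hk]
  ring

/-- For a sequence `(a_n)_{n ≥ 1}` of rationals with `f(t) = ∑_{n ≥ 1} a_n t^{n-1}` algebraic
over `ℚ(t)`, the following are equivalent:
(i) for all but finitely many primes `p`, `a_{np} - a_n ∈ p ℤ_(p)` for all `n ≥ 1`;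
(ii) for all but finitely many primes `p`, `a_{np} - a_n ∈ n p ℤ_(p)` for all `n ≥ 1`. -/
theorem congruences_iff_gauss_property
    (a : ℕ → ℚ) (f : PowerSeries ℚ)
    (hf : f = PowerSeries.mk fun k => a (k + 1))
    (halg : IsAlgebraicPS f) :
    (∃ B : ℕ, ∀ p : ℕ, p.Prime → B ≤ p →
        ∀ n : ℕ, 1 ≤ n → MemPZp p (a (n * p) - a n)) ↔
      (∃ B : ℕ, ∀ p : ℕ, p.Prime → B ≤ p →
        ∀ n : ℕ, 1 ≤ n → MemNPZp n p (a (n * p) - a n)) := by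
  subst hf
  refine ⟨fun ⟨B, hB⟩ => gauss_property_of_congruences halg hB, fun ⟨B, hB⟩ => ⟨B, fun p hp hBp n hn => ?_⟩⟩
  obtain ⟨y, hy, h⟩ := hB p hp hBp n hn
  have : Fact p.Prime := ⟨hp⟩
  refine ⟨n * y, ?_, by rw [h]; ring⟩
  intro hd
  have h1 : ((n : ℚ) * y).den ∣ y.den := by simpa using Rat.mul_den_dvd (n : ℚ) y
  exact hy (hd.trans h1)
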